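/- Let d ≥ 3 be an integer. For a general pencil of plane curves of degree d over ℂ, the number of members of the pencil that admit a flex bitangent line (i.e., a line having contact order at least 3 with the curve at one point and contact order at least 2 at another, distinct, point) is exactly 3(d² + 6d − 4)(d − 3)(d − 4). -/

import Mathlib

noncomputable section

/-- The restriction of the form `F` to the line through `[v]` and `[w]`,
parametrized by `t ↦ v + t • w`, as a polynomial in `t`. -/
def linePoly (F : MvPolynomial (Fin 3) ℂ) (v w : Fin 3 → ℂ) : Polynomial ℂ :=
  MvPolynomial.aeval (fun i => Polynomial.C (v i) + Polynomial.X * Polynomial.C (w i)) F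

/-- The line through the two (projectively distinct) points `[v]`, `[w]` has contact
order at least `m` with the curve `{F = 0}` at the point `[v]`. -/
def ContactLE (F : MvPolynomial (Fin 3) ℂ) (v w : Fin 3 → ℂ) (m : ℕ) : Prop :=
  (Polynomial.X : Polynomial ℂ) ^ m ∣ linePoly F v w

/-- The member of the pencil spanned by `F` and `G` corresponding to `c ∈ ℙ¹`. -/
def pencilMember (F G : MvPolynomial (Fin 3) ℂ) (c : Projectivization ℂ (Fin 2 → ℂ)) :
    MvPolynomial (Fin 3) ℂ :=
  c.rep 0 • F + c.rep 1 • G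

/-- The coefficient vector of a pair of forms. -/
def coeffs2 (F G : MvPolynomial (Fin 3) ℂ) : (Fin 3 →₀ ℕ) ⊕ (Fin 3 →₀ ℕ) → ℂ :=
  Sum.elim (fun m => MvPolynomial.coeff m F) (fun m => MvPolynomial.coeff m G)

/-- The set of members of the pencil spanned by `F` and `G` admitting a flex bitangent
line, i.e. a line with contact order at least 3 at one point and contact order at
least 2 at another, distinct, point. -/
def flexBitangentMembers (F G : MvPolynomial (Fin 3) ℂ) :
    Set (Projectivization ℂ (Fin 2 → ℂ)) :=
  {c | ∃ v w : Fin 3 → ℂ, LinearIndependent ℂ ![v, w] ∧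
    ContactLE (pencilMember F G c) v w 3 ∧ ContactLE (pencilMember F G c) w v 2}


section part1
open MvPolynomial

noncomputable section
namespace FB

abbrev E (d : ℕ) : Type := {e : Fin 3 →₀ ℕ // e ∈ Finset.finsuppAntidiag Finset.univ d}
abbrev Sg (d : ℕ) : Type := E d ⊕ E d
abbrev Gv : Type := Fin 2 ⊕ (Fin 2 × Fin 3) ⊕ Fin 3
abbrev A (d : ℕ) : Type := MvPolynomial (Sg d) ℂ
abbrev T (d : ℕ) : Type := MvPolynomial Gv (A d)

abbrev gc (i : Fin 2) : Gv := Sum.inl i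
abbrev gp (s : Fin 2) (i : Fin 3) : Gv := Sum.inr (Sum.inl (s, i))
abbrev gu (i : Fin 3) : Gv := Sum.inr (Sum.inr i)

def grp : Gv → Fin 4
  | Sum.inl _ => 0
  | Sum.inr (Sum.inl (s, _)) => if s = 0 then 1 else 2
  | Sum.inr (Sum.inr _) => 3

def wt (g : Gv) : Fin 4 → ℤ := Pi.single (grp g) 1

section ev
variable {d : ℕ} {R : Type*} [CommRing R] [Algebra ℂ R]

def ev (φ : Sg d → R) (y : Gv → R) : T d →+* R :=
  eval₂Hom (aeval φ : A d →ₐ[ℂ] R).toRingHom y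

@[simp] lemma ev_X (φ : Sg d → R) (y : Gv → R) (g : Gv) : ev φ y (X g) = y g := by simp [ev]
@[simp] lemma ev_C (φ : Sg d → R) (y : Gv → R) (a : A d) : ev φ y (C a) = aeval φ a := by
  simp [ev]

lemma map_ev {R' : Type*} [CommRing R'] [Algebra ℂ R'] (ψ : R →ₐ[ℂ] R') (φ : Sg d → R)
    (y : Gv → R) (g : T d) : ψ (ev φ y g) = ev (fun i => ψ (φ i)) (fun i => ψ (y i)) g := by
  have : (ψ : R →+* R').comp (ev φ y) = ev (fun i => ψ (φ i)) (fun i => ψ (y i)) := by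
    apply MvPolynomial.ringHom_ext
    · intro a
      simp only [RingHom.comp_apply, ev_C, RingHom.coe_coe]
      have h2 : ψ.comp (aeval φ) = aeval (fun i => ψ (φ i)) := by
        apply MvPolynomial.algHom_ext; intro i; simp
      exact congrArg (fun f => f a) h2
    · intro i; simp
  exact congrArg (fun f => f g) this

/-- ring homs out of T that are ℂ-linear are `ev`s. -/
lemma ringHom_eq_ev (Ψ : T d →+* R) (hC : ∀ z : ℂ, Ψ (C (C z)) = algebraMap ℂ R z) :
    Ψ = ev (fun i => Ψ (C (X i))) (fun i => Ψ (X i)) := by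
  apply MvPolynomial.ringHom_ext
  · intro a
    rw [ev_C]
    have : Ψ.comp C = (aeval (fun i => Ψ (C (X i))) : A d →ₐ[ℂ] R).toRingHom := by
      apply MvPolynomial.ringHom_ext
      · intro z; simp [hC]
      · intro i; simp
    exact congrArg (fun f => f a) this
  · intro i; simp

def chi (t : Fin 4 → ℂˣ) (m : Fin 4 → ℤ) : ℂ := ((∏ i, t i ^ m i : ℂˣ) : ℂ)

def scl (t : Fin 4 → ℂˣ) (y : Gv → R) : Gv → R := fun g => (t (grp g) : ℂ) • y g

lemma chi_add (t : Fin 4 → ℂˣ) (m n : Fin 4 → ℤ) : chi t (m + n) = chi t m * chi t n := by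
  simp [chi, zpow_add, Finset.prod_mul_distrib]

lemma chi_ne_zero (t : Fin 4 → ℂˣ) (m : Fin 4 → ℤ) : chi t m ≠ 0 := Units.ne_zero _

lemma chi_zero (t : Fin 4 → ℂˣ) : chi t 0 = 1 := by simp [chi]

lemma chi_wt (t : Fin 4 → ℂˣ) (g : Gv) : chi t (wt g) = t (grp g) := by
  simp only [chi, wt]
  congr 1
  rw [Finset.prod_eq_single (grp g)]
  · simp
  · intro b _ hb; simp [Pi.single_eq_of_ne hb]
  · simp

lemma chi_weight (t : Fin 4 → ℂˣ) (e : Gv →₀ ℕ) :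
    chi t (Finsupp.weight wt e) = e.prod fun g n => ((t (grp g) : ℂ)) ^ n := by
  induction e using Finsupp.induction_linear with
  | zero => simp [chi_zero]
  | add f g hf hg =>
    rw [map_add, chi_add, hf, hg, Finsupp.prod_add_index']
    · simp
    · intros; rw [pow_add]
  | single a b =>
    rw [Finsupp.weight_single]
    have : ∀ n : ℕ, chi t (n • wt a) = (t (grp a) : ℂ) ^ n := by
      intro n
      induction n with
      | zero => simp [chi_zero]
      | succ n ih => rw [succ_nsmul, chi_add, ih, chi_wt, pow_succ]
    rw [this]; simp

lemma ev_scl_monomial (φ : Sg d → R) (y : Gv → R) (t : Fin 4 → ℂˣ) (e : Gv →₀ ℕ) (a : A d) :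
    ev φ (scl t y) (monomial e a) = chi t (Finsupp.weight wt e) • ev φ y (monomial e a) := by
  simp only [ev, coe_eval₂Hom, eval₂_monomial, chi_weight]
  have : (e.prod fun n k => (scl t y n) ^ k) =
      (e.prod fun g n => ((t (grp g) : ℂ)) ^ n) • (e.prod fun n k => y n ^ k) := by
    simp only [Finsupp.prod, scl, smul_pow]
    rw [Finset.prod_smul]
  rw [this, mul_smul_comm]

abbrev Tm (d : ℕ) (m : Fin 4 → ℤ) : Submodule (A d) (T d) := weightedHomogeneousSubmodule (A d) wt m

lemma ev_scl_hom (φ : Sg d → R) (y : Gv → R) (t : Fin 4 → ℂˣ) {m : Fin 4 → ℤ} {g : T d}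
    (hg : g ∈ Tm d m) : ev φ (scl t y) g = chi t m • ev φ y g := by
  rw [g.as_sum, map_sum, map_sum, Finset.smul_sum]
  refine Finset.sum_congr rfl fun e he => ?_
  rw [ev_scl_monomial, hg (mem_support_iff.1 he)]

lemma scl_scl (s t : Fin 4 → ℂˣ) (y : Gv → R) : scl s (scl t y) = scl (s * t) y := by
  ext g; simp [scl, mul_smul]

end ev

lemma chi_indep {V : Type*} [AddCommGroup V] [Module ℂ V] (s : Finset (Fin 4 → ℤ))
    (x : (Fin 4 → ℤ) → V) (h : ∀ t, ∑ m ∈ s, chi t m • x m = 0) : ∀ m ∈ s, x m = 0 := by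
  let ch : (Fin 4 → ℤ) → ((Fin 4 → ℂˣ) →* ℂ) := fun m =>
    { toFun := fun t => chi t m
      map_one' := by simp [chi]
      map_mul' := by intro a b; simp [chi, mul_zpow, Finset.prod_mul_distrib] }
  have hinj : Function.Injective ch := by
    intro m n hmn
    ext i
    have := congrArg (fun f : ((Fin 4 → ℂˣ) →* ℂ) => f (Pi.mulSingle i (Units.mk0 2 two_ne_zero))) hmn
    simp only [ch, MonoidHom.coe_mk, OneHom.coe_mk, chi, Units.ext_iff.symm.eq] at this
    have hp : ∀ k : Fin 4 → ℤ, ∏ j, (Pi.mulSingle i (Units.mk0 (2:ℂ) two_ne_zero) : Fin 4 → ℂˣ) j ^ k j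
        = Units.mk0 2 two_ne_zero ^ k i := by
      intro k
      rw [Finset.prod_eq_single i]
      · simp
      · intro b _ hb; simp [Pi.mulSingle_eq_of_ne hb]
      · simp
    rw [hp, hp] at this
    have h2 : ((2:ℂ)) ^ (m i) = (2:ℂ) ^ (n i) := by
      have h4 := congrArg (fun u : ℂˣ => (u : ℂ)) this
      simpa only [Units.val_zpow_eq_zpow_val, Units.val_mk0] using h4
    have h3 : ((2:ℝ)) ^ (m i) = (2:ℝ) ^ (n i) := by
      have h5 := congrArg norm h2
      simpa only [norm_zpow, Complex.norm_ofNat] using h5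
    exact zpow_right_injective₀ (by norm_num) (by norm_num) h3
  have hli : LinearIndependent ℂ (fun m => (ch m : (Fin 4 → ℂˣ) → ℂ)) :=
    (linearIndependent_monoidHom (Fin 4 → ℂˣ) ℂ).comp ch hinj
  intro m hm
  by_contra hx
  obtain ⟨ℓ, hℓ⟩ : ∃ ℓ : Module.Dual ℂ V, ℓ (x m) ≠ 0 := by
    by_contra hcon
    push Not at hcon
    exact hx ((Module.forall_dual_apply_eq_zero_iff ℂ (x m)).1 hcon)
  have := linearIndependent_iff'.1 hli s (fun m => ℓ (x m)) (by
    ext t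
    have := congrArg ℓ (h t)
    simp only [map_sum, map_smul, map_zero, smul_eq_mul] at this
    simp only [Finset.sum_apply, Pi.smul_apply, smul_eq_mul, Pi.zero_apply, ← this]
    exact Finset.sum_congr rfl fun m _ => mul_comm _ _) m hm
  exact hℓ this

section comp
variable {d : ℕ} {K : Type*} [Field K] [Algebra ℂ K]

abbrev cmp (m : Fin 4 → ℤ) (g : T d) : T d := weightedHomogeneousComponent wt m g

lemma cmp_mem (m : Fin 4 → ℤ) (g : T d) : cmp m g ∈ Tm d m :=
  weightedHomogeneousComponent_mem wt g m

lemma exists_cmp_sum (g : T d) : ∃ s : Finset (Fin 4 → ℤ), (∀ m ∉ s, cmp m g = 0) ∧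
    g = ∑ m ∈ s, cmp m g := by
  refine ⟨(weightedHomogeneousComponent_finsupp (w := wt) g).toFinset, ?_, ?_⟩
  · intro m hm
    by_contra h
    exact hm ((Set.Finite.mem_toFinset _).2 h)
  · conv_lhs => rw [← sum_weightedHomogeneousComponent wt g]
    exact finsum_eq_sum _ _

lemma cmp_of_scl (φ : Sg d → K) (y : Gv → K) (g : T d) (om : Fin 4 → ℤ) (κ : K)
    (h : ∀ t, ev φ (scl t y) g = chi t om • κ) :
    ev φ y (cmp om g) = κ ∧ ∀ m, m ≠ om → ev φ y (cmp m g) = 0 := by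
  classical
  obtain ⟨s, hs0, hs⟩ := exists_cmp_sum g
  have hs' : g = ∑ m ∈ insert om s, cmp m g := by
    by_cases ho : om ∈ s
    · rw [Finset.insert_eq_of_mem ho]; exact hs
    · rw [Finset.sum_insert ho, hs0 om ho, zero_add]; exact hs
  have key := chi_indep (insert om s)
    (fun m => ev φ y (cmp m g) - if m = om then κ else 0) (by
      intro t
      have h1 := h t
      rw [hs', map_sum] at h1
      simp only [smul_sub, Finset.sum_sub_distrib]
      rw [sub_eq_zero]
      rw [Finset.sum_congr rfl (fun m _ => (ev_scl_hom φ y t (cmp_mem m g)))] at h1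
      rw [h1]
      simp)
  refine ⟨?_, ?_⟩
  · simpa [sub_eq_zero] using key om (Finset.mem_insert_self _ _)
  · intro m hm
    by_cases hms : m ∈ insert om s
    · simpa [hm] using key m hms
    · rw [hs0 m (fun hh => hms (Finset.mem_insert_of_mem hh)), map_zero]

end comp
end FB

end

end part1

section part2
open MvPolynomial

noncomputable section
namespace FB

section pig
variable {d : ℕ}

abbrev Bi : Type := Fin 2 × Fin 3 × Fin 3 × Fin 3

def bm (d : ℕ) (β : Bi) : T d :=
  X (gc β.1) * X (gp 0 β.2.1) * X (gp 1 β.2.2.1) * X (gu β.2.2.2)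

lemma weight_wt (e : Gv →₀ ℕ) (i : Fin 4) :
    Finsupp.weight wt e i = ∑ g, (e g : ℤ) * wt g i := by
  rw [Finsupp.weight_apply, Finsupp.sum_fintype _ _ (by simp)]
  simp

lemma weight_wt0 (e : Gv →₀ ℕ) : Finsupp.weight wt e 0 = e (gc 0) + e (gc 1) := by
  simp [weight_wt, wt, grp, Fintype.sum_prod_type, Fin.sum_univ_three]
lemma weight_wt1 (e : Gv →₀ ℕ) :
    Finsupp.weight wt e 1 = e (gp 0 0) + e (gp 0 1) + e (gp 0 2) := by
  simp [weight_wt, wt, grp, Fintype.sum_prod_type, Fin.sum_univ_three]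
lemma weight_wt2 (e : Gv →₀ ℕ) :
    Finsupp.weight wt e 2 = e (gp 1 0) + e (gp 1 1) + e (gp 1 2) := by
  simp [weight_wt, wt, grp, Fintype.sum_prod_type, Fin.sum_univ_three]
lemma weight_wt3 (e : Gv →₀ ℕ) :
    Finsupp.weight wt e 3 = e (gu 0) + e (gu 1) + e (gu 2) := by
  simp [weight_wt, wt, grp, Fintype.sum_prod_type, Fin.sum_univ_three]

lemma pig_exp (M : ℕ) (e : Gv →₀ ℕ) (h : ∀ i, (3 * M : ℤ) ≤ Finsupp.weight wt e i) :
    ∃ β : Bi, M ≤ e (gc β.1) ∧ M ≤ e (gp 0 β.2.1) ∧ M ≤ e (gp 1 β.2.2.1) ∧ M ≤ e (gu β.2.2.2) := by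
  have h0 := h 0; have h1 := h 1; have h2 := h 2; have h3 := h 3
  rw [weight_wt0] at h0; rw [weight_wt1] at h1; rw [weight_wt2] at h2; rw [weight_wt3] at h3
  have a0 : ∃ i : Fin 2, M ≤ e (gc i) := by
    by_contra hc; push Not at hc; have := hc 0; have := hc 1; omega
  have a1 : ∃ i : Fin 3, M ≤ e (gp 0 i) := by
    by_contra hc; push Not at hc; have := hc 0; have := hc 1; have := hc 2; omega
  have a2 : ∃ i : Fin 3, M ≤ e (gp 1 i) := by
    by_contra hc; push Not at hc; have := hc 0; have := hc 1; have := hc 2; omega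
  have a3 : ∃ i : Fin 3, M ≤ e (gu i) := by
    by_contra hc; push Not at hc; have := hc 0; have := hc 1; have := hc 2; omega
  obtain ⟨i, hi⟩ := a0; obtain ⟨j, hj⟩ := a1; obtain ⟨k, hk⟩ := a2; obtain ⟨l, hl⟩ := a3
  exact ⟨(i, j, k, l), hi, hj, hk, hl⟩

def bexp (β : Bi) : Gv →₀ ℕ := Finsupp.single (gc β.1) 1 + Finsupp.single (gp 0 β.2.1) 1 +
  Finsupp.single (gp 1 β.2.2.1) 1 + Finsupp.single (gu β.2.2.2) 1

lemma bm_eq (β : Bi) : bm d β = monomial (bexp β) 1 := by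
  simp [bm, bexp, X, monomial_mul]

lemma bexp_le (M : ℕ) (e : Gv →₀ ℕ) (β : Bi) (h : M ≤ e (gc β.1) ∧ M ≤ e (gp 0 β.2.1) ∧
    M ≤ e (gp 1 β.2.2.1) ∧ M ≤ e (gu β.2.2.2)) : M • bexp β ≤ e := by
  obtain ⟨h0, h1, h2, h3⟩ := h
  intro g
  simp only [bexp, Finsupp.smul_apply, Finsupp.add_apply, smul_eq_mul]
  rcases g with i | ⟨s, i⟩ | i
  · by_cases hi : β.1 = i
    · subst hi; simpa using h0
    · simp [hi]
  · fin_cases s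
    · by_cases hi : β.2.1 = i
      · subst hi; simpa [Finsupp.single_apply] using h1
      · simp [hi]
    · by_cases hi : β.2.2.1 = i
      · subst hi; simpa [Finsupp.single_apply] using h2
      · simp [hi]
  · by_cases hi : β.2.2.2 = i
    · subst hi; simpa using h3
    · simp [hi]

lemma pig_mem (c : Ideal (T d)) (M : ℕ) (hM : ∀ β, bm d β ^ M ∈ c) {m : Fin 4 → ℤ}
    (hm : ∀ i, (3 * M : ℤ) ≤ m i) {x : T d} (hx : x ∈ Tm d m) : x ∈ c := by
  rw [x.as_sum]
  refine Ideal.sum_mem _ fun e he => ?_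
  have hw : Finsupp.weight wt e = m := hx (mem_support_iff.1 he)
  obtain ⟨β, hβ⟩ := pig_exp M e (by rw [hw]; exact hm)
  have hle := bexp_le M e β hβ
  have : monomial e (coeff e x) = monomial (e - M • bexp β) (coeff e x) * bm d β ^ M := by
    rw [bm_eq, monomial_pow, monomial_mul, one_pow, mul_one, tsub_add_cancel_of_le hle]
  rw [this]
  exact Ideal.mul_mem_left _ _ (hM β)

end pig

section step
variable {d : ℕ}

instance : IsNoetherianRing (T d) := inferInstance

def HI (I : Ideal (T d)) (m : Fin 4 → ℤ) : ℤ :=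
  (Module.finrank (A d) (Tm d m) : ℤ) -
    Module.finrank (A d) ((I.restrictScalars (A d) ⊓ Tm d m : Submodule (A d) (T d)))

lemma finite_exps (m : Fin 4 → ℤ) : {e : Gv →₀ ℕ | Finsupp.weight wt e = m}.Finite := by
  have : ∀ e : Gv →₀ ℕ, Finsupp.weight wt e = m → ∀ g, e g ≤ (m 0 + m 1 + m 2 + m 3).toNat := by
    intro e he g
    subst he
    rw [weight_wt0, weight_wt1, weight_wt2, weight_wt3]
    rcases g with i | ⟨s, i⟩ | i
    · fin_cases i <;> simp [gc, gp, gu] <;> omega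
    · fin_cases s <;> fin_cases i <;> simp [gc, gp, gu] <;> omega
    · fin_cases i <;> simp [gc, gp, gu] <;> omega
  have hf : (Set.Iic (Finsupp.equivFunOnFinite.symm
      (fun _ : Gv => (m 0 + m 1 + m 2 + m 3).toNat))).Finite := Set.finite_Iic _
  exact hf.subset fun e he => by
    intro g; simpa using this e he g

instance (m : Fin 4 → ℤ) : Module.Finite (A d) (Tm d m) := by
  rw [Tm, weightedHomogeneousSubmodule_eq_finsupp_supported]
  have : Finite {e : Gv →₀ ℕ | Finsupp.weight wt e = m} := finite_exps m
  exact Module.Finite.equiv (AddMonoidAlgebra.supportedEquivFinsupp {e : Gv →₀ ℕ | Finsupp.weight wt e = m}).symm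

instance (m : Fin 4 → ℤ) (I : Submodule (A d) (T d)) :
    Module.Finite (A d) ((I ⊓ Tm d m : Submodule (A d) (T d))) := by
  have h : I ⊓ Tm d m ≤ Tm d m := inf_le_right
  have : IsNoetherian (A d) (Tm d m) := isNoetherian_of_isNoetherianRing_of_finite (A d) (Tm d m)
  exact Module.Finite.of_injective (Submodule.inclusion h) (Submodule.inclusion_injective h)


lemma cmp_same {m : Fin 4 → ℤ} {g : T d} (hg : g ∈ Tm d m) : cmp m g = g :=
  by classical rw [cmp, weightedHomogeneousComponent_of_mem hg, if_pos rfl]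

lemma cmp_ne {m n : Fin 4 → ℤ} {g : T d} (hg : g ∈ Tm d m) (h : m ≠ n) : cmp n g = 0 :=
  by classical rw [cmp, weightedHomogeneousComponent_of_mem hg, if_neg (by tauto)]

lemma Tm_mul {m n : Fin 4 → ℤ} {g h : T d} (hg : g ∈ Tm d m) (hh : h ∈ Tm d n) :
    g * h ∈ Tm d (m + n) := IsWeightedHomogeneous.mul hg hh

lemma cmp_mul {n : Fin 4 → ℤ} {g : T d} (hg : g ∈ Tm d n) (m : Fin 4 → ℤ) (h : T d) :
    cmp m (h * g) = cmp (m - n) h * g := by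
  classical
  obtain ⟨s, hs0, hs⟩ := exists_cmp_sum h
  conv_lhs => rw [hs]
  rw [Finset.sum_mul, cmp, map_sum]
  by_cases hm : m - n ∈ s
  · rw [Finset.sum_eq_single (m - n)]
    · have := Tm_mul (cmp_mem (m - n) h) hg
      rw [sub_add_cancel] at this
      exact cmp_same this
    · intro k _ hk
      exact cmp_ne (Tm_mul (cmp_mem k h) hg) (by intro h'; exact hk (by rw [← h']; simp))
    · intro h'; exact absurd hm h'
  · rw [hs0 _ hm, zero_mul]
    refine Finset.sum_eq_zero fun k hk => ?_
    exact cmp_ne (Tm_mul (cmp_mem k h) hg) (by rintro rfl; exact hm (by simpa using hk))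

/-- homogeneous generators -/
lemma exists_hom_gens (I : Ideal (T d)) (hI : ∀ g ∈ I, ∀ m, cmp m g ∈ I) :
    ∃ (S : Finset (T d)) (dg : T d → (Fin 4 → ℤ)), (∀ g ∈ S, g ∈ I ∧ g ∈ Tm d (dg g)) ∧
      Ideal.span (S : Set (T d)) = I := by
  classical
  obtain ⟨S, hS⟩ := (isNoetherianRing_iff_ideal_fg (T d)).1 inferInstance I
  choose s hs0 hs using fun g : T d => exists_cmp_sum g
  let S' : Finset (T d) := S.biUnion fun g => (s g).image fun m => cmp m g
  have hex : ∀ g : T d, ∃ m, g ∈ S' → g ∈ Tm d m := by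
    intro g
    by_cases hg : g ∈ S'
    · obtain ⟨x, hx, hg'⟩ := Finset.mem_biUnion.1 hg
      obtain ⟨m, hm, rfl⟩ := Finset.mem_image.1 hg'
      exact ⟨m, fun _ => cmp_mem m x⟩
    · exact ⟨0, fun h => absurd h hg⟩
  choose dg hdg using hex
  have hmem : ∀ g ∈ S', g ∈ I := by
    intro g hg
    obtain ⟨x, hx, hg'⟩ := Finset.mem_biUnion.1 hg
    obtain ⟨m, hm, rfl⟩ := Finset.mem_image.1 hg'
    exact hI x (hS ▸ Ideal.subset_span hx) m
  refine ⟨S', dg, fun g hg => ⟨hmem g hg, hdg g hg⟩, ?_⟩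
  apply le_antisymm
  · exact Ideal.span_le.2 hmem
  · rw [← hS]
    refine Ideal.span_le.2 fun x hx => ?_
    rw [hs x]
    exact Ideal.sum_mem _ fun m hm => Ideal.subset_span
      (Finset.mem_coe.2 (Finset.mem_biUnion.2 ⟨x, hx, Finset.mem_image_of_mem _ hm⟩))

/-- elements of big degree of a homogeneous ideal lie in a given ideal, if suitable multiples of
generators do -/
lemma big_mem (I c : Ideal (T d)) (hI : ∀ g ∈ I, ∀ m, cmp m g ∈ I)
    (h : ∀ β, ∀ g ∈ I, ∃ M, bm d β ^ M * g ∈ c) :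
    ∃ m0 : ℤ, ∀ m : Fin 4 → ℤ, (∀ i, m0 ≤ m i) → ∀ g ∈ I, g ∈ Tm d m → g ∈ c := by
  classical
  obtain ⟨S, dg, hS, hSI⟩ := exists_hom_gens I hI
  choose! M hM using h
  let M0 : ℕ := ∑ β, ∑ g ∈ S, M β g
  have hM0 : ∀ β, ∀ g ∈ S, bm d β ^ M0 * g ∈ c := by
    intro β g hg
    have : M β g ≤ M0 :=
      (Finset.single_le_sum (f := fun g => M β g) (fun _ _ => Nat.zero_le _) hg).trans
        (Finset.single_le_sum (f := fun β => ∑ g ∈ S, M β g) (fun _ _ => Nat.zero_le _)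
          (Finset.mem_univ β))
    rw [← Nat.sub_add_cancel this, pow_add, mul_assoc]
    exact Ideal.mul_mem_left _ _ (hM β g (hS g hg).1)
  let m0 : ℤ := 3 * M0 + ∑ g ∈ S, ∑ i, |dg g i|
  refine ⟨m0, fun m hm g hg hgm => ?_⟩
  rw [← hSI] at hg
  obtain ⟨cf, hcf⟩ := Submodule.mem_span_finset.1 hg
  have hg2 : g = ∑ x ∈ S, cmp (m - dg x) (cf x) * x := by
    conv_lhs => rw [← cmp_same hgm, ← hcf.2]
    rw [cmp, map_sum]
    exact Finset.sum_congr rfl fun x hx => by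
      rw [smul_eq_mul]; exact cmp_mul (hS x hx).2 _ _
  rw [hg2]
  refine Ideal.sum_mem _ fun x hx => ?_
  have := pig_mem (Submodule.comap (LinearMap.mulRight (T d) x) c) M0
    (fun β => by
      simp only [Submodule.mem_comap, LinearMap.mulRight_apply]; exact hM0 β x hx)
    (m := m - dg x) (by
      intro i
      have h1 : |dg x i| ≤ ∑ g ∈ S, ∑ i, |dg g i| :=
        (Finset.single_le_sum (f := fun i => |dg x i|) (fun _ _ => abs_nonneg _)
          (Finset.mem_univ i)).trans
        (Finset.single_le_sum (f := fun g => ∑ i, |dg g i|)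
          (fun _ _ => Finset.sum_nonneg fun _ _ => abs_nonneg _) hx)
      have h2 := le_abs_self (dg x i)
      have h3 := hm i
      simp only [Pi.sub_apply]
      simp only [m0] at h3
      linarith) (cmp_mem (m - dg x) (cf x))
  simpa using this

end step
end FB

end

end part2

section part3
open MvPolynomial

noncomputable section
namespace FB
variable {d : ℕ}

/-- scaling invariance of the kernel of a point -/
def SclInv {K : Type*} [Field K] [Algebra ℂ K] (φ : Sg d → K) (y : Gv → K) : Prop :=
  ∀ t g, ev φ y g = 0 → ev φ (scl t y) g = 0

lemma SclInv.cmp_mem {K : Type*} [Field K] [Algebra ℂ K] {φ : Sg d → K} {y : Gv → K}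
    (h : SclInv φ y) (g : T d) (hg : g ∈ RingHom.ker (ev φ y)) (m : Fin 4 → ℤ) :
    cmp m g ∈ RingHom.ker (ev φ y) := by
  have h1 := cmp_of_scl φ y g m 0 (fun t => by rw [h t g hg, smul_zero])
  exact h1.1

lemma rn {R M N : Type*} [CommRing R] [IsDomain R] [IsNoetherianRing R] [AddCommGroup M] [Module R M]
    [Module.Finite R M] [AddCommGroup N] [Module R N] (f : M →ₗ[R] N) :
    Module.finrank R (LinearMap.range f) + Module.finrank R (LinearMap.ker f) = Module.finrank R M := by
  have h := Submodule.finrank_quotient_add_finrank (LinearMap.ker f)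
  rw [f.quotKerEquivRange.finrank_eq] at h
  exact h

theorem step_rank {K : Type*} [Field K] [Algebra ℂ K] (φ : Sg d → K) (y : Gv → K)
    (I' : Ideal (T d)) (hI' : RingHom.ker (ev φ y) ≤ I') (f : K) (hf : f ≠ 0) (m n : Fin 4 → ℤ)
    (h1 : ∀ g ∈ I', g ∈ Tm d m → ∃ x ∈ Tm d n, ev φ y g = f * ev φ y x)
    (h2 : ∀ x ∈ Tm d n, ∃ g ∈ I', g ∈ Tm d m ∧ ev φ y g = f * ev φ y x) :
    HI (RingHom.ker (ev φ y)) m = HI I' m + HI (RingHom.ker (ev φ y)) n := by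
  let _ : Module (A d) K := Module.compHom K ((ev φ y).comp C)
  have smul_def : ∀ (a : A d) (x : K), a • x = ev φ y (C a) * x := fun a x => rfl
  let I := RingHom.ker (ev φ y)
  let Φ : T d →ₗ[A d] K :=
    { toFun := ev φ y
      map_add' := map_add _
      map_smul' := by intro a x; rw [smul_eq_C_mul, map_mul]; rfl }
  let Ψ : T d →ₗ[A d] K :=
    { toFun := fun x => f * ev φ y x
      map_add' := by intro a b; rw [map_add, mul_add]
      map_smul' := by intro a x; rw [smul_eq_C_mul, map_mul, RingHom.id_apply, smul_def]; ring }
  let V : Submodule (A d) (T d) := I'.restrictScalars (A d) ⊓ Tm d m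
  let Φ1 : V →ₗ[A d] K := Φ.domRestrict V
  let Ψ1 : Tm d n →ₗ[A d] K := Ψ.domRestrict (Tm d n)
  have hr : LinearMap.range Φ1 = LinearMap.range Ψ1 := by
    ext z
    constructor
    · rintro ⟨⟨g, hg⟩, rfl⟩
      obtain ⟨x, hx, hxe⟩ := h1 g hg.1 hg.2
      exact ⟨⟨x, hx⟩, hxe.symm⟩
    · rintro ⟨⟨x, hx⟩, rfl⟩
      obtain ⟨g, hg, hgm, hge⟩ := h2 x hx
      exact ⟨⟨g, hg, hgm⟩, hge⟩
  have e1 := rn (R := A d) (M := V) (N := K) Φ1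
  have e2 := rn (R := A d) (M := Tm d n) (N := K) Ψ1
  have k1 : Module.finrank (A d) (LinearMap.ker Φ1) =
      Module.finrank (A d) (I.restrictScalars (A d) ⊓ Tm d m : Submodule (A d) (T d)) := by
    apply LinearEquiv.finrank_eq
    exact
      { toFun := fun x => ⟨x.1.1, ⟨x.2, x.1.2.2⟩⟩
        invFun := fun x => ⟨⟨x.1, ⟨hI' x.2.1, x.2.2⟩⟩, x.2.1⟩
        map_add' := fun _ _ => rfl
        map_smul' := fun _ _ => rfl
        left_inv := fun _ => rfl
        right_inv := fun _ => rfl }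
  have k2 : Module.finrank (A d) (LinearMap.ker Ψ1) =
      Module.finrank (A d) (I.restrictScalars (A d) ⊓ Tm d n : Submodule (A d) (T d)) := by
    apply LinearEquiv.finrank_eq
    exact
      { toFun := fun x => ⟨x.1.1, ⟨(mul_eq_zero.1 x.2).resolve_left hf, x.1.2⟩⟩
        invFun := fun x => ⟨⟨x.1, x.2.2⟩, by
          have : ev φ y x.1 = 0 := x.2.1
          show f * ev φ y x.1 = 0
          rw [this, mul_zero]⟩
        map_add' := fun _ _ => rfl
        map_smul' := fun _ _ => rfl
        left_inv := fun _ => rfl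
        right_inv := fun _ => rfl }
  rw [hr] at e1
  simp only [HI]
  change _ = (Module.finrank (A d) (Tm d m) : ℤ) - Module.finrank (A d) V + _
  rw [k1] at e1
  rw [k2] at e2
  simp only [I] at e1 e2
  omega

theorem step {K K' : Type*} [Field K] [Algebra ℂ K] [Field K'] [Algebra ℂ K']
    (φ : Sg d → K) (y : Gv → K) (φ' : Sg d → K') (y' : Gv → K')
    (hs : SclInv φ y) (hs' : SclInv φ' y')
    (hle : RingHom.ker (ev φ y) ≤ RingHom.ker (ev φ' y')) (f : K) (hf : f ≠ 0) (δ : Fin 4 → ℤ)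
    (hN : ∀ β, ∃ (ξ N : T d) (a : Fin 4 → ℤ) (M : ℕ), ξ ∈ Tm d a ∧ ξ ∣ bm d β ^ M ∧
      ev φ y ξ * f = ev φ y N ∧ ev φ' y' N = 0 ∧ ev φ' y' ξ ≠ 0 ∧
      ∀ t, ev φ (scl t y) N = chi t (a + δ) • ev φ y N)
    (h2 : ∀ β g, ev φ' y' g = 0 → ∃ M h, ev φ y (bm d β ^ M * g) = f * ev φ y h) :
    ∃ m0 : ℤ, ∀ m : Fin 4 → ℤ, (∀ i, m0 ≤ m i) →
      HI (RingHom.ker (ev φ y)) m = HI (RingHom.ker (ev φ' y')) m +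
        HI (RingHom.ker (ev φ y)) (m - δ) := by
  classical
  let cb : Ideal (T d) :=
    { carrier := {x | ∃ h, ev φ y x = f * ev φ y h}
      add_mem' := by
        rintro a b ⟨h, hh⟩ ⟨k, hk⟩
        exact ⟨h + k, by rw [map_add, map_add, hh, hk, mul_add]⟩
      zero_mem' := ⟨0, by simp⟩
      smul_mem' := by
        rintro c x ⟨h, hh⟩
        exact ⟨c * h, by rw [smul_eq_mul, map_mul, map_mul, hh]; ring⟩ }
  let ca : Ideal (T d) :=
    { carrier := {x | ∃ h, f * ev φ y x = ev φ y h}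
      add_mem' := by
        rintro a b ⟨h, hh⟩ ⟨k, hk⟩
        exact ⟨h + k, by rw [map_add, map_add, mul_add, hh, hk]⟩
      zero_mem' := ⟨0, by simp⟩
      smul_mem' := by
        rintro c x ⟨h, hh⟩
        exact ⟨c * h, by rw [smul_eq_mul, map_mul, map_mul, ← hh]; ring⟩ }
  obtain ⟨m1, hm1⟩ := big_mem (RingHom.ker (ev φ' y')) cb hs'.cmp_mem (fun β g hg => h2 β g hg)
  choose ξ N a M hξ hdvd hξN hN0 hξ0 hNt using hN
  let M0 := ∑ β, M β
  have hca : ∀ β, bm d β ^ M0 ∈ ca := by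
    intro β
    have hle' : M β ≤ M0 := Finset.single_le_sum (f := M) (fun _ _ => Nat.zero_le _)
      (Finset.mem_univ β)
    have hx : ξ β ∈ ca := ⟨N β, by rw [← hξN β]; ring⟩
    exact ca.mem_of_dvd ((hdvd β).trans (pow_dvd_pow _ hle')) hx
  have hξ1 : ∀ β, ev φ y (ξ β) ≠ 0 := fun β h => hξ0 β (hle h)
  -- relation between g and x with Φ g = f Φ x
  let β0 : Bi := (0, 0, 0, 0)
  have rel : ∀ g x, ev φ y g = f * ev φ y x → ∀ t,
      chi t (a β0) • (ev φ y (ξ β0) * ev φ (scl t y) g) =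
        chi t (a β0 + δ) • (ev φ y (N β0) * ev φ (scl t y) x) := by
    intro g x hgx t
    have : ev φ y (ξ β0 * g - N β0 * x) = 0 := by
      rw [map_sub, map_mul, map_mul, ← hξN, hgx]; ring
    have := hs t _ this
    rw [map_sub, map_mul, map_mul, hNt, ev_scl_hom φ y t (hξ β0), sub_eq_zero] at this
    simpa [smul_mul_assoc] using this
  refine ⟨max m1 (3 * M0 + ∑ i, |δ i|), fun m hm => ?_⟩
  apply step_rank φ y _ hle f hf
  · intro g hg hgm
    obtain ⟨h, hh⟩ := hm1 m (fun i => (le_max_left _ _).trans (hm i)) g hg hgm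
    refine ⟨cmp (m - δ) h, cmp_mem _ _, ?_⟩
    have := (cmp_of_scl φ y h (m - δ) (ev φ y g / f) (fun t => by
      have r := rel g h hh t
      rw [ev_scl_hom φ y t hgm, ← hξN, chi_add] at r
      have hc : chi t m = chi t (m - δ) * chi t δ := by rw [← chi_add, sub_add_cancel]
      rw [hc] at r
      have c1 := chi_ne_zero t (a β0)
      have c2 := chi_ne_zero t δ
      simp only [Algebra.smul_def, map_mul] at r ⊢
      have c1' : algebraMap ℂ K (chi t (a β0)) ≠ 0 := by simpa using c1
      have c2' : algebraMap ℂ K (chi t δ) ≠ 0 := by simpa using c2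
      have c3 := hξ1 β0
      apply mul_left_cancel₀ (mul_ne_zero (mul_ne_zero (mul_ne_zero c1' c2') c3) hf)
      field_simp
      field_simp at r
      rw [← r])).1
    rw [this]; field_simp
  · intro x hx
    obtain ⟨g, hg⟩ := pig_mem ca M0 hca (m := m - δ) (by
      intro i
      have h1 := (le_max_right _ _).trans (hm i)
      have h2 : |δ i| ≤ ∑ i, |δ i| := Finset.single_le_sum (f := fun i => |δ i|)
        (fun _ _ => abs_nonneg _) (Finset.mem_univ i)
      have := le_abs_self (δ i)
      simp only [Pi.sub_apply]; linarith) hx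
    have hg' : g ∈ RingHom.ker (ev φ' y') := by
      have : ev φ y (ξ β0 * g - N β0 * x) = 0 := by
        rw [map_sub, map_mul, map_mul, ← hξN, ← hg]; ring
      have := hle this
      rw [RingHom.mem_ker, map_sub, map_mul, map_mul, hN0, zero_mul, sub_zero] at this
      exact (mul_eq_zero.1 this).resolve_left (hξ0 β0)
    refine ⟨cmp m g, hs'.cmp_mem g hg' m, cmp_mem _ _, ?_⟩
    refine (cmp_of_scl φ y g m (f * ev φ y x) (fun t => ?_)).1
    have r := rel g x hg.symm t
    rw [ev_scl_hom φ y t hx, ← hξN, chi_add] at r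
    have hc : chi t m = chi t (m - δ) * chi t δ := by rw [← chi_add, sub_add_cancel]
    rw [hc]
    have c1 := chi_ne_zero t (a β0)
    simp only [Algebra.smul_def, map_mul] at r ⊢
    have c1' : algebraMap ℂ K (chi t (a β0)) ≠ 0 := by simpa using c1
    apply mul_left_cancel₀ (mul_ne_zero c1' (hξ1 β0))
    rw [mul_assoc, r]; ring

end FB

end

end part3

section part4
open MvPolynomial

noncomputable section
namespace FB
variable {d : ℕ}

section forms
variable {R : Type*} [CommRing R]

def fev (a : E d → R) (v : Fin 3 → R) : R := ∑ e : E d, a e * ∏ i, v i ^ (e.1 i)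

lemma map_fev {R' : Type*} [CommRing R'] {Fn : Type*} [FunLike Fn R R'] [RingHomClass Fn R R']
    (ψ : Fn) (a : E d → R) (v : Fin 3 → R) :
    ψ (fev a v) = fev (fun e => ψ (a e)) (fun i => ψ (v i)) := by
  simp [fev, map_sum, map_prod]

lemma E_sum (e : E d) : ∑ i, e.1 i = d := by
  have := e.2
  rw [Finset.mem_finsuppAntidiag] at this
  exact this.1

lemma fev_smul (a : E d → R) (t : R) (v : Fin 3 → R) :
    fev a (fun i => t * v i) = t ^ d * fev a v := by
  simp only [fev, Finset.mul_sum]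
  refine Finset.sum_congr rfl fun e _ => ?_
  simp only [mul_pow, Finset.prod_mul_distrib]
  rw [Finset.prod_pow_eq_pow_sum, E_sum]; ring

lemma fev_add (a b : E d → R) (t : R) (v : Fin 3 → R) :
    fev (fun e => a e + t * b e) v = fev a v + t * fev b v := by
  simp only [fev, Finset.mul_sum, ← Finset.sum_add_distrib]
  refine Finset.sum_congr rfl fun e _ => ?_
  ring

lemma fev_sub (a b : E d → R) (v : Fin 3 → R) :
    fev (fun e => a e - b e) v = fev a v - fev b v := by
  simp only [fev, ← Finset.sum_sub_distrib]
  refine Finset.sum_congr rfl fun e _ => ?_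
  ring

lemma fev_coeff (P : MvPolynomial (Fin 3) R) (hP : P.IsHomogeneous d) (v : Fin 3 → R) :
    fev (fun e : E d => coeff e.1 P) v = eval v P := by
  classical
  rw [eval_eq', fev]
  rw [Finset.sum_coe_sort (Finset.finsuppAntidiag Finset.univ d)
    (fun e => coeff e P * ∏ i, v i ^ (e i))]
  symm
  apply Finset.sum_subset
  · intro e he
    rw [Finset.mem_finsuppAntidiag]
    refine ⟨?_, by simp⟩
    have := hP (mem_support_iff.1 he)
    rw [← this, Finsupp.weight_apply, Finsupp.sum_fintype _ _ (by simp)]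
    simp
  · intro e _ he
    rw [notMem_support_iff.1 he, zero_mul]

def bev (n : ℕ) (r : ℕ → R) (x z : R) : R := ∑ i ∈ Finset.range (n + 1), r i * x ^ i * z ^ (n - i)

lemma map_bev {R' : Type*} [CommRing R'] {Fn : Type*} [FunLike Fn R R'] [RingHomClass Fn R R']
    (ψ : Fn) (n : ℕ) (r : ℕ → R) (x z : R) :
    ψ (bev n r x z) = bev n (fun i => ψ (r i)) (ψ x) (ψ z) := by
  simp [bev, map_sum]

lemma bev_smul (n : ℕ) (r : ℕ → R) (t x z : R) : bev n r (t * x) (t * z) = t ^ n * bev n r x z := by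
  simp only [bev, Finset.mul_sum]
  refine Finset.sum_congr rfl fun i hi => ?_
  have : n = i + (n - i) := by have := Finset.mem_range.1 hi; omega
  conv_rhs => rw [show t ^ n = t ^ i * t ^ (n - i) by rw [← pow_add, ← this]]
  rw [mul_pow, mul_pow]; ring

lemma bev_mul_left (n : ℕ) (r : ℕ → R) (t x z : R) :
    bev n (fun i => t * r i) x z = t * bev n r x z := by
  simp only [bev, Finset.mul_sum]
  refine Finset.sum_congr rfl fun i hi => ?_
  ring

/-- binary forms of degree `n` as homogeneous polynomials -/
def bpoly (n : ℕ) (r : ℕ → R) : MvPolynomial (Fin 2) R :=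
  bev n (fun i => C (r i)) (X 0) (X 1)

lemma hom_bev {σ : Type*} (n : ℕ) (r : ℕ → R) (i j : σ) :
    (bev n (fun i => C (r i)) (X i) (X j) : MvPolynomial σ R).IsHomogeneous n := by
  apply IsHomogeneous.sum
  intro k hk
  have : n = 0 + k + (n - k) := by have := Finset.mem_range.1 hk; omega
  conv => arg 2; rw [this]
  exact ((isHomogeneous_C _ _).mul (isHomogeneous_X_pow _ _)).mul (isHomogeneous_X_pow _ _)

lemma bpoly_hom (n : ℕ) (r : ℕ → R) : (bpoly n r).IsHomogeneous n := hom_bev n r 0 1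

lemma eval_bpoly (n : ℕ) (r : ℕ → R) (x z : R) : eval ![x, z] (bpoly n r) = bev n r x z := by
  rw [bpoly, map_bev]; simp

lemma exists_bev (n : ℕ) (P : MvPolynomial (Fin 2) R) (hP : P.IsHomogeneous n) :
    ∃ r : ℕ → R, ∀ x z, eval ![x, z] P = bev n r x z := by
  classical
  let g : ℕ → (Fin 2 →₀ ℕ) := fun i => Finsupp.single 0 i + Finsupp.single 1 (n - i)
  refine ⟨fun i => coeff (g i) P, fun x z => ?_⟩
  rw [eval_eq', bev]
  have hinj : Set.InjOn g (Finset.range (n + 1)) := by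
    intro i _ j _ h
    have := DFunLike.congr_fun h 0
    simpa [g] using this
  have : ∑ i ∈ Finset.range (n + 1), coeff (g i) P * x ^ i * z ^ (n - i) =
      ∑ e ∈ (Finset.range (n + 1)).image g, coeff e P * ∏ i, (![x, z] i) ^ (e i) := by
    rw [Finset.sum_image hinj]
    refine Finset.sum_congr rfl fun i _ => ?_
    simp [g, mul_assoc]
  rw [this]
  apply Finset.sum_subset
  · intro e he
    have := hP (mem_support_iff.1 he)
    rw [Finsupp.weight_apply, Finsupp.sum_fintype _ _ (by simp), Fin.sum_univ_two] at this
    simp only [Pi.one_apply, smul_eq_mul, mul_one] at this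
    rw [Finset.mem_image]
    refine ⟨e 0, Finset.mem_range.2 (by omega), ?_⟩
    ext i
    fin_cases i
    · simp [g]
    · simp [g]; omega
  · intro e _ he
    rw [notMem_support_iff.1 he, zero_mul]

end forms

section div
variable {K : Type*} [Field K]

lemma bev_div (n : ℕ) (r : ℕ → K) (p0 p2 : K) (h2 : p2 ≠ 0) (h : bev (n + 1) r p0 p2 = 0) :
    ∃ r' : ℕ → K, ∀ x z, bev (n + 1) r x z = (p2 * x - p0 * z) * bev n r' x z := by
  classical
  let P : Polynomial K := ∑ i ∈ Finset.range (n + 2), Polynomial.monomial i (r i)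
  have hPc : ∀ i, i < n + 2 → P.coeff i = r i := by
    intro i hi
    simp [P, Polynomial.finsetSum_coeff, Polynomial.coeff_monomial, hi]
  have hPd : P.natDegree ≤ n + 1 := by
    apply Polynomial.natDegree_sum_le_of_forall_le
    intro i hi
    exact (Polynomial.natDegree_monomial_le _).trans (by have := Finset.mem_range.1 hi; omega)
  have hroot : P.IsRoot (p0 / p2) := by
    have e1 : P.eval (p0 / p2) = bev (n + 1) r (p0 / p2) 1 := by
      simp [P, Polynomial.eval_finsetSum, bev]
    have e2 : p2 ^ (n + 1) * bev (n + 1) r (p0 / p2) 1 = 0 := by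
      rw [← bev_smul, mul_one, mul_div_cancel₀ _ h2, h]
    rw [Polynomial.IsRoot, e1]
    exact (mul_eq_zero.1 e2).resolve_left (pow_ne_zero _ h2)
  obtain ⟨Q, hQ⟩ := Polynomial.dvd_iff_isRoot.2 hroot
  have hQd : Q.coeff (n + 1) = 0 := by
    by_cases hQ0 : Q = 0
    · simp [hQ0]
    apply Polynomial.coeff_eq_zero_of_natDegree_lt
    have : P.natDegree = 1 + Q.natDegree := by
      rw [hQ, Polynomial.natDegree_mul (Polynomial.X_sub_C_ne_zero _) hQ0,
        Polynomial.natDegree_X_sub_C]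
    omega
  have c0 : r 0 = - (p0 / p2) * Q.coeff 0 := by
    rw [← hPc 0 (by omega), hQ]; simp [Polynomial.mul_coeff_zero]
  have c1 : ∀ i, i < n + 1 → r (i + 1) = Q.coeff i - (p0 / p2) * Q.coeff (i + 1) := by
    intro i hi
    rw [← hPc (i + 1) (by omega), hQ, sub_mul, Polynomial.coeff_sub, Polynomial.coeff_X_mul,
      Polynomial.coeff_C_mul]
  refine ⟨fun i => Q.coeff i / p2, fun x z => ?_⟩
  have s1 : bev (n + 1) r x z = (∑ i ∈ Finset.range (n + 1), Q.coeff i * x ^ (i + 1) * z ^ (n - i))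
      - (p0 / p2) * ∑ i ∈ Finset.range (n + 2), Q.coeff i * x ^ i * z ^ (n + 1 - i) := by
    rw [bev, Finset.sum_range_succ', c0, Finset.sum_range_succ' (fun i => Q.coeff i * x ^ i * z ^ (n + 1 - i))]
    rw [Finset.sum_congr rfl (g := fun i => Q.coeff i * x ^ (i + 1) * z ^ (n - i) -
      (p0 / p2) * (Q.coeff (i + 1) * x ^ (i + 1) * z ^ (n + 1 - (i + 1))))]
    · rw [Finset.sum_sub_distrib, ← Finset.mul_sum]; ring
    · intro i hi
      rw [c1 i (Finset.mem_range.1 hi), Nat.add_sub_add_right]; ring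
  rw [s1, Finset.sum_range_succ _ (n + 1), hQd, bev, sub_mul, Finset.mul_sum, Finset.mul_sum]
  simp only [zero_mul, add_zero]
  rw [Finset.mul_sum]
  congr 1
  · refine Finset.sum_congr rfl fun i hi => ?_
    field_simp; try ring
  · refine Finset.sum_congr rfl fun i hi => ?_
    have : n + 1 - i = (n - i) + 1 := by have := Finset.mem_range.1 hi; omega
    rw [this]; field_simp; try ring
end div

section pts
variable {R : Type*} [CommRing R]

def Fc (φ : Sg d → R) (y : Gv → R) (v : Fin 3 → R) : R :=
  y (gc 0) * fev (fun e => φ (Sum.inl e)) v + y (gc 1) * fev (fun e => φ (Sum.inr e)) v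

lemma map_Fc {R' : Type*} [CommRing R'] {Fn : Type*} [FunLike Fn R R'] [RingHomClass Fn R R']
    (ψ : Fn) (φ : Sg d → R) (y : Gv → R) (v : Fin 3 → R) :
    ψ (Fc φ y v) = Fc (fun i => ψ (φ i)) (fun i => ψ (y i)) (fun i => ψ (v i)) := by
  simp [Fc, map_fev]

def dt (u v : Fin 3 → R) : R := u 0 * v 0 + u 1 * v 1 + u 2 * v 2

abbrev uu (y : Gv → R) : Fin 3 → R := fun i => y (gu i)
abbrev pp (y : Gv → R) (s : Fin 2) : Fin 3 → R := fun i => y (gp s i)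

def ell (p v : Fin 3 → R) : R := p 2 * v 0 - p 0 * v 2

end pts

/-- the base stage: only incidence with points in `S` -/
structure InB (S : Set (Fin 2)) {K : Type} [Field K] (y : Gv → K) : Prop where
  c0 : y (gc 0) ≠ 0
  u1 : y (gu 1) ≠ 0
  inc : ∀ s ∈ S, dt (uu y) (pp y s) = 0

structure InC (m0 m1 n : ℕ) {K : Type} [Field K] (φ : Sg d → K) (y : Gv → K) : Prop where
  b : InB Set.univ y
  ex : ∃ r : ℕ → K, ∀ v, dt (uu y) v = 0 →
    Fc φ y v = y (gc 0) * ell (pp y 0) v ^ m0 * ell (pp y 1) v ^ m1 * bev n r (v 0) (v 2)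

/-- Restriction of a form to a line with `u 1 ≠ 0` is a binary form. -/
lemma restrict_bev {K : Type*} [Field K] (a : E d → K) (u : Fin 3 → K) (hu : u 1 ≠ 0) :
    ∃ r : ℕ → K, ∀ v, dt u v = 0 → fev a v = bev d r (v 0) (v 2) := by
  let sub : Fin 3 → MvPolynomial (Fin 2) K :=
    ![X 0, C (-(u 0 / u 1)) * X 0 + C (-(u 2 / u 1)) * X 1, X 1]
  have hsub : ∀ i, (sub i).IsHomogeneous 1 := by
    intro i
    fin_cases i
    · exact isHomogeneous_X _ _
    · exact ((isHomogeneous_C_mul_X _ _).add (isHomogeneous_C_mul_X _ _))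
    · exact isHomogeneous_X _ _
  have hP : (fev (fun e => C (a e)) sub : MvPolynomial (Fin 2) K).IsHomogeneous d := by
    apply IsHomogeneous.sum
    intro e _
    have h1 : (∏ i, sub i ^ (e.1 i)).IsHomogeneous (∑ i, 1 * e.1 i) :=
      IsHomogeneous.prod _ _ _ fun i _ => (hsub i).pow _
    simp only [one_mul, E_sum] at h1
    have := (isHomogeneous_C (Fin 2) (a e)).mul h1
    rwa [zero_add] at this
  obtain ⟨r, hr⟩ := exists_bev d _ hP
  refine ⟨r, fun v hv => ?_⟩
  rw [← hr, map_fev]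
  have hv1 : v 1 = -(u 0 / u 1) * v 0 + -(u 2 / u 1) * v 2 := by
    field_simp; rw [dt] at hv; linear_combination hv
  congr 1
  · ext e; simp
  · ext i
    fin_cases i
    · simp [sub]
    · simp [sub, hv1]
    · simp [sub]

end FB

end

end part4

section part5
open MvPolynomial

noncomputable section
namespace FB
variable {d : ℕ}

abbrev Om (d : ℕ) : Type := MvPolynomial (Sg d ⊕ Gv ⊕ ℕ) ℂ
abbrev KK (d : ℕ) : Type := FractionRing (Om d)

def oF (e : E d) : Om d := X (Sum.inl (Sum.inl e))
def oG (e : E d) : Om d := X (Sum.inl (Sum.inr e))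
def og (g : Gv) : Om d := X (Sum.inr (Sum.inl g))
def oR (i : ℕ) : Om d := X (Sum.inr (Sum.inr i))

/-- generic coordinates, with incidence for points in `S` -/
def oy (d : ℕ) (S : Set (Fin 2)) [DecidablePred (· ∈ S)] : Gv → Om d
  | Sum.inl i => if i = 0 then og (gc 0) else og (gc 0) * og (gc 1)
  | Sum.inr (Sum.inl (s, i)) =>
      if s ∈ S ∧ i = 1 then - (og (gu 0) * og (gp s 0) + og (gu 2) * og (gp s 2)) else og (gp s i)
  | Sum.inr (Sum.inr i) => if i = 1 then og (gu 1) else og (gu i) * og (gu 1)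

def osub (d : ℕ) : Fin 3 → MvPolynomial (Fin 3) (Om d) :=
  ![X 0, - (C (og (gu 0)) * X 0 + C (og (gu 2)) * X 2), X 2]

def oell (s : Fin 2) : MvPolynomial (Fin 3) (Om d) :=
  C (og (gp s 2)) * X 0 - C (og (gp s 0)) * X 2

def oB (m0 m1 n : ℕ) : MvPolynomial (Fin 3) (Om d) :=
  fev (fun e => C (oF e)) (osub d) + C (og (gc 1)) * fev (fun e => C (oG e)) (osub d)
    - oell 0 ^ m0 * oell 1 ^ m1 * bev n (fun i => C (oR i)) (X 0) (X 2)

def ophi (m0 m1 n : ℕ) : Sg d → Om d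
  | Sum.inl e => oF e - coeff e.1 (oB m0 m1 n)
  | Sum.inr e => oG e

def ophi0 : Sg d → Om d
  | Sum.inl e => oF e
  | Sum.inr e => oG e

section spec
variable {K : Type} [Field K] [Algebra ℂ K]

instance (K : Type*) [Field K] [Algebra ℂ K] : Infinite K :=
  Infinite.of_injective (algebraMap ℂ K) (algebraMap ℂ K).injective

/-- the parameter values of a point -/
def pw (φ : Sg d → K) (y : Gv → K) (r : ℕ → K) : Sg d ⊕ Gv ⊕ ℕ → K
  | Sum.inl i => φ i
  | Sum.inr (Sum.inl (Sum.inl i)) => if i = 0 then y (gc 0) else y (gc 1) / y (gc 0)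
  | Sum.inr (Sum.inl (Sum.inr (Sum.inl (s, i)))) => y (gp s i)
  | Sum.inr (Sum.inl (Sum.inr (Sum.inr i))) => if i = 1 then y (gu 1) else y (gu i) / y (gu 1)
  | Sum.inr (Sum.inr i) => r i

def psi (φ : Sg d → K) (y : Gv → K) (r : ℕ → K) : Om d →ₐ[ℂ] K := aeval (pw φ y r)

variable (φ : Sg d → K) (y : Gv → K) (r : ℕ → K)

@[simp] lemma psi_oF (e : E d) : psi φ y r (oF e) = φ (Sum.inl e) := by simp [psi, oF, pw]
@[simp] lemma psi_oG (e : E d) : psi φ y r (oG e) = φ (Sum.inr e) := by simp [psi, oG, pw]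
@[simp] lemma psi_c0 : psi φ y r (og (gc 0)) = y (gc 0) := by simp [psi, og, pw]
@[simp] lemma psi_c1 : psi φ y r (og (gc 1)) = y (gc 1) / y (gc 0) := by simp [psi, og, pw]
@[simp] lemma psi_u1 : psi φ y r (og (gu 1)) = y (gu 1) := by simp [psi, og, pw]
@[simp] lemma psi_u0 : psi φ y r (og (gu 0)) = y (gu 0) / y (gu 1) := by simp [psi, og, pw]
@[simp] lemma psi_u2 : psi φ y r (og (gu 2)) = y (gu 2) / y (gu 1) := by simp [psi, og, pw]
@[simp] lemma psi_p (s i) : psi φ y r (og (gp s i)) = y (gp s i) := by simp [psi, og, pw]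
@[simp] lemma psi_R (i) : psi φ y r (oR i) = r i := by simp [psi, oR, pw]

lemma psi_oy (S : Set (Fin 2)) [DecidablePred (· ∈ S)] (h : InB S y) (g : Gv) :
    psi φ y r (oy d S g) = y g := by
  have h0 := h.c0
  have h1 := h.u1
  rcases g with i | ⟨s, i⟩ | i
  · fin_cases i
    · simp [oy]
    · simp [oy]; field_simp
  · simp only [oy]
    split_ifs with hs
    · obtain ⟨hs, rfl⟩ := hs
      have := h.inc s hs
      simp only [dt] at this
      simp only [map_neg, map_add, map_mul, psi_u0, psi_u2, psi_p]
      field_simp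
      linear_combination -this
    · simp
  · fin_cases i
    · simp [oy]; field_simp
    · simp [oy]
    · simp [oy]; field_simp

lemma psi_ophi0 (i : Sg d) : psi φ y r (ophi0 i) = φ i := by
  rcases i with i | i <;> simp [ophi0]

lemma eval_oB (m0 m1 n : ℕ) (v : Fin 3 → K) (hu : y (gu 1) ≠ 0) (hc : y (gc 0) ≠ 0)
    (hv : dt (uu y) v = 0) :
    y (gc 0) * eval v (map (psi φ y r : Om d →+* K) (oB m0 m1 n)) = Fc φ y v -
     y (gc 0) * ell (pp y 0) v ^ m0 * ell (pp y 1) v ^ m1 * bev n r (v 0) (v 2) := by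
  have hs : (fun i => (eval v) ((map (psi φ y r : Om d →+* K)) (osub d i))) = v := by
    ext i
    fin_cases i
    · simp [osub]
    · simp [osub]; rw [dt] at hv; field_simp; linear_combination -hv
    · simp [osub]
  simp only [oB, map_sub, map_add, map_mul, map_fev, map_pow, hs, map_bev, oell]
  simp [Fc, ell]
  field_simp

lemma psi_ophi (m0 m1 n : ℕ) (hb : InB Set.univ y) (hr : ∀ v, dt (uu y) v = 0 →
    Fc φ y v = y (gc 0) * ell (pp y 0) v ^ m0 * ell (pp y 1) v ^ m1 * bev n r (v 0) (v 2))
    (i : Sg d) : psi φ y r (ophi m0 m1 n i) = φ i := by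
  have hB : map (psi φ y r : Om d →+* K) (oB m0 m1 n) = 0 := by
    apply MvPolynomial.funext
    intro v
    rw [map_zero]
    let v' : Fin 3 → K := ![v 0, -(y (gu 0) / y (gu 1) * v 0 + y (gu 2) / y (gu 1) * v 2), v 2]
    have hv' : dt (uu y) v' = 0 := by
      have := hb.u1
      simp [dt, v']; field_simp; ring
    have h1 := eval_oB φ y r m0 m1 n v' hb.u1 hb.c0 hv'
    rw [hr v' hv', sub_self] at h1
    have h2 := (mul_eq_zero.1 h1).resolve_left hb.c0
    rw [← h2]
    have hs : ∀ v : Fin 3 → K, (fun i => (eval v) ((map (psi φ y r : Om d →+* K)) (osub d i))) =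
        ![v 0, -(y (gu 0) / y (gu 1) * v 0 + y (gu 2) / y (gu 1) * v 2), v 2] := by
      intro v
      ext i
      fin_cases i <;> simp [osub]
    simp only [oB, map_sub, map_add, map_mul, map_fev, map_pow, hs, map_bev, oell]
    simp [v']
  rcases i with e | e
  · simp only [ophi, map_sub, psi_oF]
    have : psi φ y r (coeff e.1 (oB m0 m1 n)) = coeff e.1 (map (psi φ y r : Om d →+* K) (oB m0 m1 n)) := by
      rw [coeff_map]; rfl
    rw [this, hB]; simp
  · simp [ophi]

end spec

abbrev ii (d : ℕ) : Om d →ₐ[ℂ] KK d := Algebra.algHom ℂ (Om d) (KK d)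

lemma ii_inj : Function.Injective (ii d) := IsFractionRing.injective (Om d) (KK d)

section gen

lemma oB_hom (m0 m1 n : ℕ) (h : d = m0 + m1 + n) : (oB m0 m1 n : MvPolynomial (Fin 3) (Om d)).IsHomogeneous d := by
  have hsub : ∀ i, (osub d i).IsHomogeneous 1 := by
    intro i
    fin_cases i
    · exact isHomogeneous_X _ _
    · exact ((isHomogeneous_C_mul_X _ _).add (isHomogeneous_C_mul_X _ _)).neg
    · exact isHomogeneous_X _ _
  have hP : ∀ a : E d → Om d, (fev (fun e => C (a e)) (osub d)).IsHomogeneous d := by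
    intro a
    apply IsHomogeneous.sum
    intro e _
    have h1 : (∏ i, osub d i ^ (e.1 i)).IsHomogeneous (∑ i, 1 * e.1 i) :=
      IsHomogeneous.prod _ _ _ fun i _ => (hsub i).pow _
    simp only [one_mul, E_sum] at h1
    have := (isHomogeneous_C (Fin 3) (a e)).mul h1
    rwa [zero_add] at this
  have he : ∀ s, (oell s : MvPolynomial (Fin 3) (Om d)).IsHomogeneous 1 := fun s =>
    (isHomogeneous_C_mul_X _ _).sub (isHomogeneous_C_mul_X _ _)
  refine ((hP _).add ?_).sub ?_
  · have := (isHomogeneous_C (Fin 3) (og (gc 1) : Om d)).mul (hP oG)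
    rwa [zero_add] at this
  · have := (((he 0).pow m0).mul ((he 1).pow m1)).mul (hom_bev (σ := Fin 3) n (oR (d := d)) 0 2)
    rw [one_mul, one_mul, ← h] at this
    exact this

abbrev gy (d : ℕ) (S : Set (Fin 2)) [DecidablePred (· ∈ S)] : Gv → KK d := fun g => ii d (oy d S g)
abbrev gphi (m0 m1 n : ℕ) : Sg d → KK d := fun i => ii d (ophi m0 m1 n i)
abbrev gphi0 : Sg d → KK d := fun i => ii d (ophi0 i)

lemma og_ne (g : Gv) : (og g : Om d) ≠ 0 := X_ne_zero _

lemma oy_ne (S : Set (Fin 2)) [DecidablePred (· ∈ S)] (g : Gv) : oy d S g ≠ 0 := by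
  rcases g with i | ⟨s, i⟩ | i
  · fin_cases i
    · simp [oy, og_ne]
    · simp [oy, og_ne]
  · simp only [oy]
    split_ifs with hs
    · intro h
      have := congrArg (aeval (fun _ => (1:ℂ))) h
      simp [og] at this
    · exact og_ne _
  · fin_cases i
    · simp [oy, og_ne]
    · simp [oy, og_ne]
    · simp [oy, og_ne]

lemma gy_ne (S : Set (Fin 2)) [DecidablePred (· ∈ S)] (g : Gv) : gy d S g ≠ 0 := by
  intro h
  exact oy_ne S g (ii_inj (by rw [map_zero]; exact h))

lemma gy_inB (S : Set (Fin 2)) [DecidablePred (· ∈ S)] : InB S (gy d S) where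
  c0 := gy_ne S _
  u1 := gy_ne S _
  inc := by
    intro s hs
    have : dt (fun i => oy d S (gu i)) (fun i => oy d S (gp s i)) = 0 := by
      simp [dt, oy, hs]; ring
    have h2 := congrArg (ii d) this
    rw [map_zero] at h2
    rw [← h2]; simp [dt]

lemma gen_inC (m0 m1 n : ℕ) (h : d = m0 + m1 + n) :
    ∀ v, dt (uu (gy d Set.univ)) v = 0 →
    Fc (gphi m0 m1 n) (gy d Set.univ) v = gy d Set.univ (gc 0) * ell (pp (gy d Set.univ) 0) v ^ m0 *
      ell (pp (gy d Set.univ) 1) v ^ m1 * bev n (fun i => ii d (oR i)) (v 0) (v 2) := by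
  intro v hv
  have hb := gy_inB (d := d) ∅
  have e1 := eval_oB (gphi0 (d := d)) (gy d ∅) (fun i => ii d (oR i)) m0 m1 n v hb.u1 hb.c0 hv
  have hpsi : psi (gphi0 (d := d)) (gy d ∅) (fun i => ii d (oR i)) = ii d := by
    apply MvPolynomial.algHom_ext
    intro i
    have hc : ii d (og (gc 0)) ≠ 0 := fun h => og_ne (gc 0) (ii_inj (by rw [map_zero]; exact h))
    have hu : ii d (og (gu 1)) ≠ 0 := fun h => og_ne (gu 1) (ii_inj (by rw [map_zero]; exact h))
    rcases i with (e | e) | (i | ⟨s, i⟩ | i) | i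
    · exact psi_oF _ _ _ e
    · exact psi_oG _ _ _ e
    · fin_cases i
      · exact (psi_c0 _ _ _).trans (by simp [gy, oy]; rfl)
      · refine (psi_c1 _ _ _).trans ?_
        simp [gy, oy]; field_simp; rfl
    · refine (psi_p _ _ _ s i).trans ?_
      simp [gy, oy]; rfl
    · fin_cases i
      · refine (psi_u0 _ _ _).trans ?_
        simp [gy, oy]; field_simp; rfl
      · exact (psi_u1 _ _ _).trans (by simp [gy, oy]; rfl)
      · refine (psi_u2 _ _ _).trans ?_
        simp [gy, oy]; field_simp; rfl
    · exact psi_R _ _ _ i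
  rw [hpsi] at e1
  have hl : ∀ s, ell (pp (gy d ∅) s) v = ell (pp (gy d Set.univ) s) v := by
    intro s
    have q2 : ∀ (S : Set (Fin 2)) [DecidablePred (· ∈ S)], pp (gy d S) s 2 = ii d (og (gp s 2)) := by
      intro S _; show ii d (oy d S (gp s 2)) = _; simp [oy]
    have q0 : ∀ (S : Set (Fin 2)) [DecidablePred (· ∈ S)], pp (gy d S) s 0 = ii d (og (gp s 0)) := by
      intro S _; show ii d (oy d S (gp s 0)) = _; simp [oy]
    simp only [ell, q2, q0]
  rw [hl, hl] at e1
  have hF : Fc (gphi m0 m1 n) (gy d Set.univ) v = Fc gphi0 (gy d ∅) v - gy d ∅ (gc 0) *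
      eval v (map (ii d : Om d →+* KK d) (oB m0 m1 n)) := by
    have hh := fev_coeff (d := d) (map (ii d : Om d →+* KK d) (oB m0 m1 n))
      ((oB_hom m0 m1 n h).map _) v
    rw [← hh]
    simp only [Fc, ophi, gphi, map_sub, fev_sub, ophi0, coeff_map, RingHom.coe_coe]
    have e2 : gy d Set.univ (gc 0) = gy d ∅ (gc 0) := rfl
    have e3 : gy d Set.univ (gc 1) = gy d ∅ (gc 1) := rfl
    have e4 : (fun e : E d => ii d (oF e)) = fun e => gphi0 (Sum.inl e) := rfl
    have e5 : (fun e : E d => ii d (oG e)) = fun e => gphi0 (Sum.inr e) := rfl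
    rw [e2, e3, e4, e5]; ring
  rw [hF, e1]
  have e2 : gy d Set.univ (gc 0) = gy d ∅ (gc 0) := rfl
  rw [e2]; ring

end gen

/-- A stage: generic point in `KK d` together with a predicate for points in arbitrary fields. -/
structure Stage (d : ℕ) where
  φ : Sg d → KK d
  y : Gv → KK d
  P : ∀ (K : Type) [Field K] [Algebra ℂ K], (Sg d → K) → (Gv → K) → Prop
  gen : P (KK d) φ y
  kill : ∀ (K : Type) [Field K] [Algebra ℂ K] (φ' : Sg d → K) (y' : Gv → K), P K φ' y' →
    ∀ g, ev φ y g = 0 → ev φ' y' g = 0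
  scale : ∀ (K : Type) [Field K] [Algebra ℂ K] (φ' : Sg d → K) (y' : Gv → K) (t : Fin 4 → ℂˣ),
    P K φ' y' → P K φ' (scl t y')
  ne : ∀ g, y g ≠ 0

lemma Stage.sclInv (Z : Stage d) : SclInv Z.φ Z.y := fun t g hg =>
  Z.kill _ _ _ (Z.scale _ _ _ t Z.gen) g hg

abbrev Stage.I (Z : Stage d) : Ideal (T d) := RingHom.ker (ev Z.φ Z.y)

lemma kill_of {K : Type} [Field K] [Algebra ℂ K] (fo : Sg d → Om d) (yo : Gv → Om d)
    (φ' : Sg d → K) (y' : Gv → K) (ψ : Om d →ₐ[ℂ] K) (h1 : ∀ i, ψ (fo i) = φ' i)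
    (h2 : ∀ i, ψ (yo i) = y' i) (g : T d)
    (hg : ev (fun i => ii d (fo i)) (fun i => ii d (yo i)) g = 0) : ev φ' y' g = 0 := by
  rw [← map_ev] at hg
  have : ev fo yo g = 0 := ii_inj (by rw [hg, map_zero])
  have h3 := map_ev ψ fo yo g
  rw [this, map_zero] at h3
  rw [funext h1, funext h2] at h3
  exact h3.symm

lemma scl_ne {K : Type} [Field K] [Algebra ℂ K] (t : Fin 4 → ℂˣ) (y : Gv → K) (g : Gv) (h : y g ≠ 0) :
    scl t y g ≠ 0 := by
  simp only [scl]
  exact smul_ne_zero (Units.ne_zero _) h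

lemma InB.scale {S : Set (Fin 2)} {K : Type} [Field K] [Algebra ℂ K] {y : Gv → K} (h : InB S y)
    (t : Fin 4 → ℂˣ) : InB S (scl t y) where
  c0 := scl_ne _ _ _ h.c0
  u1 := scl_ne _ _ _ h.u1
  inc := by
    intro s hs
    have := h.inc s hs
    simp only [dt, scl, Algebra.smul_def] at this ⊢
    have e : ∀ i, grp (gu i) = 3 := fun i => rfl
    have e' : ∀ i, grp (gp s i) = grp (gp s 0) := fun i => rfl
    rw [e' 1, e' 2, e, e, e]
    linear_combination (algebraMap ℂ K (t 3) * algebraMap ℂ K (t (grp (gp s 0)))) * this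

lemma InC.scale {m0 m1 n : ℕ} {K : Type} [Field K] [Algebra ℂ K] {φ : Sg d → K} {y : Gv → K}
    (h : InC m0 m1 n φ y) (t : Fin 4 → ℂˣ) : InC m0 m1 n φ (scl t y) where
  b := h.b.scale t
  ex := by
    obtain ⟨r, hr⟩ := h.ex
    let al := algebraMap ℂ K
    have h1 : al (t 1) ≠ 0 := by simp [al]
    have h2 : al (t 2) ≠ 0 := by simp [al]
    have h3 : al (t 3) ≠ 0 := by simp [al]
    refine ⟨fun i => ((al (t 1))⁻¹ ^ m0 * (al (t 2))⁻¹ ^ m1) * r i, fun v hv => ?_⟩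
    have hv' : dt (uu y) v = 0 := by
      have e : dt (uu (scl t y)) v = al (t 3) * dt (uu y) v := by
        have e : ∀ i, grp (gu i) = 3 := fun i => rfl
        simp only [dt, scl, Algebra.smul_def, e, al]; ring
      rw [e] at hv
      exact (mul_eq_zero.1 hv).resolve_left h3
    have e0 : Fc φ (scl t y) v = al (t 0) * Fc φ y v := by
      have e : ∀ i, grp (gc i) = 0 := fun i => rfl
      simp only [Fc, scl, Algebra.smul_def, e, al]; ring
    have e1 : ell (pp (scl t y) 0) v = al (t 1) * ell (pp y 0) v := by
      have e : ∀ i, grp (gp 0 i) = 1 := fun i => rfl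
      simp only [ell, scl, Algebra.smul_def, e, al]; ring
    have e2 : ell (pp (scl t y) 1) v = al (t 2) * ell (pp y 1) v := by
      have e : ∀ i, grp (gp 1 i) = 2 := fun i => rfl
      simp only [ell, scl, Algebra.smul_def, e, al]; ring
    have e3 : scl t y (gc 0) = al (t 0) * y (gc 0) := by
      simp only [scl, Algebra.smul_def, al]; rfl
    rw [e0, e1, e2, e3, hr v hv', bev_mul_left, mul_pow, mul_pow, inv_pow, inv_pow]
    field_simp

def stB (d : ℕ) (S : Set (Fin 2)) [DecidablePred (· ∈ S)] : Stage d where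
  φ := gphi0
  y := gy d S
  P := fun _ _ _ _ y => InB S y
  gen := gy_inB S
  kill := by
    intro K _ _ φ' y' h g hg
    exact kill_of ophi0 (oy d S) φ' y' (psi φ' y' 0) (psi_ophi0 _ _ _) (psi_oy _ _ _ S h) g hg
  scale := fun _ _ _ _ _ t h => h.scale t
  ne := gy_ne S

def stC (m0 m1 n : ℕ) (h : d = m0 + m1 + n) : Stage d where
  φ := gphi m0 m1 n
  y := gy d Set.univ
  P := fun _ _ _ φ y => InC m0 m1 n φ y
  gen := ⟨gy_inB _, _, gen_inC m0 m1 n h⟩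
  kill := by
    intro K _ _ φ' y' h g hg
    obtain ⟨r, hr⟩ := h.ex
    exact kill_of (ophi m0 m1 n) (oy d Set.univ) φ' y' (psi φ' y' r)
      (psi_ophi _ _ _ _ _ _ h.b hr) (psi_oy _ _ _ _ h.b) g hg
  scale := fun _ _ _ _ _ t h => h.scale t
  ne := gy_ne _

def ofr : Sg d → Om d := fun i => X (Sum.inl i)
def ofy : Gv → Om d := fun i => X (Sum.inr (Sum.inl i))

def stF (d : ℕ) : Stage d where
  φ := fun i => ii d (ofr i)
  y := fun i => ii d (ofy i)
  P := fun _ _ _ _ _ => True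
  gen := trivial
  kill := by
    intro K _ _ φ' y' h g hg
    exact kill_of ofr ofy φ' y' (aeval (Sum.elim φ' (Sum.elim y' 0))) (by simp [ofr]) (by simp [ofy]) g hg
  scale := fun _ _ _ _ _ t h => h
  ne := fun g h => X_ne_zero (R := ℂ) (σ := Sg d ⊕ Gv ⊕ ℕ) _ (ii_inj (by rw [map_zero]; exact h))

end FB

end

end part5

section part6
open MvPolynomial

noncomputable section
namespace FB
variable {d : ℕ}

/-- shifting hom -/
def sh (Wf : Sg d → T d) (Wy : Gv → T d) : T d →+* Polynomial (T d) :=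
  ev (fun i => Polynomial.C (C (X i)) + Polynomial.X * Polynomial.C (Wf i))
    (fun i => Polynomial.C (X i) + Polynomial.X * Polynomial.C (Wy i))

lemma ev_CC {K : Type*} [CommRing K] [Algebra ℂ K] (φ : Sg d → K) (y : Gv → K) (z : ℂ) :
    ev φ y (C (C z)) = algebraMap ℂ K z := by
  rw [ev_C, aeval_C]

lemma eval₂_sh {K : Type*} [CommRing K] [Algebra ℂ K] (φ : Sg d → K) (y : Gv → K) (τ : K) (Wf : Sg d → T d)
    (Wy : Gv → T d) (g : T d) : Polynomial.eval₂ (ev φ y) τ (sh Wf Wy g) =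
      ev (fun i => φ i + τ * ev φ y (Wf i)) (fun i => y i + τ * ev φ y (Wy i)) g := by
  have h := ringHom_eq_ev ((Polynomial.eval₂RingHom (ev φ y) τ).comp (sh Wf Wy)) (by
    intro z
    have : sh Wf Wy (C (C z)) = Polynomial.C (C (C z)) := by
      rw [sh, ev_CC]; rfl
    rw [RingHom.comp_apply, this]
    simp)
  have h2 := congrArg (fun f => f g) h
  simp only [RingHom.comp_apply, Polynomial.coe_eval₂RingHom] at h2
  rw [h2]
  congr 2
  · ext i; simp [sh]; exact mul_comm _ _
  · ext i; simp [sh]; exact mul_comm _ _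

lemma ev_id (g : T d) : ev (fun i => (C (X i) : T d)) (fun i => X i) g = g := by
  have := ringHom_eq_ev (RingHom.id (T d)) (fun z => rfl)
  exact (congrArg (fun f => f g) this).symm

lemma sh_coeff_zero (Wf : Sg d → T d) (Wy : Gv → T d) (g : T d) : (sh Wf Wy g).coeff 0 = g := by
  have h := eval₂_sh (fun i => (C (X i) : T d)) (fun i => X i) 0 Wf Wy g
  simp only [zero_mul, add_zero] at h
  rw [Polynomial.eval₂_at_zero, ev_id, ev_id] at h
  exact h

lemma clear_den {K : Type*} [Field K] (Φ : T d →+* K) (τ : K) (x N : T d)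
    (h : Φ x * τ = Φ N) (P : Polynomial (T d)) : ∃ M t, Φ (x ^ M) * Polynomial.eval₂ Φ τ P = Φ t := by
  induction P using Polynomial.induction_on with
  | C a => exact ⟨0, a, by simp⟩
  | add p q hp hq =>
    obtain ⟨M, t, hM⟩ := hp
    obtain ⟨M', t', hM'⟩ := hq
    refine ⟨M + M', x ^ M' * t + x ^ M * t', ?_⟩
    rw [Polynomial.eval₂_add, map_add, map_mul, map_mul, ← hM, ← hM', pow_add, map_mul]; ring
  | monomial n a ih =>
    obtain ⟨M, t, hM⟩ := ih
    refine ⟨M + 1, N * t, ?_⟩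
    rw [map_mul, ← hM, ← h]
    simp only [Polynomial.eval₂_mul, Polynomial.eval₂_C, Polynomial.eval₂_pow, Polynomial.eval₂_X,
      map_pow]
    ring

lemma shift_lemma {K : Type*} [Field K] [Algebra ℂ K] (φ : Sg d → K) (y : Gv → K) (Wf : Sg d → T d)
    (Wy : Gv → T d) (g ξ η N b : T d) (f τ : K) (e : ℕ) (hξ : ξ ∣ b ^ e) (hη : η ∣ b ^ e)
    (hN : ev φ y ξ * f = ev φ y N) (hτ : τ * ev φ y η = - f)
    (h0 : ev (fun i => φ i + τ * ev φ y (Wf i)) (fun i => y i + τ * ev φ y (Wy i)) g = 0) :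
    ∃ M h, ev φ y (b ^ M * g) = f * ev φ y h := by
  let Φ := ev φ y
  rw [← eval₂_sh] at h0
  obtain ⟨M, t, hM⟩ := clear_den Φ τ (ξ * η) (-N) (by
    rw [map_mul, map_neg, ← hN]; linear_combination Φ ξ * hτ) (sh Wf Wy g).divX
  have hd := Polynomial.divX_mul_X_add (sh Wf Wy g)
  rw [sh_coeff_zero] at hd
  rw [← hd, Polynomial.eval₂_add, Polynomial.eval₂_mul, Polynomial.eval₂_X, Polynomial.eval₂_C] at h0
  have key : Φ (η * (ξ * η) ^ M * g) = f * Φ t := by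
    rw [map_mul, map_mul, ← hM]
    linear_combination (Φ η * Φ ((ξ * η) ^ M)) * h0 -
      Φ ((ξ * η) ^ M) * Polynomial.eval₂ Φ τ (sh Wf Wy g).divX * hτ
  obtain ⟨k, hk⟩ : η * (ξ * η) ^ M ∣ b ^ (e + (e + e) * M) := by
    rw [pow_add, pow_mul, pow_add]
    exact mul_dvd_mul hη (pow_dvd_pow_of_dvd (mul_dvd_mul hξ hη) M)
  refine ⟨e + (e + e) * M, k * t, ?_⟩
  rw [hk, show η * (ξ * η) ^ M * k * g = k * (η * (ξ * η) ^ M * g) by ring]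
  change Φ (k * _) = f * Φ (k * t)
  rw [map_mul, key, map_mul]; ring

lemma dvd_bm_c (β : Bi) : (X (gc β.1) : T d) ∣ bm d β := by
  unfold bm; exact ⟨X (gp 0 β.2.1) * X (gp 1 β.2.2.1) * X (gu β.2.2.2), by ring⟩

/-- the coordinate index of `pt s` in `β` -/
def bp (β : Bi) (s : Fin 2) : Fin 3 := if s = 0 then β.2.1 else β.2.2.1

lemma dvd_bm_p (β : Bi) (s : Fin 2) : (X (gp s (bp β s)) : T d) ∣ bm d β := by
  unfold bm bp
  fin_cases s
  · exact ⟨X (gc β.1) * X (gp 1 β.2.2.1) * X (gu β.2.2.2), by simp; ring⟩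
  · exact ⟨X (gc β.1) * X (gp 0 β.2.1) * X (gu β.2.2.2), by simp; ring⟩

lemma dvd_bm_u (β : Bi) : (X (gu β.2.2.2) : T d) ∣ bm d β := by
  unfold bm; exact ⟨X (gc β.1) * X (gp 0 β.2.1) * X (gp 1 β.2.2.1), by ring⟩

lemma X_mem_Tm (g : Gv) : (X g : T d) ∈ Tm d (wt g) := isWeightedHomogeneous_X _ _ _

/-- base step: impose incidence of `pt s` -/
theorem base_step (Z Z' : Stage d) (s : Fin 2)
    (hf : dt (uu Z.y) (pp Z.y s) ≠ 0) (hle : Z.P (KK d) Z'.φ Z'.y)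
    (hinc : dt (uu Z'.y) (pp Z'.y s) = 0)
    (hsh : ∀ l, Z'.P (KK d) Z.φ (fun g => Z.y g + (-(dt (uu Z.y) (pp Z.y s)) / Z.y (gu l)) *
      (if g = gp s l then 1 else 0))) :
    ∃ m0 : ℤ, ∀ m : Fin 4 → ℤ, (∀ i, m0 ≤ m i) →
      HI Z.I m = HI Z'.I m + HI Z.I (m - (wt (gu 0) + wt (gp s 0))) := by
  let N : T d := dt (fun i => X (gu i)) (fun i => X (gp s i))
  have hNm : N ∈ Tm d (wt (gu 0) + wt (gp s 0)) := by
    have : ∀ i, (X (gu i) * X (gp s i) : T d) ∈ Tm d (wt (gu 0) + wt (gp s 0)) := fun i =>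
      Tm_mul (X_mem_Tm (gu i)) (X_mem_Tm (gp s i))
    exact add_mem (add_mem (this 0) (this 1)) (this 2)
  have hNe : ∀ {K : Type} [Field K] [Algebra ℂ K] (φ : Sg d → K) (y : Gv → K),
      ev φ y N = dt (uu y) (pp y s) := by
    intro K _ _ φ y; simp [N, dt]
  refine step Z.φ Z.y Z'.φ Z'.y Z.sclInv Z'.sclInv (fun g hg => Z.kill _ _ _ hle g hg)
    (dt (uu Z.y) (pp Z.y s)) hf _ ?_ ?_
  · intro β
    refine ⟨1, N, 0, 0, ?_, by simp, by rw [hNe]; simp, by rw [hNe, hinc], by simp, ?_⟩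
    · exact isWeightedHomogeneous_one _ _
    · intro t; rw [zero_add]; exact ev_scl_hom _ _ t hNm
  · intro β g hg
    let l := β.2.2.2
    have hu : Z.y (gu l) ≠ 0 := Z.ne _
    apply shift_lemma Z.φ Z.y (fun _ => 0) (fun g => if g = gp s l then 1 else 0) g 1 (X (gu l)) N
      (bm d β) _ (-(dt (uu Z.y) (pp Z.y s)) / Z.y (gu l)) 1 (one_dvd _) (by rw [pow_one]; exact dvd_bm_u β)
    · rw [hNe]; simp
    · rw [ev_X]; field_simp
    · have h1 := Z'.kill _ _ _ (hsh l) g hg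
      rw [← h1]
      congr 2
      · ext i; simp
      · ext i; split_ifs <;> simp

end FB

end

end part6

section part7
open MvPolynomial

noncomputable section
namespace FB
variable {d : ℕ}

def CtR (s s' : Fin 2) (a b n : ℕ) {K : Type} [Field K] (φ : Sg d → K) (y : Gv → K) (r : ℕ → K) : Prop :=
  ∀ v, dt (uu y) v = 0 →
    Fc φ y v = y (gc 0) * ell (pp y s') v ^ a * ell (pp y s) v ^ b * bev n r (v 0) (v 2)

section cross
variable {R : Type*} [CommRing R]
def cr (a b : Fin 3 → R) : Fin 3 → R :=
  ![a 1 * b 2 - a 2 * b 1, a 2 * b 0 - a 0 * b 2, a 0 * b 1 - a 1 * b 0]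

def eb (j : Fin 3) : Fin 3 → R := Pi.single j 1

lemma dt_cr_eb (u : Fin 3 → R) (j : Fin 3) : dt u (cr (eb j) u) = 0 := by
  fin_cases j <;> simp [dt, cr, eb] <;> ring

lemma ell_cr_eb (p u : Fin 3 → R) (j : Fin 3) (h : dt u p = 0) :
    ell p (cr (eb j) u) = - (p j * u 1) := by
  rw [dt] at h
  fin_cases j <;> simp [ell, cr, eb] <;> linear_combination h

lemma cr_eb_self (u : Fin 3 → R) (j : Fin 3) : cr (eb j) u j = 0 := by
  fin_cases j <;> simp [cr, eb]

lemma map_cr {R' : Type*} [CommRing R'] {Fn : Type*} [FunLike Fn R R'] [RingHomClass Fn R R']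
    (ψ : Fn) (a b : Fin 3 → R) (i : Fin 3) :
    ψ (cr a b i) = cr (fun i => ψ (a i)) (fun i => ψ (b i)) i := by
  fin_cases i <;> simp [cr]

lemma cr_decomp {K : Type*} [Field K] (u p v : Fin 3 → K) (hu : u 1 ≠ 0) (hp : dt u p = 0) (hv : dt u v = 0)
    (j l i : Fin 3) : p j * u l * v i = u l * v j * p i + cr v p l * cr (eb j) u i := by
  have e1 : p 1 = -(u 0 * p 0 + u 2 * p 2) / u 1 := by
    field_simp; rw [dt] at hp; linear_combination hp
  have e2 : v 1 = -(u 0 * v 0 + u 2 * v 2) / u 1 := by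
    field_simp; rw [dt] at hv; linear_combination hv
  fin_cases j <;> fin_cases l <;> fin_cases i <;> simp [cr, eb, e1, e2] <;> field_simp <;> try ring

lemma cr_line {K : Type*} [Field K] (u p v : Fin 3 → K) (hu : u 1 ≠ 0) (hp : dt u p = 0) (hv : dt u v = 0)
    (l : Fin 3) : cr p v l = ell p v * (u l / u 1) := by
  have e1 : p 1 = -(u 0 * p 0 + u 2 * p 2) / u 1 := by
    field_simp; rw [dt] at hp; linear_combination hp
  have e2 : v 1 = -(u 0 * v 0 + u 2 * v 2) / u 1 := by
    field_simp; rw [dt] at hv; linear_combination hv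
  fin_cases l <;> simp [cr, ell, e1, e2] <;> field_simp <;> try ring

lemma cr_pw {K : Type*} [Field K] (u p : Fin 3 → K) (hu : u 1 ≠ 0) (hp : dt u p = 0)
    (l k : Fin 3) : cr (cr (eb k) u) p l = p k * u l := by
  have e1 : p 1 = -(u 0 * p 0 + u 2 * p 2) / u 1 := by
    field_simp; rw [dt] at hp; linear_combination hp
  fin_cases l <;> fin_cases k <;> simp [cr, eb, e1] <;> field_simp <;> try ring

lemma map_cr' {R' : Type*} [CommRing R'] (ψ : R →+* R') (a b : Fin 3 → R) (i : Fin 3) :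
    ψ (cr a b i) = cr (fun i => ψ (a i)) (fun i => ψ (b i)) i := map_cr ψ a b i

lemma map_lin {R' : Type*} [CommRing R'] (ψ : R →+* R') (x z : R) :
    (Polynomial.C x + Polynomial.X * Polynomial.C z).map ψ =
      Polynomial.C (ψ x) + Polynomial.X * Polynomial.C (ψ z) := by simp

lemma ev_lin (t x z : R) : (Polynomial.C x + Polynomial.X * Polynomial.C z).eval t = x + t * z := by
  rw [Polynomial.eval_add, Polynomial.eval_mul, Polynomial.eval_C, Polynomial.eval_C, Polynomial.eval_X]

/-- the contact numerator -/
def Pol1 (φ : Sg d → R) (y : Gv → R) (s' : Fin 2) (j : Fin 3) : Polynomial R :=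
  Fc (fun i => Polynomial.C (φ i)) (fun i => Polynomial.C (y i))
    (fun i => Polynomial.C (y (gp s' i)) + Polynomial.X * Polynomial.C (cr (eb j) (uu y) i))

def PolS (φ : Sg d → R) (y : Gv → R) (s s' : Fin 2) (a n1 : ℕ) (j k l : Fin 3) : Polynomial R :=
  ∑ i ∈ Finset.range (n1 + 1), Polynomial.C ((Pol1 φ y s' j).coeff (a + i)) *
    (Polynomial.C (y (gp s j)) + Polynomial.X * Polynomial.C (cr (eb k) (uu y) j)) ^ (n1 - i) *
    (Polynomial.C (cr (pp y s) (pp y s') l) + Polynomial.X * Polynomial.C (y (gu l) * y (gp s' k))) ^ i *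
    Polynomial.C (y (gu l)) ^ (n1 - i)

lemma map_PolS {R' : Type*} [CommRing R'] (ψ : R →+* R') (φ : Sg d → R) (y : Gv → R)
    (s s' : Fin 2) (a n1 : ℕ) (j k l : Fin 3) : (PolS φ y s s' a n1 j k l).map ψ =
      PolS (fun i => ψ (φ i)) (fun i => ψ (y i)) s s' a n1 j k l := by
  have heb : ∀ j : Fin 3, (fun i => ψ (eb j i)) = eb j := by
    intro j; ext i; simp [eb, Pi.single_apply]
  have h1 : (Pol1 φ y s' j).map ψ = Pol1 (fun i => ψ (φ i)) (fun i => ψ (y i)) s' j := by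
    rw [Pol1, ← Polynomial.coe_mapRingHom, map_Fc]
    simp only [Pol1, Polynomial.coe_mapRingHom, Polynomial.map_C, map_lin, map_cr' ψ, heb]
  simp only [PolS, ← h1, Polynomial.coeff_map]
  simp only [Polynomial.map_sum, Polynomial.map_mul, Polynomial.map_pow, Polynomial.map_C, map_lin, map_cr' ψ, heb,
    map_mul ψ]
end cross

section value
variable {K : Type} [Field K] [Algebra ℂ K]

lemma value_lemma (φ : Sg d → K) (y : Gv → K) (r : ℕ → K) (s s' : Fin 2) (a b n : ℕ)
    (hb : InB Set.univ y) (hr : CtR s s' a b n φ y r) (hy : ∀ g, y g ≠ 0) (j k l : Fin 3) :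
    (PolS φ y s s' a (n + b) j k l).coeff b = (-1) ^ (a + b) *
      ((y (gp s' j) * y (gu l)) ^ (n + b) * y (gp s' j) ^ a * y (gp s k) ^ b *
      (y (gc 0) * y (gu 1) ^ (a + b) * bev n r (y (gp s 0)) (y (gp s 2)))) := by
  set u := uu y with hu
  set p := pp y s' with hp
  set q := pp y s with hq
  have hup : dt u p = 0 := hb.inc s' (Set.mem_univ _)
  have huq : dt u q = 0 := hb.inc s (Set.mem_univ _)
  set w := cr (eb j) u with hw
  set w' := cr (eb k) u with hw'
  have hu1 : u 1 ≠ 0 := hy _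
  -- the residual form
  let Rr : (Fin 3 → K) → K := fun v => ell q v ^ b * bev n r (v 0) (v 2)
  have Rhom : ∀ (t : K) v, Rr (fun i => t * v i) = t ^ (n + b) * Rr v := by
    intro t v
    simp only [Rr, bev_smul]
    have : ell q (fun i => t * v i) = t * ell q v := by simp only [ell]; ring
    rw [this, mul_pow, pow_add]; ring
  let QR : Polynomial K := (Polynomial.C (ell q p) + Polynomial.X * Polynomial.C (ell q w)) ^ b *
    bev n (fun i => Polynomial.C (r i)) (Polynomial.C (p 0) + Polynomial.X * Polynomial.C (w 0))
      (Polynomial.C (p 2) + Polynomial.X * Polynomial.C (w 2))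
  have QRe : ∀ t, QR.eval t = Rr (fun i => p i + t * w i) := by
    intro t
    simp only [QR, Rr, Polynomial.eval_mul, Polynomial.eval_pow, ← Polynomial.coe_evalRingHom, map_bev]
    have : ell q (fun i => p i + t * w i) = ell q p + t * ell q w := by simp only [ell]; ring
    rw [this]
    simp only [Polynomial.coe_evalRingHom, ev_lin, Polynomial.eval_C]
  have lin1 : ∀ x z : K, (Polynomial.C x + Polynomial.X * Polynomial.C z).natDegree ≤ 1 := by
    intro x z; compute_degree
  have QRd : QR.natDegree ≤ n + b := by
    rw [add_comm]
    apply Polynomial.natDegree_mul_le_of_le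
    · have := Polynomial.natDegree_pow_le_of_le b (lin1 (ell q p) (ell q w))
      simpa using this
    · apply Polynomial.natDegree_sum_le_of_forall_le
      intro i hi
      have hi' : i ≤ n := by have := Finset.mem_range.1 hi; omega
      have h1 := Polynomial.natDegree_pow_le_of_le i (lin1 (p 0) (w 0))
      have h2 := Polynomial.natDegree_pow_le_of_le (n - i) (lin1 (p 2) (w 2))
      have h3 := Polynomial.natDegree_mul_le_of_le (Polynomial.natDegree_mul_le_of_le
        (Polynomial.natDegree_C (r i)).le h1) h2
      exact h3.trans (by omega)
  have P1 : Pol1 φ y s' j = Polynomial.X ^ a * (Polynomial.C (y (gc 0) * (- (p j * u 1)) ^ a) * QR) := by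
    apply Polynomial.funext
    intro t
    have hv : dt u (fun i => p i + t * w i) = 0 := by
      have := dt_cr_eb u j
      rw [← hw] at this
      simp only [dt] at this hup ⊢
      linear_combination hup + t * this
    have e1 : (Pol1 φ y s' j).eval t = Fc φ y (fun i => p i + t * w i) := by
      rw [Pol1, ← Polynomial.coe_evalRingHom, map_Fc]
      simp only [Polynomial.coe_evalRingHom, ev_lin, Polynomial.eval_C, hp, hw, hu]
    rw [e1, hr _ hv]
    have e2 : ell p (fun i => p i + t * w i) = t * (- (p j * u 1)) := by
      rw [← ell_cr_eb p u j hup]; simp only [ell, hw]; ring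
    simp only [Polynomial.eval_mul, Polynomial.eval_pow, Polynomial.eval_X, Polynomial.eval_C, QRe, Rr]
    rw [← hp, ← hq, e2]; ring
  have cP : ∀ i, (Pol1 φ y s' j).coeff (a + i) = y (gc 0) * (- (p j * u 1)) ^ a * QR.coeff i := by
    intro i
    rw [P1, add_comm, Polynomial.coeff_X_pow_mul, Polynomial.coeff_C_mul]
  have hpj : p j ≠ 0 := hy _
  have hul : u l ≠ 0 := hy _
  have hqj : q j ≠ 0 := hy _
  -- main polynomial identity
  let D : Polynomial K := Polynomial.C (q j) + Polynomial.X * Polynomial.C (w' j)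
  have hD : D ≠ 0 := by
    intro h
    have := congrArg (Polynomial.eval 0) h
    simp [D] at this
    exact hqj this
  have main : PolS φ y s s' a (n + b) j k l = Polynomial.X ^ b *
      (Polynomial.C (y (gc 0) * (- (p j * u 1)) ^ a * (p j * u l) ^ (n + b) * (- (q k * u 1)) ^ b) *
        bev n (fun i => Polynomial.C (r i)) (Polynomial.C (q 0) + Polynomial.X * Polynomial.C (w' 0))
        (Polynomial.C (q 2) + Polynomial.X * Polynomial.C (w' 2))) := by
    apply mul_left_cancel₀ hD
    apply Polynomial.funext
    intro t
    rw [Polynomial.eval_mul, Polynomial.eval_mul]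
    by_cases hDt : D.eval t = 0
    · rw [hDt]; ring
    congr 1
    have hDt' : q j + t * w' j ≠ 0 := by simpa only [D, ev_lin] using hDt
    set Xh := q j + t * w' j
    set Yh := cr q p l + t * (u l * p k)
    have hv : dt u (fun i => q i + t * w' i) = 0 := by
      have := dt_cr_eb u k
      rw [← hw'] at this
      simp only [dt] at this huq ⊢
      linear_combination huq + t * this
    have dec : ∀ i, p j * u l * (q i + t * w' i) = u l * Xh * p i + Yh * w i := by
      intro i
      have h1 := cr_decomp u p _ hu1 hup hv j l i
      have h2 : cr (fun i => q i + t * w' i) p l = Yh := by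
        have := cr_pw u p hu1 hup l k
        rw [← hw'] at this
        have h3 : cr (fun i => q i + t * w' i) p l = cr q p l + t * cr w' p l := by
          fin_cases l <;> simp [cr] <;> ring
        rw [h3, this]; simp only [Yh]; ring
      rw [h2] at h1
      exact h1
    have eS : (PolS φ y s s' a (n + b) j k l).eval t = y (gc 0) * (- (p j * u 1)) ^ a *
        ∑ i ∈ Finset.range (n + b + 1), QR.coeff i * (u l * Xh) ^ (n + b - i) * Yh ^ i := by
      rw [PolS, Polynomial.eval_finsetSum, Finset.mul_sum]
      refine Finset.sum_congr rfl fun i _ => ?_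
      rw [cP]
      simp only [Polynomial.eval_mul, Polynomial.eval_pow, Polynomial.eval_X, Polynomial.eval_C,
        Polynomial.eval_add]
      rw [mul_pow]
      simp only [Xh, Yh, hw', hq, hp, hu]
      ring
    have hZ : u l * Xh ≠ 0 := mul_ne_zero hul hDt'
    have eR : ∑ i ∈ Finset.range (n + b + 1), QR.coeff i * (u l * Xh) ^ (n + b - i) * Yh ^ i =
        (p j * u l) ^ (n + b) * Rr (fun i => q i + t * w' i) := by
      rw [← Rhom]
      have e3 : (fun i => p j * u l * (q i + t * w' i)) =
          fun i => (u l * Xh) * (p i + (Yh / (u l * Xh)) * w i) := by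
        ext i; rw [dec, mul_add (u l * Xh) (p i), ← mul_assoc (u l * Xh) (Yh / (u l * Xh)), mul_div_cancel₀ _ hZ]
      rw [e3, Rhom, ← QRe, Polynomial.eval_eq_sum_range' (Nat.lt_succ_of_le QRd), Finset.mul_sum]
      refine Finset.sum_congr rfl fun i hi => ?_
      have hi' : n + b = (n + b - i) + i := by have := Finset.mem_range.1 hi; omega
      conv_rhs => rw [show (u l * Xh) ^ (n + b) = (u l * Xh) ^ (n + b - i) * (u l * Xh) ^ i by
        rw [← pow_add, ← hi']]
      rw [div_pow]; field_simp
    have e4 : ell q (fun i => q i + t * w' i) = t * (- (q k * u 1)) := by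
      rw [← ell_cr_eb q u k huq]; simp only [ell, hw']; ring
    rw [eS, eR]
    simp only [Rr]
    rw [e4]
    simp only [Polynomial.eval_mul, Polynomial.eval_pow, Polynomial.eval_X, Polynomial.eval_C]
    rw [← Polynomial.coe_evalRingHom, map_bev]
    simp only [Polynomial.coe_evalRingHom, ev_lin, Polynomial.eval_C]
    ring
  rw [main]
  have := Polynomial.coeff_X_pow_mul (Polynomial.C (y (gc 0) * (- (p j * u 1)) ^ a * (p j * u l) ^ (n + b) * (- (q k * u 1)) ^ b) *
        bev n (fun i => Polynomial.C (r i)) (Polynomial.C (q 0) + Polynomial.X * Polynomial.C (w' 0))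
        (Polynomial.C (q 2) + Polynomial.X * Polynomial.C (w' 2))) b 0
  rw [zero_add] at this
  rw [this, Polynomial.coeff_zero_eq_eval_zero, Polynomial.eval_mul, Polynomial.eval_C,
    ← Polynomial.coe_evalRingHom, map_bev]
  simp only [Polynomial.coe_evalRingHom, Polynomial.eval_C, Polynomial.eval_add, Polynomial.eval_mul,
    Polynomial.eval_X, zero_mul, add_zero, hp, hq, hu, neg_eq_neg_one_mul (y _ * _), mul_pow, pow_add]
  ring

end value
end FB

end

end part7

section part8
open MvPolynomial

set_option linter.all false
noncomputable section
namespace FB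
variable {d : ℕ}

section
variable {K : Type} [Field K] [Algebra ℂ K]

lemma CtR.up {s s' : Fin 2} {a b n : ℕ} {φ : Sg d → K} {y : Gv → K} {r : ℕ → K}
    (h : CtR s s' a (b + 1) n φ y r) :
    ∃ r', CtR s s' a b (n + 1) φ y r' ∧ bev (n + 1) r' (y (gp s 0)) (y (gp s 2)) = 0 := by
  have hl : (C (y (gp s 2)) * X 0 - C (y (gp s 0)) * X 1 : MvPolynomial (Fin 2) K).IsHomogeneous 1 :=
    (isHomogeneous_C_mul_X _ _).sub (isHomogeneous_C_mul_X _ _)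
  have hm := hl.mul (bpoly_hom n r)
  rw [add_comm] at hm
  obtain ⟨r', hr'⟩ := exists_bev (n + 1) _ hm
  have hr2 : ∀ x z, bev (n + 1) r' x z = (y (gp s 2) * x - y (gp s 0) * z) * bev n r x z := by
    intro x z; rw [← hr', map_mul, eval_bpoly]; simp
  refine ⟨r', fun v hv => ?_, ?_⟩
  · rw [h v hv, hr2]
    simp only [ell]; ring
  · rw [hr2]; ring

lemma CtR.scale {s s' : Fin 2} {a b n : ℕ} {φ : Sg d → K} {y : Gv → K} {r : ℕ → K}
    (h : CtR s s' a b n φ y r) (t : Fin 4 → ℂˣ) : CtR s s' a b n φ (scl t y)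
      (fun i => ((algebraMap ℂ K (t (grp (gp s' 0))))⁻¹ ^ a * (algebraMap ℂ K (t (grp (gp s 0))))⁻¹ ^ b) * r i) := by
  intro v hv
  let al := algebraMap ℂ K
  have h1 : ∀ i, al (t i) ≠ 0 := by simp [al]
  have hv' : dt (uu y) v = 0 := by
    have e : dt (uu (scl t y)) v = al (t 3) * dt (uu y) v := by
      have e : ∀ i, grp (gu i) = 3 := fun i => rfl
      simp only [dt, scl, Algebra.smul_def, e, al]; ring
    rw [e] at hv
    exact (mul_eq_zero.1 hv).resolve_left (h1 3)
  have e0 : Fc φ (scl t y) v = al (t 0) * Fc φ y v := by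
    have e : ∀ i, grp (gc i) = 0 := fun i => rfl
    simp only [Fc, scl, Algebra.smul_def, e, al]; ring
  have e1 : ∀ s, ell (pp (scl t y) s) v = al (t (grp (gp s 0))) * ell (pp y s) v := by
    intro s
    have e : ∀ i, grp (gp s i) = grp (gp s 0) := fun i => rfl
    simp only [ell, scl, Algebra.smul_def, e, al]; ring
  have e3 : scl t y (gc 0) = al (t 0) * y (gc 0) := by
    simp only [scl, Algebra.smul_def, al]; rfl
  have h2 := h1 (grp (gp s 0))
  have h3 := h1 (grp (gp s' 0))
  rw [e0, e1, e1, e3, h v hv', bev_mul_left, mul_pow, mul_pow, inv_pow, inv_pow]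
  simp only [al] at h2 h3 ⊢
  field_simp

lemma bev_add (n : ℕ) (r r' : ℕ → K) (t x z : K) :
    bev n (fun i => r i + t * r' i) x z = bev n r x z + t * bev n r' x z := by
  simp only [bev, Finset.mul_sum, ← Finset.sum_add_distrib]
  exact Finset.sum_congr rfl fun i _ => by ring

/-- powers of a coordinate restricted to the line -/
lemma coord_bev (n : ℕ) (u : Fin 3 → K) (hu : u 1 ≠ 0) (k : Fin 3) :
    ∃ r : ℕ → K, ∀ v, dt u v = 0 → v k ^ n = bev n r (v 0) (v 2) := by
  obtain ⟨r, hr⟩ := restrict_bev (d := n) (fun e => coeff e.1 (X k ^ n : MvPolynomial (Fin 3) K)) u hu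
  refine ⟨r, fun v hv => ?_⟩
  rw [← hr v hv, fev_coeff _ (isHomogeneous_X_pow _ _)]
  simp

lemma CtR.shift {s s' : Fin 2} {a b n : ℕ} {φ φ' : Sg d → K} {y : Gv → K} {r : ℕ → K}
    (hb : InB Set.univ y) (hy : ∀ g, y g ≠ 0)
    (h : CtR s s' a b (n + 1) φ y r) (i : Fin 2) (k l : Fin 3) (τ : K)
    (hτ : τ * (y (gc i) * y (gu l) ^ (a + b) * y (gp s k) ^ (n + 1)) =
      - (y (gc 0) * y (gu 1) ^ (a + b) * bev (n + 1) r (y (gp s 0)) (y (gp s 2))))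
    (hφ : ∀ v, Fc φ' y v = Fc φ y v + τ * y (gc i) *
      (cr (pp y s') v l ^ a * cr (pp y s) v l ^ b * v k ^ (n + 1))) :
    ∃ r', CtR s s' a (b + 1) n φ' y r' := by
  obtain ⟨rk, hrk⟩ := coord_bev (n + 1) (uu y) hb.u1 k
  have hc0 := hy (gc 0)
  have hu1 := hy (gu 1)
  have hul := hy (gu l)
  let κ := τ * y (gc i) * (y (gu l) / y (gu 1)) ^ (a + b) / y (gc 0)
  have hq : dt (uu y) (pp y s) = 0 := hb.inc s (Set.mem_univ _)
  have hp : dt (uu y) (pp y s') = 0 := hb.inc s' (Set.mem_univ _)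
  have hz : bev (n + 1) (fun i => r i + κ * rk i) (y (gp s 0)) (y (gp s 2)) = 0 := by
    have h1 := hrk (pp y s) hq
    rw [bev_add, ← h1]
    simp only [κ]
    rw [div_pow]
    field_simp
    linear_combination hτ
  obtain ⟨r', hr'⟩ := bev_div n _ _ _ (hy (gp s 2)) hz
  refine ⟨r', fun v hv => ?_⟩
  have h2 := hr' (v 0) (v 2)
  rw [bev_add, ← hrk v hv] at h2
  rw [hφ, h v hv, cr_line (uu y) (pp y s') v hb.u1 hp hv, cr_line (uu y) (pp y s) v hb.u1 hq hv]
  have h3 : y (gc 0) * ell (pp y s') v ^ a * ell (pp y s) v ^ (b + 1) * bev n r' (v 0) (v 2) =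
    y (gc 0) * ell (pp y s') v ^ a * ell (pp y s) v ^ b *
      (bev (n + 1) r (v 0) (v 2) + κ * v k ^ (n + 1)) := by
    rw [h2]; simp only [ell]; ring
  rw [h3]
  simp only [κ, pow_add, mul_pow]
  field_simp

end

lemma chi_nsmul (t : Fin 4 → ℂˣ) (n : ℕ) (m : Fin 4 → ℤ) : chi t (n • m) = chi t m ^ n := by
  induction n with
  | zero => simp [chi_zero]
  | succ n ih => rw [succ_nsmul, chi_add, ih, pow_succ]

lemma chi_neg (t : Fin 4 → ℂˣ) (m : Fin 4 → ℤ) : chi t (-m) = (chi t m)⁻¹ := by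
  exact eq_inv_of_mul_eq_one_left (by rw [← chi_add, neg_add_cancel, chi_zero])

def crX (d : ℕ) (s : Fin 2) (l : Fin 3) : MvPolynomial (Fin 3) (T d) :=
  cr (fun i => (C (X (gp s i) : T d) : MvPolynomial (Fin 3) (T d))) (fun i => (X i : MvPolynomial (Fin 3) (T d))) l

lemma crX_hom (s : Fin 2) (l : Fin 3) : (crX d s l).IsHomogeneous 1 := by
  unfold crX
  fin_cases l <;> simp only [cr] <;> exact (isHomogeneous_C_mul_X (R := T d) _ _).sub (isHomogeneous_C_mul_X (R := T d) _ _)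

def Wp (d : ℕ) (s s' : Fin 2) (a b n : ℕ) (k l : Fin 3) : MvPolynomial (Fin 3) (T d) :=
  crX d s' l ^ a * crX d s l ^ b * X k ^ n

lemma Wp_hom (s s' : Fin 2) (a b n : ℕ) (k l : Fin 3) : (Wp d s s' a b n k l).IsHomogeneous (a + b + n) := by
  have := (((crX_hom (d := d) s' l).pow a).mul ((crX_hom (d := d) s l).pow b)).mul (isHomogeneous_X_pow (R := T d) k n)
  rw [one_mul, one_mul] at this
  exact this

def Wf (i : Fin 2) (P : MvPolynomial (Fin 3) (T d)) : Sg d → T d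
  | Sum.inl e => if i = 0 then coeff e.1 P else 0
  | Sum.inr e => if i = 0 then 0 else coeff e.1 P

lemma Fc_Wf {K : Type} [Field K] [Algebra ℂ K] (φ : Sg d → K) (y : Gv → K) (i : Fin 2)
    (P : MvPolynomial (Fin 3) (T d)) (hP : P.IsHomogeneous d) (τ : K) (v : Fin 3 → K) :
    Fc (fun x => φ x + τ * ev φ y (Wf i P x)) y v = Fc φ y v + τ * y (gc i) * eval v (map (ev φ y) P) := by
  rw [← fev_coeff (d := d) _ (hP.map _)]
  simp only [coeff_map]
  fin_cases i
  · simp only [Fc, Wf]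
    simp only [Fin.zero_eta, if_true, map_zero, mul_zero, add_zero, fev_add]
    ring
  · simp only [Fc, Wf]
    simp only [Fin.mk_one, one_ne_zero, if_false, map_zero, mul_zero, add_zero, fev_add]
    ring

def xi (d : ℕ) (s s' : Fin 2) (a b n : ℕ) (β : Bi) : T d :=
  X (gp s' (bp β s')) ^ (n + 1 + b) * X (gu β.2.2.2) ^ (n + 1 + b) *
    X (gp s' (bp β s')) ^ a * X (gp s (bp β s)) ^ b

def xw (s s' : Fin 2) (a b n : ℕ) (β : Bi) : Fin 4 → ℤ :=
  (n + 1 + b) • wt (gp s' (bp β s')) + (n + 1 + b) • wt (gu β.2.2.2) +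
        a • wt (gp s' (bp β s')) + b • wt (gp s (bp β s))

def NN (d : ℕ) (s s' : Fin 2) (a b n : ℕ) (β : Bi) : T d :=
  (-1) ^ (a + b) *
    (PolS (fun i => (C (X i : A d) : T d)) (fun i => (X i : T d)) s s' a (n + 1 + b) (bp β s') (bp β s) β.2.2.2).coeff b

lemma hXp (g : Gv) (k : ℕ) : (X g ^ k : T d) ∈ Tm d (k • wt g) :=
  (isWeightedHomogeneous_X (A d) (wt) g).pow k

lemma xi_mem (s s' : Fin 2) (a b n : ℕ) (β : Bi) : xi d s s' a b n β ∈ Tm d (xw s s' a b n β) :=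
  Tm_mul (Tm_mul (Tm_mul (hXp _ _) (hXp _ _)) (hXp _ _)) (hXp _ _)

lemma xi_dvd (s s' : Fin 2) (a b n : ℕ) (β : Bi) :
    xi d s s' a b n β ∣ bm d β ^ ((n + 1 + b) + (n + 1 + b) + a + b) := by
  have h1 : (X (gp s' (bp β s')) ^ (n + 1 + b) : T d) ∣ bm d β ^ (n + 1 + b) := pow_dvd_pow_of_dvd (dvd_bm_p β s') _
  have h2 : (X (gu β.2.2.2) ^ (n + 1 + b) : T d) ∣ bm d β ^ (n + 1 + b) := pow_dvd_pow_of_dvd (dvd_bm_u β) _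
  have h3 : (X (gp s' (bp β s')) ^ a : T d) ∣ bm d β ^ a := pow_dvd_pow_of_dvd (dvd_bm_p β s') _
  have h4 : (X (gp s (bp β s)) ^ b : T d) ∣ bm d β ^ b := pow_dvd_pow_of_dvd (dvd_bm_p β s) _
  have := mul_dvd_mul (mul_dvd_mul (mul_dvd_mul h1 h2) h3) h4
  rw [← pow_add, ← pow_add, ← pow_add] at this
  exact this

lemma xi_ev_ne {K : Type} [Field K] [Algebra ℂ K] (φ : Sg d → K) (y : Gv → K) (hy : ∀ g, y g ≠ 0)
    (s s' : Fin 2) (a b n : ℕ) (β : Bi) : ev φ y (xi d s s' a b n β) ≠ 0 := by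
  simp only [xi, map_mul, map_pow, ev_X]
  exact mul_ne_zero (mul_ne_zero (mul_ne_zero (pow_ne_zero _ (hy _)) (pow_ne_zero _ (hy _)))
        (pow_ne_zero _ (hy _))) (pow_ne_zero _ (hy _))

lemma NN_val {K : Type} [Field K] [Algebra ℂ K] (s s' : Fin 2) (a b n : ℕ) (β : Bi) (φ : Sg d → K) (y : Gv → K) (r : ℕ → K)
    (hb : InB Set.univ y) (hr : CtR s s' a b (n + 1) φ y r) (hy : ∀ g, y g ≠ 0) :
      ev φ y (NN d s s' a b n β) = ev φ y (xi d s s' a b n β) *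
        (y (gc 0) * y (gu 1) ^ (a + b) * bev (n + 1) r (y (gp s 0)) (y (gp s 2))) := by
  have h1 := value_lemma φ y r s s' a b (n + 1) hb hr hy (bp β s') (bp β s) β.2.2.2
  have h2 := congrArg (fun P => Polynomial.coeff P b) (map_PolS (ev φ y) (fun i => (C (X i : A d) : T d)) (fun i => (X i : T d))
      s s' a (n + 1 + b) (bp β s') (bp β s) β.2.2.2)
  simp only [Polynomial.coeff_map, ev_X, ev_C, aeval_X] at h2
  simp only [NN, xi, map_mul, map_pow, map_neg, map_one, ev_X]
  rw [h2, h1, ← mul_assoc, ← pow_add, Even.neg_one_pow ⟨a + b, rfl⟩, one_mul, mul_pow]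

def eta (d : ℕ) (s : Fin 2) (a b n : ℕ) (β : Bi) : T d :=
  X (gc β.1) * X (gu β.2.2.2) ^ (a + b) * X (gp s (bp β s)) ^ (n + 1)

lemma eta_ne {K : Type} [Field K] [Algebra ℂ K] (φ : Sg d → K) (y : Gv → K) (hy : ∀ g, y g ≠ 0)
    (s : Fin 2) (a b n : ℕ) (β : Bi) : ev φ y (eta d s a b n β) ≠ 0 := by
  simp only [eta, map_mul, map_pow, ev_X]
  exact mul_ne_zero (mul_ne_zero (hy _) (pow_ne_zero _ (hy _))) (pow_ne_zero _ (hy _))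

lemma eta_dvd (s : Fin 2) (a b n : ℕ) (β : Bi) : eta d s a b n β ∣ bm d β ^ (1 + (a + b) + (n + 1)) := by
  have h1 : (X (gc β.1) : T d) ∣ bm d β ^ 1 := by rw [pow_one]; exact dvd_bm_c β
  have h2 : (X (gu β.2.2.2) ^ (a + b) : T d) ∣ bm d β ^ (a + b) := pow_dvd_pow_of_dvd (dvd_bm_u β) _
  have h3 : (X (gp s (bp β s)) ^ (n + 1) : T d) ∣ bm d β ^ (n + 1) := pow_dvd_pow_of_dvd (dvd_bm_p β s) _
  have := mul_dvd_mul (mul_dvd_mul h1 h2) h3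
  rw [← pow_add, ← pow_add] at this
  exact this

lemma NN_scale {K : Type} [Field K] [Algebra ℂ K] (s s' : Fin 2) (a b n : ℕ) (β : Bi) (φ : Sg d → K) (y : Gv → K) (r : ℕ → K)
    (hb : InB Set.univ y) (hr : CtR s s' a b (n + 1) φ y r) (hy : ∀ g, y g ≠ 0) (t : Fin 4 → ℂˣ) :
    ev φ (scl t y) (NN d s s' a b n β) = chi t (xw s s' a b n β + (wt (gc 0) + (n + 1) • wt (gp s 0) + (a + b) • wt (gu 0)
        + (- (a • wt (gp s' 0) + b • wt (gp s 0))))) • ev φ y (NN d s s' a b n β) := by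
  rw [NN_val s s' a b n β _ _ _ (hb.scale t) (hr.scale t) (fun g => scl_ne t _ g (hy g)),
    NN_val s s' a b n β _ _ _ hb hr hy, ev_scl_hom _ _ t (xi_mem s s' a b n β), chi_add t _ (_ + _)]
  rw [mul_smul, smul_mul_assoc, ← mul_smul_comm]
  congr 2
  simp only [chi_add, chi_nsmul, chi_neg, chi_wt]
  simp only [Algebra.smul_def, scl, map_mul, map_pow, map_inv₀]
  have q1 : grp (gp s 2) = grp (gp s 0) := rfl
  have q2 : grp (gu 1) = grp (gu 0) := rfl
  rw [q1, q2, bev_smul, bev_mul_left, mul_inv, inv_pow, inv_pow]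
  ring

theorem contact_step (Z Z' : Stage d) (s s' : Fin 2) (a b n : ℕ) (hd : d = a + b + (n + 1))
    (hZ : ∀ (K : Type) [Field K] [Algebra ℂ K] (φ : Sg d → K) (y : Gv → K),
      Z.P K φ y ↔ InB Set.univ y ∧ ∃ r, CtR s s' a b (n + 1) φ y r)
    (hZ' : ∀ (K : Type) [Field K] [Algebra ℂ K] (φ : Sg d → K) (y : Gv → K),
      Z'.P K φ y ↔ InB Set.univ y ∧ ∃ r, CtR s s' a (b + 1) n φ y r)
    (r : ℕ → KK d) (hr : CtR s s' a b (n + 1) Z.φ Z.y r)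
    (hr0 : bev (n + 1) r (Z.y (gp s 0)) (Z.y (gp s 2)) ≠ 0) :
    ∃ m0 : ℤ, ∀ m : Fin 4 → ℤ, (∀ i, m0 ≤ m i) →
      HI Z.I m = HI Z'.I m + HI Z.I (m - (wt (gc 0) + (n + 1) • wt (gp s 0) + (a + b) • wt (gu 0)
        + (- (a • wt (gp s' 0) + b • wt (gp s 0))))) := by
  have hbZ := ((hZ _ _ _).1 Z.gen).1
  obtain ⟨hbZ', r', hr'⟩ := (hZ' _ _ _).1 Z'.gen
  obtain ⟨r2, hr2, hr20⟩ := hr'.up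
  have hle : Z.P (KK d) Z'.φ Z'.y := (hZ _ _ _).2 ⟨hbZ', r2, hr2⟩
  set f : KK d := Z.y (gc 0) * Z.y (gu 1) ^ (a + b) * bev (n + 1) r (Z.y (gp s 0)) (Z.y (gp s 2)) with hf
  have hNval := fun β => NN_val s s' a b n β _ _ _ hbZ hr Z.ne
  refine step Z.φ Z.y Z'.φ Z'.y Z.sclInv Z'.sclInv (fun g hg => Z.kill _ _ _ hle g hg) f
    (mul_ne_zero (mul_ne_zero (Z.ne _) (pow_ne_zero _ (Z.ne _))) hr0) _ ?_ ?_
  · intro β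
    refine ⟨xi d s s' a b n β, NN d s s' a b n β, _, _, xi_mem s s' a b n β, xi_dvd s s' a b n β, (hNval β).symm, ?_,
      xi_ev_ne _ _ Z'.ne s s' a b n β, NN_scale s s' a b n β _ _ _ hbZ hr Z.ne⟩
    rw [NN_val s s' a b n β _ _ _ hbZ' hr2 Z'.ne, hr20]; ring
  · intro β g hg
    have hτ : (-f / ev Z.φ Z.y (eta d s a b n β)) * ev Z.φ Z.y (eta d s a b n β) = - f :=
      div_mul_cancel₀ _ (eta_ne _ _ Z.ne s a b n β)
    refine shift_lemma Z.φ Z.y (Wf β.1 (Wp d s s' a b (n + 1) (bp β s) β.2.2.2)) (fun _ => 0) g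
      (xi d s s' a b n β) (eta d s a b n β) (NN d s s' a b n β) (bm d β) f
      (-f / ev Z.φ Z.y (eta d s a b n β)) (((n + 1 + b) + (n + 1 + b) + a + b) + (1 + (a + b) + (n + 1)))
      ((xi_dvd s s' a b n β).trans (pow_dvd_pow _ (by omega)))
      ((eta_dvd s a b n β).trans (pow_dvd_pow _ (by omega))) (hNval β).symm hτ ?_
    simp only [map_zero, mul_zero, add_zero]
    refine Z'.kill _ _ _ ((hZ' _ _ _).2 ⟨hbZ, ?_⟩) g hg
    refine CtR.shift hbZ Z.ne hr β.1 (bp β s) β.2.2.2 (-f / ev Z.φ Z.y (eta d s a b n β)) ?_ ?_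
    · rw [← hf]; simp only [eta, map_mul, map_pow, ev_X] at hτ ⊢; exact hτ
    · intro v
      rw [Fc_Wf _ _ _ _ (by have := Wp_hom (d := d) s s' a b (n + 1) (bp β s) β.2.2.2; rwa [← hd] at this)]
      simp [Wp, crX, map_cr]

end FB

end

end part8

section part9
open MvPolynomial

set_option linter.all false
noncomputable section
namespace FB
variable {d : ℕ}

lemma shift_dt {K : Type} [Field K] (y : Gv → K) (s s2 : Fin 2) (l : Fin 3) (hl : y (gu l) ≠ 0) :
    dt (uu (fun g => y g + (-(dt (uu y) (pp y s)) / y (gu l)) * (if g = gp s l then 1 else 0)))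
      (pp (fun g => y g + (-(dt (uu y) (pp y s)) / y (gu l)) * (if g = gp s l then 1 else 0)) s2) =
    if s2 = s then 0 else dt (uu y) (pp y s2) := by
  have e1 : ∀ i, (if gp s2 i = gp s l then (1:K) else 0) = if s2 = s ∧ i = l then 1 else 0 := by
    intro i; simp [gp]
  have e2 : ∀ i, (if gu i = gp s l then (1:K) else 0) = 0 := by
    intro i; simp [gu, gp]
  have e3 : (-(dt (uu y) (pp y s)) / y (gu l)) * y (gu l) = - dt (uu y) (pp y s) := div_mul_cancel₀ _ hl
  generalize (-(dt (uu y) (pp y s)) / y (gu l)) = τ at *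
  simp only [dt, uu, pp, e1, e2] at e3 ⊢
  by_cases h : s2 = s
  · subst h
    fin_cases l <;> simp at e3 ⊢ <;> linear_combination e3
  · simp [h]

lemma shift_InB {K : Type} [Field K] (y : Gv → K) (s : Fin 2) (l : Fin 3) (hl : ∀ l, y (gu l) ≠ 0)
    (h0 : y (gc 0) ≠ 0) (S : Set (Fin 2)) (hS : ∀ s' ∈ S, s' ≠ s → dt (uu y) (pp y s') = 0) :
    InB S (fun g => y g + (-(dt (uu y) (pp y s)) / y (gu l)) * (if g = gp s l then 1 else 0)) where
  c0 := by simpa using h0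
  u1 := by simpa using hl 1
  inc := by
    intro s' hs'
    rw [shift_dt y s s' l (hl l)]
    split_ifs with h
    · rfl
    · exact hS _ hs' h

lemma InC_zero {K : Type} [Field K] [Algebra ℂ K] (φ : Sg d → K) (y : Gv → K) (h : InB Set.univ y) : InC 0 0 d φ y where
  b := h
  ex := by
    obtain ⟨r1, h1⟩ := restrict_bev (fun e => φ (Sum.inl e)) (uu y) h.u1
    obtain ⟨r2, h2⟩ := restrict_bev (fun e => φ (Sum.inr e)) (uu y) h.u1
    refine ⟨fun i => r1 i + (y (gc 1) / y (gc 0)) * r2 i, fun v hv => ?_⟩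
    rw [bev_add, ← h1 v hv, ← h2 v hv, Fc]
    have := h.c0
    field_simp

theorem ch1 : ∃ m0 : ℤ, ∀ m : Fin 4 → ℤ, (∀ i, m0 ≤ m i) →
      HI (stF d).I m = HI (stB d {0}).I m + HI (stF d).I (m - (wt (gu 0) + wt (gp 0 0))) := by
  refine base_step _ _ 0 ?_ trivial ((gy_inB _).inc 0 rfl) ?_
  · intro h
    have h2 : dt (fun i => (ofy (gu i) : Om d)) (fun i => ofy (gp 0 i)) = 0 := by
      apply ii_inj (d := d)
      rw [map_zero, ← h]
      simp [dt, stF]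
    have := congrArg (aeval (fun _ => (1:ℂ))) h2
    simp [dt, ofy] at this
    norm_num at this
  · intro l
    exact shift_InB _ 0 l (fun l => (stF d).ne _) ((stF d).ne _) _ (fun s' h h' => absurd h h')

theorem ch2 : ∃ m0 : ℤ, ∀ m : Fin 4 → ℤ, (∀ i, m0 ≤ m i) →
      HI (stB d {0}).I m = HI (stC (d := d) 0 0 d (by omega)).I m + HI (stB d {0}).I (m - (wt (gu 0) + wt (gp 1 0))) := by
  refine base_step _ _ 1 ?_ ?_ ((gy_inB Set.univ).inc 1 trivial) ?_
  · intro h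
    have h2 : dt (fun i => (oy d {0} (gu i) : Om d)) (fun i => oy d {0} (gp 1 i)) = 0 := by
      apply ii_inj (d := d)
      rw [map_zero, ← h]
      simp [dt, stB]
    have := congrArg (aeval (fun _ => (1:ℂ))) h2
    simp [dt, oy, og] at this
    norm_num at this
  · have := gy_inB (d := d) Set.univ
    exact ⟨this.c0, this.u1, fun s _ => this.inc s trivial⟩
  · intro l
    refine InC_zero _ _ (shift_InB _ 1 l (fun l => (stB d {0}).ne _) ((stB d {0}).ne _) _ (fun s' _ h' => ?_))
    have : s' = 0 := by omega
    subst this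
    exact (gy_inB {0}).inc 0 rfl

lemma CtR_iff {K : Type} [Field K] (m0 m1 n : ℕ) (φ : Sg d → K) (y : Gv → K) :
    InC m0 m1 n φ y ↔ InB Set.univ y ∧ ∃ r, CtR 1 0 m0 m1 n φ y r :=
  ⟨fun h => ⟨h.b, h.ex⟩, fun h => ⟨h.1, h.2⟩⟩

lemma CtR_iff' {K : Type} [Field K] (m0 m1 n : ℕ) (φ : Sg d → K) (y : Gv → K) :
    InC m0 m1 n φ y ↔ InB Set.univ y ∧ ∃ r, CtR 0 1 m1 m0 n φ y r := by
  have : ∀ r, CtR 0 1 m1 m0 n φ y r ↔ CtR 1 0 m0 m1 n φ y r := by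
    intro r
    simp only [CtR, mul_right_comm (y (gc 0))]
  simp only [this]
  exact CtR_iff _ _ _ _ _

lemma gen_r_ne (n : ℕ) (s : Fin 2) :
    bev n (fun i => ii d (oR i)) (gy d Set.univ (gp s 0)) (gy d Set.univ (gp s 2)) ≠ 0 := by
  intro h
  have h2 : bev n (fun i => (oR i : Om d)) (oy d Set.univ (gp s 0)) (oy d Set.univ (gp s 2)) = 0 := by
    apply ii_inj (d := d)
    rw [map_zero, ← h, map_bev]
  have := congrArg (aeval (fun _ => (1:ℂ))) h2
  rw [map_bev] at this
  simp [oy, og, oR, bev] at this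
  norm_cast at this

theorem ch0 (b n : ℕ) (h : d = b + 0 + (n + 1)) (h' : d = (b + 1) + 0 + n) : ∃ m0 : ℤ, ∀ m : Fin 4 → ℤ, (∀ i, m0 ≤ m i) →
      HI (stC b 0 (n + 1) h).I m = HI (stC (b + 1) 0 n h').I m + HI (stC b 0 (n + 1) h).I
        (m - (wt (gc 0) + (n + 1) • wt (gp 0 0) + (0 + b) • wt (gu 0) + (- (0 • wt (gp 1 0) + b • wt (gp 0 0))))) := by
  refine contact_step (stC b 0 (n + 1) h) (stC (b + 1) 0 n h') 0 1 0 b n (by omega) (fun K _ _ φ y => CtR_iff' _ _ _ _ _) (fun K _ _ φ y => CtR_iff' _ _ _ _ _) (fun i => ii d (oR i)) ?_ (gen_r_ne _ _)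
  intro v hv
  have := gen_inC b 0 (n + 1) h v hv
  rw [pow_zero, mul_one] at this ⊢
  exact this

theorem chq (a b n : ℕ) (h : d = a + b + (n + 1)) (h' : d = a + (b + 1) + n) : ∃ m0 : ℤ, ∀ m : Fin 4 → ℤ, (∀ i, m0 ≤ m i) →
      HI (stC a b (n + 1) h).I m = HI (stC a (b + 1) n h').I m + HI (stC a b (n + 1) h).I
        (m - (wt (gc 0) + (n + 1) • wt (gp 1 0) + (a + b) • wt (gu 0) + (- (a • wt (gp 0 0) + b • wt (gp 1 0))))) := by
  exact contact_step (stC a b (n + 1) h) (stC a (b + 1) n h') 1 0 a b n (by omega) (fun K _ _ φ y => CtR_iff _ _ _ _ _) (fun K _ _ φ y => CtR_iff _ _ _ _ _) (fun i => ii d (oR i)) (gen_inC a b (n + 1) h) (gen_r_ne _ _)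

lemma stF_I : (stF d).I = ⊥ := by
  rw [eq_bot_iff]
  intro g hg
  have h1 := (stF d).kill _ (fun i => algebraMap (T d) (FractionRing (T d)) (C (X i))) (fun i => algebraMap (T d) (FractionRing (T d)) (X i)) trivial g hg
  have h2 := ringHom_eq_ev (d := d) (algebraMap (T d) (FractionRing (T d))) (by
    intro z; rw [IsScalarTower.algebraMap_apply ℂ (T d) (FractionRing (T d))]; rfl)
  rw [← h2] at h1
  exact IsFractionRing.injective (T d) (FractionRing (T d)) (by rw [h1, map_zero])
end FB

end

end part9

section part10
open MvPolynomial

set_option linter.all false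
noncomputable section
namespace FB
variable {d : ℕ}

abbrev EE (k n : ℕ) : Type := {e : Fin k →₀ ℕ // e ∈ Finset.finsuppAntidiag Finset.univ n}

def expEquiv (a b c e : ℕ) : {x : Gv →₀ ℕ // Finsupp.weight wt x = ![(a:ℤ), b, c, e]} ≃
    EE 2 a × EE 3 b × EE 3 c × EE 3 e where
  toFun x := (⟨Finsupp.equivFunOnFinite.symm fun i => x.1 (gc i), by
      have := congrFun x.2 0
      rw [weight_wt0] at this
      simp [Finset.mem_finsuppAntidiag, Fin.sum_univ_two] at this ⊢; exact_mod_cast this⟩,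
    ⟨Finsupp.equivFunOnFinite.symm fun i => x.1 (gp 0 i), by
      have := congrFun x.2 1
      rw [weight_wt1] at this
      simp [Finset.mem_finsuppAntidiag, Fin.sum_univ_three] at this ⊢; exact_mod_cast this⟩,
    ⟨Finsupp.equivFunOnFinite.symm fun i => x.1 (gp 1 i), by
      have := congrFun x.2 2
      rw [weight_wt2] at this
      simp [Finset.mem_finsuppAntidiag, Fin.sum_univ_three] at this ⊢; exact_mod_cast this⟩,
    ⟨Finsupp.equivFunOnFinite.symm fun i => x.1 (gu i), by
      have := congrFun x.2 3
      rw [weight_wt3] at this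
      simp [Finset.mem_finsuppAntidiag, Fin.sum_univ_three] at this ⊢; exact_mod_cast this⟩)
  invFun z := ⟨Finsupp.equivFunOnFinite.symm (Sum.elim (fun i => z.1.1 i)
      (Sum.elim (fun i => if i.1 = 0 then z.2.1.1 i.2 else z.2.2.1.1 i.2) (fun i => z.2.2.2.1 i))), by
    obtain ⟨⟨z1, h1⟩, ⟨z2, h2⟩, ⟨z3, h3⟩, ⟨z4, h4⟩⟩ := z
    simp [Finset.mem_finsuppAntidiag, Fin.sum_univ_two, Fin.sum_univ_three] at h1 h2 h3 h4
    funext i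
    fin_cases i
    · refine (weight_wt0 _).trans ?_
      simp; exact_mod_cast h1
    · refine (weight_wt1 _).trans ?_
      simp; exact_mod_cast h2
    · refine (weight_wt2 _).trans ?_
      simp; exact_mod_cast h3
    · refine (weight_wt3 _).trans ?_
      simp; exact_mod_cast h4⟩
  left_inv x := by
    ext g
    rcases g with i | ⟨s, i⟩ | i
    · simp
    · fin_cases s <;> simp
    · simp
  right_inv z := by
    obtain ⟨⟨z1, h1⟩, ⟨z2, h2⟩, ⟨z3, h3⟩, ⟨z4, h4⟩⟩ := z
    simp only [Prod.mk.injEq, Subtype.mk.injEq]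
    refine ⟨?_, ?_, ?_, ?_⟩ <;> ext <;> simp

lemma HI_bot (m : Fin 4 → ℤ) : HI (⊥ : Ideal (T d)) m = Nat.card {e : Gv →₀ ℕ // Finsupp.weight wt e = m} := by
  have h1 : ((⊥ : Ideal (T d)).restrictScalars (A d) ⊓ Tm d m : Submodule (A d) (T d)) = ⊥ := by
    rw [Submodule.restrictScalars_bot, bot_inf_eq]
  rw [HI, h1, finrank_bot, Nat.cast_zero, sub_zero]
  congr 1
  have : Finite {e : Gv →₀ ℕ | Finsupp.weight wt e = m} := finite_exps m
  have := Fintype.ofFinite {e : Gv →₀ ℕ | Finsupp.weight wt e = m}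
  rw [Tm, weightedHomogeneousSubmodule_eq_finsupp_supported]
  refine (LinearEquiv.finrank_eq (AddMonoidAlgebra.supportedEquivFinsupp {e : Gv →₀ ℕ | Finsupp.weight wt e = m})).trans ?_
  rw [Module.finrank_finsupp_self]
  exact (Nat.card_eq_fintype_card (α := {e : Gv →₀ ℕ | Finsupp.weight wt e = m})).symm

lemma HI_bot_val (a b c e : ℕ) : (HI (⊥ : Ideal (T d)) ![(a:ℤ), b, c, e] : ℚ) =
    (a + 1) * (b + 1) * (b + 2) * (c + 1) * (c + 2) * (e + 1) * (e + 2) / 8 := by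
  have hE2 : ∀ n, Nat.card (EE 2 n) = n + 1 := by
    intro n
    rw [Nat.card_eq_fintype_card, Fintype.card_coe, Finset.card_finsuppAntidiag_nat_eq_choose]
    simp [Nat.add_comm 1 n]
  have hE3 : ∀ n, (Nat.card (EE 3 n) : ℚ) = (n + 1) * (n + 2) / 2 := by
    intro n
    rw [Nat.card_eq_fintype_card, Fintype.card_coe, Finset.card_finsuppAntidiag_nat_eq_choose]
    have : 3 + n - 1 = n + 2 := by omega
    simp only [Finset.card_univ, Fintype.card_fin, this]
    rw [Nat.choose_symm_add, Nat.cast_choose_two]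
    push_cast; ring
  rw [HI_bot, Nat.card_congr (expEquiv a b c e), Nat.card_prod, Nat.card_prod, Nat.card_prod, hE2]
  push_cast
  rw [hE3, hE3, hE3]; ring

def Ev (I : Ideal (T d)) (P : ℚ → ℚ → ℚ → ℚ → ℚ) : Prop :=
  ∃ m0 : ℤ, ∀ m : Fin 4 → ℤ, (∀ i, m0 ≤ m i) → (HI I m : ℚ) = P (m 0) (m 1) (m 2) (m 3)

lemma Ev_step {I I' : Ideal (T d)} {P : ℚ → ℚ → ℚ → ℚ → ℚ} (h : Ev I P) (δ : Fin 4 → ℤ)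
    (hs : ∃ m0 : ℤ, ∀ m : Fin 4 → ℤ, (∀ i, m0 ≤ m i) → HI I m = HI I' m + HI I (m - δ))
    {P' : ℚ → ℚ → ℚ → ℚ → ℚ} (a b c e : ℚ) (ha : (δ 0 : ℚ) = a) (hb : (δ 1 : ℚ) = b) (hc : (δ 2 : ℚ) = c) (he : (δ 3 : ℚ) = e)
    (hP : ∀ i j k l, P' i j k l = P i j k l - P (i - a) (j - b) (k - c) (l - e)) : Ev I' P' := by
  obtain ⟨m1, h1⟩ := h
  obtain ⟨m2, h2⟩ := hs
  refine ⟨|m1| + |m2| + |δ 0| + |δ 1| + |δ 2| + |δ 3|, fun m hm => ?_⟩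
  have hd : ∀ i, δ i ≤ |δ 0| + |δ 1| + |δ 2| + |δ 3| := by
    intro i
    have := abs_nonneg (δ 0); have := abs_nonneg (δ 1); have := abs_nonneg (δ 2); have := abs_nonneg (δ 3)
    have := le_abs_self (δ i)
    have e : i = 0 ∨ i = 1 ∨ i = 2 ∨ i = 3 := by omega
    rcases e with rfl | rfl | rfl | rfl <;> linarith
  have q1 := le_abs_self m1
  have q2 := le_abs_self m2
  have r1 := abs_nonneg m1
  have r2 := abs_nonneg m2
  have q3 : 0 ≤ |δ 0| + |δ 1| + |δ 2| + |δ 3| := by positivity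
  have k1 := h1 m (fun i => by have := hm i; linarith)
  have k2 := h2 m (fun i => by have := hm i; linarith)
  have k3 := h1 (m - δ) (fun i => by have := hm i; have := hd i; simp only [Pi.sub_apply]; linarith)
  have : (HI I' m : ℚ) = HI I m - HI I (m - δ) := by rw [k2]; push_cast; ring
  rw [this, k1, k3, hP]
  simp only [Pi.sub_apply, Int.cast_sub, ha, hb, hc, he]

lemma wt_gc (i : Fin 2) : wt (gc i) = ![1, 0, 0, 0] := by
  ext j; fin_cases j <;> simp [wt, grp]
lemma wt_gp0 (i : Fin 3) : wt (gp 0 i) = ![0, 1, 0, 0] := by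
  ext j; fin_cases j <;> simp [wt, grp]
lemma wt_gp1 (i : Fin 3) : wt (gp 1 i) = ![0, 0, 1, 0] := by
  ext j; fin_cases j <;> simp [wt, grp]
lemma wt_gu (i : Fin 3) : wt (gu i) = ![0, 0, 0, 1] := by
  ext j; fin_cases j <;> simp [wt, grp]

theorem HI_final (n : ℕ) : ∃ m0 : ℤ, ∀ m : Fin 4 → ℤ, (∀ i, m0 ≤ m i) →
    HI (stC (d := n + 5) 3 2 n (by omega)).I m = 3*n^4 + 57*n^3 + 303*n^2 + 555*n + 306 := by
  have h0 : Ev (stF (n + 5)).I (fun i j k l => (i+1)*(j+1)*(j+2)*(k+1)*(k+2)*(l+1)*(l+2)/8) := by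
    refine ⟨0, fun m hm => ?_⟩
    obtain ⟨a, ha⟩ := Int.eq_ofNat_of_zero_le (hm 0)
    obtain ⟨b, hb⟩ := Int.eq_ofNat_of_zero_le (hm 1)
    obtain ⟨c, hc⟩ := Int.eq_ofNat_of_zero_le (hm 2)
    obtain ⟨e, he⟩ := Int.eq_ofNat_of_zero_le (hm 3)
    have : m = ![(a:ℤ), b, c, e] := by
      ext i; fin_cases i <;> simp [ha, hb, hc, he]
    subst this
    rw [stF_I, HI_bot_val]; simp
  have h1 := Ev_step (P' := fun i j k l => (1/4)*i*j^2*k^2*l + (1/4)*i*j^2*k^2 + (3/4)*i*j^2*k*l + (3/4)*i*j^2*k + (1/2)*i*j^2*l + (1/2)*i*j^2 + (1/4)*i*j*k^2*l^2 + (1)*i*j*k^2*l + (3/4)*i*j*k^2 + (3/4)*i*j*k*l^2 + (3)*i*j*k*l + (9/4)*i*j*k + (1/2)*i*j*l^2 + (2)*i*j*l + (3/2)*i*j + (1/4)*i*k^2*l^2 + (3/4)*i*k^2*l + (1/2)*i*k^2 + (3/4)*i*k*l^2 + (9/4)*i*k*l + (3/2)*i*k + (1/2)*i*l^2 + (3/2)*i*l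 + (1)*i + (1/4)*j^2*k^2*l + (1/4)*j^2*k^2 + (3/4)*j^2*k*l + (3/4)*j^2*k + (1/2)*j^2*l + (1/2)*j^2 + (1/4)*j*k^2*l^2 + (1)*j*k^2*l + (3/4)*j*k^2 + (3/4)*j*k*l^2 + (3)*j*k*l + (9/4)*j*k + (1/2)*j*l^2 + (2)*j*l + (3/2)*j + (1/4)*k^2*l^2 + (3/4)*k^2*l + (1/2)*k^2 + (3/4)*k*l^2 + (9/4)*k*l + (3/2)*k + (1/2)*l^2 + (3/2)*l + (1)) h0 _ ch1 0 1 0 1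
    (by simp [wt_gc, wt_gp0, wt_gp1, wt_gu] <;> ring) (by simp [wt_gc, wt_gp0, wt_gp1, wt_gu] <;> ring) (by simp [wt_gc, wt_gp0, wt_gp1, wt_gu] <;> ring) (by simp [wt_gc, wt_gp0, wt_gp1, wt_gu] <;> ring)
    (by intro i j k l; ring)
  have h2 := Ev_step (P' := fun i j k l => (1/4)*i*j^2*k^2 + (1/2)*i*j^2*k*l + (3/4)*i*j^2*k + (1/2)*i*j^2*l + (1/2)*i*j^2 + (1/2)*i*j*k^2*l + (3/4)*i*j*k^2 + (1/2)*i*j*k*l^2 + (5/2)*i*j*k*l + (9/4)*i*j*k + (1/2)*i*j*l^2 + (2)*i*j*l + (3/2)*i*j + (1/2)*i*k^2*l + (1/2)*i*k^2 + (1/2)*i*k*l^2 + (2)*i*k*l + (3/2)*i*k + (1/2)*i*l^2 + (3/2)*i*l + (1)*i + (1/4)*j^2*k^2 + (1/2)*j^2*k*l + (3/4)*j^2*k + (1/2)*j^2*l + (1/2)*j^2 + (1/2)*j*k^2*l + (3/4)*j*k^2 + (1/2)*j*k*l^2 + (5/2)*j*k*l + (9/4)*j*k + (1/2)*j*l^2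 + (2)*j*l + (3/2)*j + (1/2)*k^2*l + (1/2)*k^2 + (1/2)*k*l^2 + (2)*k*l + (3/2)*k + (1/2)*l^2 + (3/2)*l + (1)) h1 _ ch2 0 0 1 1
    (by simp [wt_gc, wt_gp0, wt_gp1, wt_gu] <;> ring) (by simp [wt_gc, wt_gp0, wt_gp1, wt_gu] <;> ring) (by simp [wt_gc, wt_gp0, wt_gp1, wt_gu] <;> ring) (by simp [wt_gc, wt_gp0, wt_gp1, wt_gu] <;> ring)
    (by intro i j k l; ring)
  have h3 := Ev_step (P' := fun i j k l => (1/2)*i*j*k^2*n + (5/2)*i*j*k^2 + (1)*i*j*k*l*n + (5)*i*j*k*l + (3/2)*i*j*k*n + (15/2)*i*j*k + (1)*i*j*l*n + (5)*i*j*l + (1)*i*j*n + (5)*i*j + (1/2)*i*k^2*l*n + (5/2)*i*k^2*l + (-1/4)*i*k^2*n^2 + (-7/4)*i*k^2*n + (-5/2)*i*k^2 + (1/2)*i*k*l^2*n + (5/2)*i*k*l^2 + (-1/2)*i*k*l*n^2 + (-5/2)*i*k*l*n + (-3/4)*i*k*n^2 + (-21/4)*i*k*n + (-15/2)*i*k +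 (1/2)*i*l^2*n + (5/2)*i*l^2 + (-1/2)*i*l*n^2 + (-3)*i*l*n + (-5/2)*i*l + (-1/2)*i*n^2 + (-7/2)*i*n + (-5)*i + (1/4)*j^2*k^2 + (1/2)*j^2*k*l + (3/4)*j^2*k + (1/2)*j^2*l + (1/2)*j^2 + (1/2)*j*k^2*l + (3/4)*j*k^2 + (1/2)*j*k*l^2 + (5/2)*j*k*l + (9/4)*j*k + (1/2)*j*l^2 + (2)*j*l + (3/2)*j + (1/2)*k^2*l + (1/2)*k^2 + (1/2)*k*l^2 + (2)*k*l + (3/2)*k + (1/2)*l^2 + (3/2)*l + (1)) h2 _ (ch0 0 (n+4) (by omega) (by omega)) 1 (n+5) 0 0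
    (by simp [wt_gc, wt_gp0, wt_gp1, wt_gu] <;> ring) (by simp [wt_gc, wt_gp0, wt_gp1, wt_gu] <;> ring) (by simp [wt_gc, wt_gp0, wt_gp1, wt_gu] <;> ring) (by simp [wt_gc, wt_gp0, wt_gp1, wt_gu] <;> ring)
    (by intro i j k l; ring)
  have h4 := Ev_step (P' := fun i j k l => (1)*i*j*k*n + (5)*i*j*k + (1)*i*j*n + (5)*i*j + (1/2)*i*k^2*n^2 + (9/2)*i*k^2*n + (10)*i*k^2 + (1)*i*k*l*n^2 + (9)*i*k*l*n + (20)*i*k*l + (1)*i*k*n + (5)*i*k + (1)*i*l*n^2 + (9)*i*l*n + (20)*i*l + (-1/2)*i*n^2 + (-7/2)*i*n + (-5)*i + (1/2)*j^2*k + (1/2)*j^2 + (1)*j*k^2*n + (9/2)*j*k^2 + (2)*j*k*l*n + (9)*j*k*l + (1)*j*k*n + (6)*j*k + (2)*j*l*n + (9)*j*l + (3/2)*j + (1)*k^2*l*n + (4)*k^2*l + (-1)*k^2*n^2 + (-15/2)*k^2*n + (-27/2)*k^2 + (1)*k*l^2*n + (4)*k*l^2 + (-2)*k*l*n^2 + (-13)*k*l*n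 + (-19)*k*l + (-1)*k*n^2 + (-15/2)*k*n + (-25/2)*k + (1)*l^2*n + (4)*l^2 + (-2)*l*n^2 + (-14)*l*n + (-23)*l + (1)) h3 _ (ch0 1 (n+3) (by omega) (by omega)) 1 (n+3) 0 1
    (by simp [wt_gc, wt_gp0, wt_gp1, wt_gu] <;> ring) (by simp [wt_gc, wt_gp0, wt_gp1, wt_gu] <;> ring) (by simp [wt_gc, wt_gp0, wt_gp1, wt_gu] <;> ring) (by simp [wt_gc, wt_gp0, wt_gp1, wt_gu] <;> ring)
    (by intro i j k l; ring)
  have h5 := Ev_step (P' := fun i j k l => (3)*i*k*n^2 + (24)*i*k*n + (45)*i*k + (3)*i*n^2 + (24)*i*n + (45)*i + (6)*j*k*n + (24)*j*k + (6)*j*n + (24)*j + (3/2)*k^2*n^2 + (12)*k^2*n + (45/2)*k^2 + (3)*k*l*n^2 + (24)*k*l*n + (45)*k*l + (-21/2)*k*n^2 + (-69)*k*n + (-213/2)*k + (3)*l*n^2 + (24)*l*n + (45)*l + (-12)*n^2 + (-81)*n + (-129)) h4 _ (ch0 2 (n+2) (by omega) (by omega)) 1 (n+1) 0 2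
    (by simp [wt_gc, wt_gp0, wt_gp1, wt_gu] <;> ring) (by simp [wt_gc, wt_gp0, wt_gp1, wt_gu] <;> ring) (by simp [wt_gc, wt_gp0, wt_gp1, wt_gu] <;> ring) (by simp [wt_gc, wt_gp0, wt_gp1, wt_gu] <;> ring)
    (by intro i j k l; ring)
  have h6 := Ev_step (P' := fun i j k l => (3)*i*n^3 + (30)*i*n^2 + (93)*i*n + (90)*i + (6)*j*n^2 + (36)*j*n + (48)*j + (3)*k*n^3 + (42)*k*n^2 + (171)*k*n + (198)*k + (3)*l*n^3 + (30)*l*n^2 + (93)*l*n + (90)*l + (-3/2)*n^4 + (-81/2)*n^3 + (-513/2)*n^2 + (-1137/2)*n + (-411)) h5 _ (chq 3 0 (n+1) (by omega) (by omega)) 1 (-3) (n+2) 3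
    (by simp [wt_gc, wt_gp0, wt_gp1, wt_gu] <;> ring) (by simp [wt_gc, wt_gp0, wt_gp1, wt_gu] <;> ring) (by simp [wt_gc, wt_gp0, wt_gp1, wt_gu] <;> ring) (by simp [wt_gc, wt_gp0, wt_gp1, wt_gu] <;> ring)
    (by intro i j k l; ring)
  have h7 := Ev_step (P' := fun i j k l => (3)*n^4 + (57)*n^3 + (303)*n^2 + (555)*n + (306)) h6 _ (chq 3 1 n (by omega) (by omega)) 1 (-3) n 4
    (by simp [wt_gc, wt_gp0, wt_gp1, wt_gu] <;> ring) (by simp [wt_gc, wt_gp0, wt_gp1, wt_gu] <;> ring) (by simp [wt_gc, wt_gp0, wt_gp1, wt_gu] <;> ring) (by simp [wt_gc, wt_gp0, wt_gp1, wt_gu] <;> ring)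
    (by intro i j k l; ring)
  obtain ⟨m0, h⟩ := h7
  refine ⟨m0, fun m hm => ?_⟩
  have := h m hm
  rw [← @Int.cast_inj ℚ, this]; push_cast; ring
end FB

end

end part10

section part11
open MvPolynomial

set_option linter.all false
noncomputable section
namespace FB
variable {d : ℕ}

lemma inj_of_HI {K : Type*} [Field K] [Algebra ℂ K] (φ : Sg d → K) (y : Gv → K) (m : Fin 4 → ℤ)
    (h : 0 < HI (RingHom.ker (ev φ y)) m) (a : A d) (ha : aeval φ a = 0) : a = 0 := by
  by_contra hne
  let V : Submodule (A d) (T d) := (RingHom.ker (ev φ y)).restrictScalars (A d) ⊓ Tm d m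
  let f : Tm d m →ₗ[A d] V :=
    { toFun := fun x => ⟨a • x.1, ⟨by
        show a • x.1 ∈ RingHom.ker (ev φ y)
        rw [RingHom.mem_ker, smul_eq_C_mul, map_mul, ev_C, ha, zero_mul], (Tm d m).smul_mem _ x.2⟩⟩
      map_add' := by intro x x'; ext1; simp
      map_smul' := by intro b x; ext1; simp [smul_smul, mul_comm] }
  have hf : Function.Injective f := by
    intro x x' hx
    have h1 : a • x.1 = a • x'.1 := congrArg (fun z : V => z.1) hx
    rw [smul_eq_C_mul, smul_eq_C_mul] at h1
    have hC : (C a : T d) ≠ 0 := by rwa [Ne, C_eq_zero]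
    exact Subtype.ext (mul_left_cancel₀ hC h1)
  have := LinearMap.finrank_le_finrank_of_injective hf
  rw [HI] at h
  have h2 : (Module.finrank (A d) (Tm d m) : ℤ) ≤ Module.finrank (A d) V := by exact_mod_cast this
  have h3 : (Module.finrank (A d) V : ℤ) = (Module.finrank (A d) (Submodule.restrictScalars (A d) (RingHom.ker (ev φ y)) ⊓ Tm d m : Submodule (A d) (T d)) : ℤ) := rfl
  omega

/-- rank over a domain equals the dimension of the span over the fraction field -/
lemma finrank_span_frac {A k K : Type*} [CommRing A] [IsDomain A] [Field k] [Algebra A k] [IsFractionRing A k]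
    [Field K] [Algebra A K] [Algebra k K] [IsScalarTower A k K] (M : Submodule A K) [Module.Finite A M] :
    Module.Finite k (Submodule.span k (M : Set K)) ∧
    Module.finrank k (Submodule.span k (M : Set K)) = Module.finrank A M := by
  have hfin : Module.Finite k (Submodule.span k (M : Set K)) := by
    obtain ⟨S, hS⟩ := (Module.Finite.iff_fg.1 (inferInstance : Module.Finite A M))
    have : Submodule.span k (M : Set K) = Submodule.span k (S : Set K) := by
      apply le_antisymm
      · apply Submodule.span_le.2
        rw [← hS]
        exact Submodule.span_le_restrictScalars A k (S : Set K)
      · apply Submodule.span_mono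
        rw [← hS]; exact Submodule.subset_span
    rw [this]
    exact Module.Finite.span_of_finite k S.finite_toSet
  refine ⟨hfin, le_antisymm ?_ ?_⟩
  · obtain ⟨b, hbs, hspan, hli⟩ := exists_linearIndependent k (M : Set K)
    rw [← hspan]
    let w0 : b → Submodule.span k (M : Set K) := fun x => ⟨x.1, Submodule.subset_span (hbs x.2)⟩
    have hw0 : LinearIndependent k w0 := LinearIndependent.of_comp (Submodule.span k (M : Set K)).subtype hli
    have hbfin : Finite b := hw0.finite
    have := Fintype.ofFinite b
    have e1 : Module.finrank k (Submodule.span k b) = Fintype.card b := by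
      have := finrank_span_eq_card hli
      rwa [Subtype.range_coe] at this
    rw [e1]
    have hli' : LinearIndependent A (Subtype.val : b → K) := (LinearIndependent.iff_fractionRing A k).2 hli
    let w : b → M := fun x => ⟨x.1, hbs x.2⟩
    have hw : LinearIndependent A w := by
      apply LinearIndependent.of_comp M.subtype
      exact hli'
    exact hw.fintype_card_le_finrank
  · obtain ⟨s, hs, hli⟩ := exists_finset_linearIndependent_of_le_finrank (R := A) (M := M) le_rfl
    have h2 : LinearIndependent A (fun x : s => (x.1 : K)) := hli.map' M.subtype (by simp)
    have h3 := (LinearIndependent.iff_fractionRing A k).1 h2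
    let w : s → Submodule.span k (M : Set K) := fun x => ⟨x.1, Submodule.subset_span x.1.2⟩
    have hw : LinearIndependent k w := LinearIndependent.of_comp (Submodule.span k (M : Set K)).subtype h3
    have := hw.fintype_card_le_finrank
    simpa [hs] using this

lemma ev_norm_monomial {R : Type*} [Field R] [Algebra ℂ R] (φ : Sg d → R) (y : Gv → R) (s : Fin 4 → R)
    (hs : ∀ i, s i ≠ 0) (e : Gv →₀ ℕ) (a : A d) :
    ev φ (fun g => y g / s (grp g)) (monomial e a) * ∏ i, s i ^ (Finsupp.weight wt e i) = ev φ y (monomial e a) := by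
  simp only [ev, coe_eval₂Hom, eval₂_monomial]
  rw [mul_assoc]
  congr 1
  have hw : ∏ i, s i ^ (Finsupp.weight wt e i) = e.prod fun g n => s (grp g) ^ n := by
    induction e using Finsupp.induction_linear with
    | zero => simp
    | add f g hf hg =>
      rw [map_add, Finsupp.prod_add_index' (by simp) (by intros; rw [pow_add]), ← hf, ← hg, ← Finset.prod_mul_distrib]
      exact Finset.prod_congr rfl fun i _ => by rw [Pi.add_apply, zpow_add₀ (hs i)]
    | single g n =>
      rw [Finsupp.weight_single, Finsupp.prod_single_index (by simp)]
      rw [Finset.prod_eq_single (grp g)]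
      · simp [wt]
      · intro b _ hb; simp [wt, Pi.single_eq_of_ne hb]
      · simp
  rw [hw]
  simp only [Finsupp.prod, ← Finset.prod_mul_distrib]
  refine Finset.prod_congr rfl fun g _ => ?_
  rw [← mul_pow, div_mul_cancel₀ _ (hs _)]

lemma ev_norm {R : Type*} [Field R] [Algebra ℂ R] (φ : Sg d → R) (y : Gv → R) (s : Fin 4 → R)
    (hs : ∀ i, s i ≠ 0) {m : Fin 4 → ℤ} {g : T d} (hg : g ∈ Tm d m) :
    ev φ (fun g => y g / s (grp g)) g * ∏ i, s i ^ (m i) = ev φ y g := by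
  rw [g.as_sum, map_sum, map_sum, Finset.sum_mul]
  refine Finset.sum_congr rfl fun e he => ?_
  rw [← hg (mem_support_iff.1 he)]
  exact ev_norm_monomial _ _ _ hs _ _

end FB

end

end part11

section part12
open MvPolynomial

set_option linter.all false
noncomputable section
namespace FB
variable {d : ℕ}

def bs : Fin 4 → Gv := ![gc 0, gp 0 0, gp 1 0, gu 1]
lemma grp_bs (i : Fin 4) : grp (bs i) = i := by fin_cases i <;> rfl

def yn {K : Type*} [Field K] (y : Gv → K) (g : Gv) : K := y g / y (bs (grp g))

lemma yn_bs {K : Type*} [Field K] (y : Gv → K) (hy : ∀ g, y g ≠ 0) (i : Fin 4) : yn y (bs i) = 1 := by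
  rw [yn, grp_bs, div_self (hy _)]

section
variable {K : Type} [Field K] [Algebra ℂ K] {k : Type*} [Field k] [Algebra (A d) k] [IsFractionRing (A d) k]
  [Algebra (A d) K] [Algebra k K] [IsScalarTower (A d) k K]

def Phi (φ : Sg d → K) (y : Gv → K) (hA : ∀ a, algebraMap (A d) K a = aeval φ a) : T d →ₗ[A d] K where
  toFun := ev φ y
  map_add' := map_add _
  map_smul' := by intro a x; rw [smul_eq_C_mul, map_mul, ev_C, ← hA, RingHom.id_apply, Algebra.smul_def]

lemma finrank_Phi (φ : Sg d → K) (y : Gv → K) (hA : ∀ a, algebraMap (A d) K a = aeval φ a)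
    (hy : ∀ g, y g ≠ 0) (m : Fin 4 → ℤ) :
    (Module.finrank (A d) ((Tm d m).map (Phi φ (yn y) hA)) : ℤ) = HI (RingHom.ker (ev φ y)) m := by
  have e2 := rn (R := A d) (M := Tm d m) (N := K) ((Phi φ (yn y) hA).domRestrict (Tm d m))
  rw [LinearMap.range_domRestrict] at e2
  have hk : ∀ x ∈ Tm d m, ev φ (yn y) x = 0 ↔ ev φ y x = 0 := by
    intro x hx
    have h1 := ev_norm φ y (fun i => y (bs i)) (fun i => hy _) hx
    have h2 : ∏ i, y (bs i) ^ (m i) ≠ 0 := Finset.prod_ne_zero_iff.2 fun i _ => zpow_ne_zero _ (hy _)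
    rw [← h1]
    show _ ↔ ev φ (yn y) x * _ = 0
    simp [h2]
  have k1 : Module.finrank (A d) (LinearMap.ker ((Phi φ (yn y) hA).domRestrict (Tm d m))) =
      Module.finrank (A d) ((RingHom.ker (ev φ y)).restrictScalars (A d) ⊓ Tm d m : Submodule (A d) (T d)) := by
    apply LinearEquiv.finrank_eq
    exact
      { toFun := fun x => ⟨x.1.1, ⟨(hk _ x.1.2).1 x.2, x.1.2⟩⟩
        invFun := fun x => ⟨⟨x.1, x.2.2⟩, (hk _ x.2.2).2 x.2.1⟩
        left_inv := fun x => rfl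
        right_inv := fun x => rfl
        map_add' := fun x x' => rfl
        map_smul' := fun x x' => rfl }
  rw [HI, ← k1, ← e2]; push_cast; ring

def nu (d : ℕ) (M : ℕ) : T d := ∏ i, X (bs i) ^ M

lemma nu_mem (M : ℕ) : nu d M ∈ Tm d (fun _ => (M : ℤ)) := by
  have h : (∑ i : Fin 4, M • wt (bs i)) = fun _ => (M:ℤ) := by
    ext j
    fin_cases j <;> simp [Fin.sum_univ_four, wt, grp_bs]
  rw [← h]
  exact IsWeightedHomogeneous.prod _ _ _ fun i _ => hXp _ _

lemma ev_nu (φ : Sg d → K) (y : Gv → K) (hy : ∀ g, y g ≠ 0) (M : ℕ) : ev φ (yn y) (nu d M) = 1 := by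
  simp [nu, map_prod, yn_bs y hy]

variable (k) in
theorem field_finrank (φ : Sg d → K) (y : Gv → K) (hA : ∀ a, algebraMap (A d) K a = aeval φ a)
    (hy : ∀ g, y g ≠ 0) (N : ℕ) (hN : 0 < N)
    (hHI : ∃ m0 : ℤ, ∀ m : Fin 4 → ℤ, (∀ i, m0 ≤ m i) → HI (RingHom.ker (ev φ y)) m = N) :
    Module.Finite k (Algebra.adjoin k (Set.range (yn y))) ∧
    Module.finrank k (Algebra.adjoin k (Set.range (yn y))) = N := by
  obtain ⟨m0, hm0⟩ := hHI
  let M : ℕ := m0.toNat + 1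
  let MM : ℕ → Submodule (A d) K := fun j => (Tm d (fun _ => (j : ℤ))).map (Phi φ (yn y) hA)
  let V : ℕ → Submodule k K := fun j => Submodule.span k (MM j : Set K)
  have hfin : ∀ j, Module.Finite k (V j) := fun j => (finrank_span_frac (k := k) (MM j)).1
  have hrk : ∀ j, M ≤ j → Module.finrank k (V j) = N := by
    intro j hj
    have h1 := (finrank_span_frac (k := k) (MM j)).2
    have h2 := finrank_Phi φ y hA hy (fun _ => (j : ℤ))
    rw [hm0 _ (fun i => by show m0 ≤ (j:ℤ); omega)] at h2
    rw [h1]; exact_mod_cast h2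
  have hmul : ∀ i j x x', x ∈ MM i → x' ∈ MM j → x * x' ∈ MM (i + j) := by
    rintro i j _ _ ⟨g, hg, rfl⟩ ⟨g', hg', rfl⟩
    refine ⟨g * g', ?_, map_mul (ev φ (yn y)) _ _⟩
    have := Tm_mul hg hg'
    have e : (fun _ => (i:ℤ)) + (fun _ => (j:ℤ)) = fun _ : Fin 4 => ((i + j : ℕ) : ℤ) := by ext; simp
    rw [e] at this
    exact this
  have hone : ∀ j, (1 : K) ∈ MM j := fun j => ⟨nu d j, nu_mem j, ev_nu φ y hy j⟩
  have hmono : ∀ i j, MM i ≤ MM (i + j) := by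
    intro i j x hx
    have := hmul i j x 1 hx (hone j)
    rwa [mul_one] at this
  have hVeq : V M = V (M + M) := by
    have := hfin (M + M)
    apply Submodule.eq_of_le_of_finrank_eq
    · exact Submodule.span_mono (hmono M M)
    · rw [hrk _ le_rfl, hrk _ (by omega)]
  have hVmul : ∀ x x', x ∈ V M → x' ∈ V M → x * x' ∈ V M := by
    intro x x' hx hx'
    rw [hVeq]
    have h1 : x * x' ∈ V M * V M := Submodule.mul_mem_mul hx hx'
    rw [Submodule.span_mul_span] at h1
    refine Submodule.span_mono ?_ h1
    rintro _ ⟨a, ha, b, hb, rfl⟩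
    exact hmul _ _ _ _ ha hb
  let S : Subalgebra k K := (V M).toSubalgebra (Submodule.subset_span (hone M)) hVmul
  have hS : Algebra.adjoin k (Set.range (yn y)) = S := by
    apply le_antisymm
    · apply Algebra.adjoin_le
      rintro _ ⟨g, rfl⟩
      show yn y g ∈ V M
      apply Submodule.subset_span
      let m' : Fin 4 → ℤ := fun i => (M : ℤ) - wt g i
      have hnn : ∀ i, 0 ≤ m' i := by
        intro i
        have : wt g i ≤ 1 := by
          rw [wt, Pi.single_apply]; split_ifs <;> simp
        show (0 : ℤ) ≤ (M : ℤ) - wt g i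
        have : (1 : ℤ) ≤ M := by simp [M]
        omega
      refine ⟨X g * ∏ i, X (bs i) ^ (m' i).toNat, ?_, ?_⟩
      · have h1 : (∏ i, X (bs i) ^ (m' i).toNat : T d) ∈ Tm d (∑ i, (m' i).toNat • wt (bs i)) :=
          IsWeightedHomogeneous.prod _ _ _ fun i _ => hXp _ _
        have h2 := Tm_mul (isWeightedHomogeneous_X (A d) wt g) h1
        have e : wt g + ∑ i, (m' i).toNat • wt (bs i) = fun _ => (M:ℤ) := by
         ext j
         have : (∑ i, (m' i).toNat • wt (bs i)) j = m' j := by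
          rw [Finset.sum_apply, Finset.sum_eq_single j]
          · simp [wt, grp_bs, hnn]
          · intro b _ hb; simp [wt, grp_bs, Pi.single_eq_of_ne hb.symm]
          · simp
         rw [Pi.add_apply, this]; simp [m']
        rw [e] at h2
        exact h2
      · show ev φ (yn y) _ = _
        simp [map_prod, yn_bs y hy]
    · show ∀ x ∈ V M, x ∈ Subalgebra.toSubmodule (Algebra.adjoin k (Set.range (yn y)))
      apply Submodule.span_le.2
      rintro _ ⟨g, hg, rfl⟩
      clear hg
      show ev φ (yn y) g ∈ Algebra.adjoin k (Set.range (yn y))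
      induction g using MvPolynomial.induction_on with
      | C a =>
        rw [ev_C, ← hA, IsScalarTower.algebraMap_apply (A d) k K]
        exact Subalgebra.algebraMap_mem _ _
      | add p q hp hq => rw [map_add]; exact Subalgebra.add_mem _ hp hq
      | mul_X p g hp =>
        rw [map_mul, ev_X]
        exact Subalgebra.mul_mem _ hp (Algebra.subset_adjoin ⟨g, rfl⟩)
  rw [hS]
  exact ⟨hfin M, hrk M le_rfl⟩
end
end FB

end

end part12

section part13
open MvPolynomial

set_option linter.all false
noncomputable section
namespace FB
variable {d : ℕ}

section cD
variable {R : Type*} [CommRing R] [Algebra ℂ R] {σ : Type*}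

def cDf (D : Derivation ℂ R R) (P : MvPolynomial σ R) : MvPolynomial σ R :=
  ∑ m ∈ P.support, monomial m (D (coeff m P))

lemma coeff_cDf (D : Derivation ℂ R R) (P : MvPolynomial σ R) (m : σ →₀ ℕ) :
    coeff m (cDf D P) = D (coeff m P) := by
  classical
  rw [cDf, coeff_sum]
  simp only [coeff_monomial]
  rw [Finset.sum_ite_eq' P.support m]
  split_ifs with h
  · rfl
  · rw [notMem_support_iff.1 h, map_zero]

def cD (D : Derivation ℂ R R) : Derivation ℂ (MvPolynomial σ R) (MvPolynomial σ R) :=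
  Derivation.mk' 
    { toFun := cDf D
      map_add' := by intro P Q; ext m; simp [coeff_cDf]
      map_smul' := by intro c P; ext m; simp [coeff_cDf] }
    (by
      classical
      intro P Q
      ext m
      show coeff m (cDf D (P * Q)) = coeff m (P • cDf D Q + Q • cDf D P)
      rw [coeff_cDf, coeff_mul, map_sum, smul_eq_mul, smul_eq_mul, mul_comm Q, coeff_add, coeff_mul, coeff_mul,
        ← Finset.sum_add_distrib]
      refine Finset.sum_congr rfl fun x _ => ?_
      rw [coeff_cDf, coeff_cDf, Derivation.leibniz, smul_eq_mul, smul_eq_mul]; ring)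

lemma coeff_cD (D : Derivation ℂ R R) (P : MvPolynomial σ R) (m : σ →₀ ℕ) :
    coeff m (cD D P) = D (coeff m P) := coeff_cDf D P m

@[simp] lemma cD_C (D : Derivation ℂ R R) (a : R) : cD D (C a : MvPolynomial σ R) = C (D a) := by
  classical
  ext m
  rw [coeff_cD, coeff_C, coeff_C]
  split_ifs <;> simp

@[simp] lemma cD_X (D : Derivation ℂ R R) (i : σ) : cD D (X i : MvPolynomial σ R) = 0 := by
  classical
  ext m
  rw [coeff_cD, coeff_X']
  split_ifs <;> simp

lemma cD_aeval (D : Derivation ℂ R R) (s : Fin 3 → MvPolynomial σ R) (P : MvPolynomial (Fin 3) R) :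
    cD D (aeval s P) = aeval s (cD D P) + ∑ i, aeval s (pderiv i P) * cD D (s i) := by
  induction P using MvPolynomial.induction_on with
  | C a => simp [algebraMap_eq]
  | add p q hp hq => 
    simp only [map_add, hp, hq, add_mul, Finset.sum_add_distrib]; ring
  | mul_X p g hp =>
    simp only [map_mul, Derivation.leibniz, hp, smul_eq_mul, aeval_X, cD_X, map_add, mul_zero, zero_add, map_zero]
    rw [mul_add]
    have : ∀ i : Fin 3, (aeval s p * aeval s (pderiv i (X g : MvPolynomial (Fin 3) R)) + s g * aeval s (pderiv i p)) * cD D (s i) =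
       aeval s p * (aeval s (pderiv i (X g : MvPolynomial (Fin 3) R)) * cD D (s i)) + s g * (aeval s (pderiv i p) * cD D (s i)) := by intro i; ring
    simp only [this, Finset.sum_add_distrib]
    rw [← Finset.mul_sum, ← Finset.mul_sum]
    have h2 : ∑ i, aeval s (pderiv i (X g : MvPolynomial (Fin 3) R)) * cD D (s i) = cD D (s g) := by
      rw [Finset.sum_eq_single g]
      · simp [pderiv_X_self]
      · intro b _ hb; rw [pderiv_X_of_ne hb.symm]; simp
      · simp
    rw [h2]; ring
end cD

/-- coefficientwise partial derivative of polynomials over `A d` -/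
def pd (i : Sg d) (B : Polynomial (A d)) : Polynomial (A d) :=
  B.sum fun j a => Polynomial.monomial j (pderiv i a)

lemma pd_add (i : Sg d) (B B' : Polynomial (A d)) : pd i (B + B') = pd i B + pd i B' := by
  rw [pd, Polynomial.sum_add_index]
  · rfl
  · simp
  · simp
lemma pd_mon (i : Sg d) (j : ℕ) (a : A d) : pd i (Polynomial.monomial j a) = Polynomial.monomial j (pderiv i a) := by
  rw [pd, Polynomial.sum_monomial_index]; simp

section chain
variable {R : Type*} [CommRing R] [Algebra ℂ R]

abbrev evp (f : Sg d → R) (c : R) (B : Polynomial (A d)) : R :=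
  B.eval₂ (aeval f : A d →ₐ[ℂ] R).toRingHom c

lemma chainA (D : Derivation ℂ R R) (f : Sg d → R) (a : A d) :
    D (aeval f a) = ∑ i, aeval f (pderiv i a) * D (f i) := by
  classical
  induction a using MvPolynomial.induction_on with
  | C a => simp [algebraMap_eq]
  | add p q hp hq => 
    simp only [map_add, hp, hq, add_mul, Finset.sum_add_distrib]
  | mul_X p g hp =>
    simp only [map_mul, Derivation.leibniz, hp, smul_eq_mul, aeval_X, map_add]
    have : ∀ i : Sg d, (aeval f p * aeval f (pderiv i (X g : A d)) + f g * aeval f (pderiv i p)) * D (f i) =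
       aeval f p * (aeval f (pderiv i (X g : A d)) * D (f i)) + f g * (aeval f (pderiv i p) * D (f i)) := by intro i; ring
    simp only [this, Finset.sum_add_distrib]
    rw [← Finset.mul_sum, ← Finset.mul_sum]
    have h2 : ∑ i, aeval f (pderiv i (X g : A d)) * D (f i) = D (f g) := by
      rw [Finset.sum_eq_single g]
      · simp [pderiv_X_self]
      · intro b _ hb; rw [pderiv_X_of_ne hb.symm]; simp
      · simp
    rw [h2]

lemma chainP (D : Derivation ℂ R R) (f : Sg d → R) (c : R) (B : Polynomial (A d)) :
    D (evp f c B) = ∑ i, evp f c (pd i B) * D (f i) + evp f c B.derivative * D c := by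
  induction B using Polynomial.induction_on' with
  | add p q hp hq =>
    simp only [evp, Polynomial.eval₂_add, map_add, pd_add, Polynomial.derivative_add, add_mul, Finset.sum_add_distrib] at *
    rw [hp, hq]; ring
  | monomial n a =>
    simp only [evp, pd_mon, Polynomial.eval₂_monomial, Polynomial.derivative_monomial]
    have : (aeval f : A d →ₐ[ℂ] R).toRingHom = ((aeval f : A d →ₐ[ℂ] R) : A d →+* R) := rfl
    simp only [this, RingHom.coe_coe]
    rw [Derivation.leibniz, chainA, smul_eq_mul, smul_eq_mul, Derivation.leibniz_pow, Finset.mul_sum, smul_eq_mul, map_mul, map_natCast, nsmul_eq_mul, add_comm]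
    congr 1
    · refine Finset.sum_congr rfl fun i _ => by ring
    · ring
end chain
end FB

end

end part13

section part14
open MvPolynomial

set_option linter.all false
noncomputable section
namespace FB
variable {d : ℕ}

/-- monomials as polynomials, forms with coefficient vector -/
def mkF {R : Type*} [CommRing R] (a : E d → R) : MvPolynomial (Fin 3) R := fev (fun e => C (a e)) X

lemma mkF_eval {R : Type*} [CommRing R] (a : E d → R) (v : Fin 3 → R) : eval v (mkF a) = fev a v := by
  rw [mkF, map_fev]; simp

lemma mkF_aeval {R S : Type*} [CommRing R] [CommRing S] [Algebra R S] (a : E d → R) (v : Fin 3 → S) :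
    aeval v (mkF a) = fev (fun e => algebraMap R S (a e)) v := by
  rw [mkF, map_fev]; simp

lemma mkF_term {R : Type*} [CommRing R] (a : E d → R) : mkF a = ∑ e : E d, monomial e.1 (a e) := by
  rw [mkF, fev]
  refine Finset.sum_congr rfl fun e _ => ?_
  rw [monomial_eq, Finsupp.prod_fintype _ _ (by simp)]

lemma coeff_mkF {R : Type*} [CommRing R] (a : E d → R) (e : E d) : coeff e.1 (mkF a) = a e := by
  classical
  rw [mkF_term, coeff_sum, Finset.sum_eq_single e]
  · simp
  · intro b _ hb
    rw [coeff_monomial, if_neg]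
    intro h; exact hb (Subtype.ext h)
  · simp

lemma mkF_hom {R : Type*} [CommRing R] (a : E d → R) : (mkF a).IsHomogeneous d := by
  rw [mkF_term]
  apply IsHomogeneous.sum
  intro e _
  apply isHomogeneous_monomial
  rw [Finsupp.degree_eq_sum]
  exact E_sum e

lemma mkF_coeff {R : Type*} [CommRing R] (P : MvPolynomial (Fin 3) R) (h : P.IsHomogeneous d) :
    mkF (fun e : E d => coeff e.1 P) = P := by
  classical
  ext m
  by_cases hm : m ∈ Finset.finsuppAntidiag (Finset.univ : Finset (Fin 3)) d
  · exact coeff_mkF (fun e : E d => coeff e.1 P) ⟨m, hm⟩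
  · have : Finsupp.degree m ≠ d := by
      rw [Finsupp.degree_eq_sum]
      intro h
      apply hm
      rw [Finset.mem_finsuppAntidiag]
      exact ⟨h, by simp⟩
    rw [h.coeff_eq_zero this, (mkF_hom _).coeff_eq_zero this]

lemma cD_fev (D : Derivation ℂ (Om d) (Om d)) (a : E d → Om d) :
    cD D (mkF a) = mkF (fun e => D (a e)) := by
  rw [mkF_term, mkF_term, map_sum]
  refine Finset.sum_congr rfl fun e _ => ?_
  ext m
  rw [coeff_cD, coeff_monomial, coeff_monomial]
  split_ifs <;> simp

def oH (d : ℕ) : MvPolynomial (Fin 3) (Om d) := mkF oF + C (og (gc 1)) * mkF oG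
def orr (d n : ℕ) : MvPolynomial (Fin 3) (Om d) := bev n (fun i => C (oR i)) (X 0) (X 2)

lemma oB_eq (m0 m1 n : ℕ) : (oB m0 m1 n : MvPolynomial (Fin 3) (Om d)) =
    aeval (osub d) (oH d) - oell 0 ^ m0 * oell 1 ^ m1 * orr d n := by
  rw [oB, oH, map_add, map_mul, mkF_aeval, mkF_aeval, orr]
  simp [algebraMap_eq]

lemma cD_oH (D : Derivation ℂ (Om d) (Om d)) : cD D (oH d) = mkF (fun e => D (oF e)) +
    (C (og (gc 1)) * mkF (fun e => D (oG e)) + C (D (og (gc 1))) * mkF oG) := by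
  rw [oH, map_add, Derivation.leibniz, cD_fev, cD_fev, cD_C, smul_eq_mul, smul_eq_mul]; ring

lemma cD_oell (D : Derivation ℂ (Om d) (Om d)) (s) : cD D (oell s) =
    C (D (og (gp s 2))) * X 0 - C (D (og (gp s 0))) * X 2 := by
  rw [oell, map_sub, Derivation.leibniz, Derivation.leibniz, cD_C, cD_C, cD_X, cD_X]
  simp only [smul_eq_mul]; ring

lemma cD_orr (D : Derivation ℂ (Om d) (Om d)) (n) : cD D (orr d n) =
    bev n (fun i => C (D (oR i))) (X 0) (X 2) := by
  rw [orr, bev, bev, map_sum]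
  refine Finset.sum_congr rfl fun i _ => ?_
  simp only [Derivation.leibniz, Derivation.leibniz_pow, cD_C, cD_X, smul_eq_mul, smul_zero, mul_zero, zero_add]
  ring

lemma cD_oB (D : Derivation ℂ (Om d) (Om d)) (n) : cD D (oB 3 2 n : MvPolynomial (Fin 3) (Om d)) =
    aeval (osub d) (cD D (oH d)) - aeval (osub d) (pderiv 1 (oH d)) *
      (C (D (og (gu 0))) * X 0 + C (D (og (gu 2))) * X 2)
     - (3 * oell 0 ^ 2 * oell 1 ^ 2 * orr d n * cD D (oell 0) + 2 * oell 0 ^ 3 * oell 1 * orr d n * cD D (oell 1)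
       + oell 0 ^ 3 * oell 1 ^ 2 * cD D (orr d n)) := by
  rw [oB_eq, map_sub, cD_aeval, Fin.sum_univ_three]
  have h0 : cD D (osub d 0) = 0 := by simp [osub]
  have h2 : cD D (osub d 2) = 0 := by simp [osub]
  have h1 : cD D (osub d 1) = - (C (D (og (gu 0))) * X 0 + C (D (og (gu 2))) * X 2) := by
    show cD D (- (C (og (gu 0)) * X 0 + C (og (gu 2)) * X 2)) = _
    rw [map_neg, map_add, Derivation.leibniz, Derivation.leibniz, cD_C, cD_C, cD_X, cD_X]
    simp only [smul_eq_mul]; ring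
  rw [h0, h1, h2]
  simp only [Derivation.leibniz, Derivation.leibniz_pow, smul_eq_mul, nsmul_eq_mul]
  push_cast
  ring

section tangent
variable (n : ℕ) (B : Polynomial (A d))

def Lam (e : E d) : Om d := evp (ophi 3 2 n) (og (gc 1)) (pd (Sum.inl e) B)

def LL : MvPolynomial (Fin 3) (Om d) →ₗ[Om d] Om d where
  toFun P := ∑ e : E d, Lam n B e * coeff e.1 P
  map_add' P Q := by simp [mul_add, Finset.sum_add_distrib]
  map_smul' c P := by
    simp only [coeff_smul, smul_eq_mul, Finset.mul_sum, RingHom.id_apply]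
    exact Finset.sum_congr rfl fun e _ => by ring

lemma LL_mkF (a : E d → Om d) : LL n B (mkF a) = ∑ e, Lam n B e * a e := by
  simp [LL, coeff_mkF]

variable (hB : evp (ophi 3 2 n) (og (gc 1)) B = 0)
include hB

lemma tangent (D : Derivation ℂ (Om d) (Om d)) :
    ∑ e, Lam n B e * D (oF e) + ∑ e : E d, evp (ophi 3 2 n) (og (gc 1)) (pd (Sum.inr e) B) * D (oG e)
    + evp (ophi 3 2 n) (og (gc 1)) B.derivative * D (og (gc 1)) = LL n B (cD D (oB 3 2 n)) := by
  have h := chainP D (ophi 3 2 n) (og (gc 1)) B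
  rw [hB, map_zero, Fintype.sum_sum_type] at h
  have h1 : ∀ e : E d, ophi 3 2 n (Sum.inl e) = oF e - coeff e.1 (oB 3 2 n) := fun _ => rfl
  have h2 : ∀ e : E d, ophi 3 2 n (Sum.inr e) = (oG e : Om d) := fun _ => rfl
  have h3 : LL n B (cD D (oB 3 2 n)) = ∑ e : E d, Lam n B e * D (coeff e.1 (oB 3 2 n)) := by
    show ∑ e : E d, Lam n B e * coeff e.1 (cD D (oB 3 2 n)) = _
    simp only [coeff_cD]
  rw [h3]
  simp only [h1, h2, map_sub, mul_sub, Finset.sum_sub_distrib] at h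
  have h4 : ∀ x y z w : Om d, 0 = x - y + z + w → x + z + w = y := fun x y z w h => by linear_combination -h
  exact h4 _ _ _ _ h

lemma tF (e : E d) : Lam n B e = LL n B (aeval (osub d) (monomial e.1 (1 : Om d))) := by
  classical
  have h := tangent n B hB (pderiv (Sum.inl (Sum.inl e)))
  have hF : ∀ e' : E d, pderiv (Sum.inl (Sum.inl e)) (oF e') = if e' = e then (1 : Om d) else 0 := by
    intro e'
    rw [oF, pderiv_X]
    by_cases h : e' = e
    · subst h; simp
    · simp [h, Pi.single_apply, Ne.symm h, eq_comm]
  have hG : ∀ e' : E d, pderiv (Sum.inl (Sum.inl e)) (oG e') = (0 : Om d) := by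
    intro e'; rw [oG, pderiv_X_of_ne]; simp
  have hg : ∀ g, pderiv (Sum.inl (Sum.inl e)) (og g) = (0 : Om d) := by
    intro e'; rw [og, pderiv_X_of_ne]; simp
  have hR : ∀ g, pderiv (Sum.inl (Sum.inl e)) (oR g) = (0 : Om d) := by
    intro e'; rw [oR, pderiv_X_of_ne]; simp
  have e1 : mkF (fun e : E d => (0 : Om d)) = 0 := by rw [mkF_term]; simp
  have e2 : bev n (fun i => (0 : MvPolynomial (Fin 3) (Om d))) (X 0) (X 2) = 0 := by
    simp [bev]
  have e3 : mkF (fun e' : E d => if e' = e then (1 : Om d) else 0) = monomial e.1 1 := by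
    rw [mkF_term, Finset.sum_eq_single e]
    · simp
    · intro b _ hb; simp [hb]
    · simp
  have hX : cD (pderiv (Sum.inl (Sum.inl e))) (oB 3 2 n : MvPolynomial (Fin 3) (Om d)) =
      aeval (osub d) (monomial e.1 (1 : Om d)) := by
    rw [cD_oB, cD_oH, cD_oell, cD_oell, cD_orr]
    simp only [hF, hG, hg, hR, e1, e2, e3, map_zero, zero_mul, mul_zero, add_zero, sub_zero]
  rw [hX] at h
  rw [← h]
  simp only [hF, hG, hg, mul_zero, Finset.sum_const_zero, add_zero, mul_ite, mul_one]
  rw [Finset.sum_ite_eq']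
  simp

lemma tR (i : ℕ) (hi : i ∈ Finset.range (n+1)) : LL n B (oell 0 ^ 3 * oell 1 ^ 2 * (X 0 ^ i * X 2 ^ (n - i))) = 0 := by
  classical
  have h := tangent n B hB (pderiv (Sum.inr (Sum.inr i)))
  have hF : ∀ e' : E d, pderiv (Sum.inr (Sum.inr i)) (oF e') = (0 : Om d) := by
    intro e'; rw [oF, pderiv_X_of_ne]; simp
  have hG : ∀ e' : E d, pderiv (Sum.inr (Sum.inr i)) (oG e') = (0 : Om d) := by
    intro e'; rw [oG, pderiv_X_of_ne]; simp
  have hg : ∀ g, pderiv (Sum.inr (Sum.inr i)) (og g) = (0 : Om d) := by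
    intro e'; rw [og, pderiv_X_of_ne]; simp
  have hR : ∀ j, pderiv (Sum.inr (Sum.inr i)) (oR j) = if j = i then (1 : Om d) else 0 := by
    intro e'
    rw [oR, pderiv_X]
    by_cases h : e' = i
    · subst h; simp
    · simp [h, Pi.single_apply, Ne.symm h, eq_comm]
  rw [cD_oB, cD_oH, cD_oell, cD_oell, cD_orr] at h
  have e1 : mkF (fun e : E d => (0 : Om d)) = 0 := by rw [mkF_term]; simp
  have e2 : bev n (fun i_1 => C (if i_1 = i then (1 : Om d) else 0)) (X 0) (X 2 : MvPolynomial (Fin 3) (Om d)) = X 0 ^ i * X 2 ^ (n - i) := by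
    rw [bev, Finset.sum_eq_single i]
    · simp
    · intro b _ hb; simp [hb]
    · intro h; exact absurd hi h
  simp only [hF, hG, hg, hR, map_zero, zero_mul, mul_zero, Finset.sum_const_zero, add_zero, sub_zero, e1, e2, zero_sub, map_neg, zero_add] at h
  rw [eq_comm, neg_eq_zero] at h
  exact h

lemma tg (D : Derivation ℂ (Om d) (Om d)) (hF : ∀ e, D (oF e) = 0) (hG : ∀ e, D (oG e) = 0)
    (hg : D (og (gc 1)) = 0) (hR : ∀ i, D (oR i) = 0) : LL n B (aeval (osub d) (pderiv 1 (oH d)) *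
      (C (D (og (gu 0))) * X 0 + C (D (og (gu 2))) * X 2)
     + (3 * oell 0 ^ 2 * oell 1 ^ 2 * orr d n * (C (D (og (gp 0 2))) * X 0 - C (D (og (gp 0 0))) * X 2)
       + 2 * oell 0 ^ 3 * oell 1 * orr d n * (C (D (og (gp 1 2))) * X 0 - C (D (og (gp 1 0))) * X 2))) = 0 := by
  have h := tangent n B hB D
  have e1 : mkF (fun e : E d => (0 : Om d)) = 0 := by rw [mkF_term]; simp
  have e2 : bev n (fun i => (0 : MvPolynomial (Fin 3) (Om d))) (X 0) (X 2) = 0 := by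
    simp [bev]
  simp only [hF, hG, hg, mul_zero, Finset.sum_const_zero, add_zero] at h
  rw [← neg_eq_zero, ← map_neg]
  refine Eq.trans (congrArg (LL n B) ?_) h.symm
  rw [cD_oB, cD_oH, cD_oell, cD_oell, cD_orr]
  simp only [hF, hG, hg, hR, e1, e2, mul_zero, map_zero, zero_mul, add_zero]
  ring

lemma tc : LL n B (aeval (osub d) (mkF oG : MvPolynomial (Fin 3) (Om d))) = evp (ophi 3 2 n) (og (gc 1)) B.derivative := by
  classical
  have h := tangent n B hB (pderiv (Sum.inr (Sum.inl (gc 1))))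
  have hF : ∀ e' : E d, pderiv (Sum.inr (Sum.inl (gc 1))) (oF e') = (0 : Om d) := by
    intro e'; rw [oF, pderiv_X_of_ne]; simp
  have hG : ∀ e' : E d, pderiv (Sum.inr (Sum.inl (gc 1))) (oG e') = (0 : Om d) := by
    intro e'; rw [oG, pderiv_X_of_ne]; simp
  have hg : ∀ g, g ≠ gc 1 → pderiv (Sum.inr (Sum.inl (gc 1))) (og g) = (0 : Om d) := by
    intro g hc; rw [og, pderiv_X_of_ne]; simpa using hc
  have hg' : pderiv (Sum.inr (Sum.inl (gc 1))) (og (gc 1)) = (1 : Om d) := by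
    rw [og, pderiv_X_self]
  have hR : ∀ g', pderiv (Sum.inr (Sum.inl (gc 1))) (oR g') = (0 : Om d) := by
    intro e'; rw [oR, pderiv_X_of_ne]; simp
  have e1 : mkF (fun e : E d => (0 : Om d)) = 0 := by rw [mkF_term]; simp
  have e2 : bev n (fun i => (0 : MvPolynomial (Fin 3) (Om d))) (X 0) (X 2) = 0 := by
    simp [bev]
  simp only [hF, hG, hg', mul_zero, Finset.sum_const_zero, zero_add, mul_one] at h
  refine Eq.trans (congrArg (LL n B) ?_) h.symm
  rw [cD_oB, cD_oH, cD_oell, cD_oell, cD_orr]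
  rw [hg', hg (gu 0) (by decide), hg (gu 2) (by decide), hg (gp 0 0) (by decide), hg (gp 0 2) (by decide), hg (gp 1 0) (by decide), hg (gp 1 2) (by decide)]
  simp only [hF, hG, hR, e1, e2, mul_zero, map_zero, zero_mul, add_zero, zero_add, sub_zero, map_one, one_mul]
end tangent
end FB

end

end part14

section part15
open MvPolynomial

set_option linter.all false
noncomputable section
namespace FB
variable {d : ℕ}

section lp
variable {R : Type*} [CommRing R]

def lp (v w : Fin 3 → R) (P : MvPolynomial (Fin 3) R) : Polynomial R :=
  aeval (fun i => Polynomial.C (v i) + Polynomial.X * Polynomial.C (w i)) P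

lemma lp_add (v w : Fin 3 → R) (P Q) : lp v w (P + Q) = lp v w P + lp v w Q := map_add _ _ _
lemma lp_mul (v w : Fin 3 → R) (P Q) : lp v w (P * Q) = lp v w P * lp v w Q := map_mul _ _ _
lemma lp_sub (v w : Fin 3 → R) (P Q) : lp v w (P - Q) = lp v w P - lp v w Q := map_sub _ _ _
lemma lp_pow (v w : Fin 3 → R) (P) (k : ℕ) : lp v w (P ^ k) = lp v w P ^ k := map_pow _ _ _
@[simp] lemma lp_C (v w : Fin 3 → R) (a : R) : lp v w (C a) = Polynomial.C a := by
  simp [lp]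
@[simp] lemma lp_X (v w : Fin 3 → R) (i) : lp v w (X i) = Polynomial.C (v i) + Polynomial.X * Polynomial.C (w i) := by
  simp [lp]

lemma lp_coeff0 (v w : Fin 3 → R) (P) : (lp v w P).coeff 0 = eval v P := by
  induction P using MvPolynomial.induction_on with
  | C a => simp
  | add p q hp hq => rw [lp_add, Polynomial.coeff_add, hp, hq, map_add]
  | mul_X p i hp => rw [lp_mul, Polynomial.mul_coeff_zero, hp, map_mul, lp_X]; simp

lemma lp_map {S : Type*} [CommRing S] (f : R →+* S) (v w : Fin 3 → R) (P) :
    (lp v w P).map f = lp (fun i => f (v i)) (fun i => f (w i)) (map f P) := by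
  induction P using MvPolynomial.induction_on with
  | C a => simp
  | add p q hp hq => rw [lp_add, map_add, lp_add, Polynomial.map_add, hp, hq]
  | mul_X p i hp => rw [lp_mul, Polynomial.map_mul, map_mul, lp_mul, hp, map_X, lp_X, lp_X]; simp

def der (v w : Fin 3 → R) (P : MvPolynomial (Fin 3) R) : R := (lp v w P).coeff 1

lemma der_mul (v w : Fin 3 → R) (P Q) : der v w (P * Q) = eval v P * der v w Q + der v w P * eval v Q := by
  rw [der, lp_mul, Polynomial.mul_coeff_one, lp_coeff0, lp_coeff0]; rfl
lemma der_add (v w : Fin 3 → R) (P Q) : der v w (P + Q) = der v w P + der v w Q := by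
  rw [der, lp_add, Polynomial.coeff_add]; rfl
@[simp] lemma der_C (v w : Fin 3 → R) (a) : der v w (C a) = 0 := by
  rw [der, lp_C, Polynomial.coeff_C]; simp
@[simp] lemma der_X (v w : Fin 3 → R) (i) : der v w (X i) = w i := by
  rw [der, lp_X]; simp [Polynomial.coeff_C]
lemma der_map {S : Type*} [CommRing S] (f : R →+* S) (v w : Fin 3 → R) (P) :
    der (fun i => f (v i)) (fun i => f (w i)) (map f P) = f (der v w P) := by
  rw [der, ← lp_map, Polynomial.coeff_map]; rfl

def lf (p : Fin 3 → R) : MvPolynomial (Fin 3) R := C (p 2) * X 0 - C (p 0) * X 2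
def Rp (n : ℕ) (r : ℕ → R) : MvPolynomial (Fin 3) R := bev n (fun i => C (r i)) (X 0) (X 2)

@[simp] lemma eval_lf (p v : Fin 3 → R) : eval v (lf p) = ell p v := by
  simp [lf, ell]
@[simp] lemma eval_Rp (n) (r : ℕ → R) (v : Fin 3 → R) : eval v (Rp n r) = bev n r (v 0) (v 2) := by
  rw [Rp, map_bev]; simp
lemma ell_self (p : Fin 3 → R) : ell p p = 0 := by simp [ell, mul_comm]
lemma der_lf (p v w : Fin 3 → R) : der v w (lf p) = ell p w := by
  have : lf p = C (p 2) * X 0 + C (- p 0) * X 2 := by rw [lf, map_neg]; ring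
  rw [this, der_add, der_mul, der_mul, der_C, der_C]; simp [ell]; ring

def sb (a b : R) : Fin 3 → MvPolynomial (Fin 3) R := ![X 0, - (C a * X 0 + C b * X 2), X 2]

lemma eval_sb (a b : R) (P) (v : Fin 3 → R) : eval v (aeval (sb a b) P) = eval ![v 0, -(a * v 0 + b * v 2), v 2] P := by
  rw [← coe_aeval_eq_eval, ← coe_aeval_eq_eval]
  show aeval v (aeval (sb a b) P) = aeval _ P
  rw [← AlgHom.comp_apply, comp_aeval]
  congr 2
  ext i
  fin_cases i <;> simp [sb]

lemma lp_sb (a b : R) (P) (v w : Fin 3 → R) (hv : v 1 = -(a * v 0 + b * v 2)) (hw : w 1 = -(a * w 0 + b * w 2)) :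
    lp v w (aeval (sb a b) P) = lp v w P := by
  rw [lp, lp, ← AlgHom.comp_apply, comp_aeval]
  congr 2
  funext i
  fin_cases i
  · simp [sb]
  · simp [sb, hv, hw]; ring
  · simp [sb]
end lp

section ker
variable {K : Type*} [Field K] [Infinite K]

lemma Rp_div (n : ℕ) (r : ℕ → K) (p : Fin 3 → K) (h2 : p 2 ≠ 0) (h : bev (n + 1) r (p 0) (p 2) = 0) :
    ∃ r', Rp (n+1) r = lf p * Rp n r' := by
  obtain ⟨r', h⟩ := bev_div n r (p 0) (p 2) h2 h
  refine ⟨r', MvPolynomial.funext fun v => ?_⟩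
  rw [map_mul, eval_Rp, eval_Rp, eval_lf, h, ell]

lemma sb_Rp (a b : K) (P : MvPolynomial (Fin 3) K) (hP : P.IsHomogeneous d) : ∃ r, aeval (sb a b) P = Rp d r := by
  obtain ⟨r, hr⟩ := restrict_bev (d := d) (fun e => coeff e.1 P) (![a, 1, b] : Fin 3 → K) (by simp)
  refine ⟨r, MvPolynomial.funext fun v => ?_⟩
  rw [eval_sb, eval_Rp, ← fev_coeff P hP, hr]
  · simp
  · simp [dt]

lemma hom_lf_mul (a b : K) : (lf ![a, 0, b]).IsHomogeneous 1 :=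
  (isHomogeneous_C_mul_X _ _).sub (isHomogeneous_C_mul_X _ _)

lemma ker_lemma (n : ℕ) (L : MvPolynomial (Fin 3) K →ₗ[K] K) (a b : K) (p q : Fin 3 → K) (r : ℕ → K)
    (hp1 : p 1 = -(a * p 0 + b * p 2)) (hq1 : q 1 = -(a * q 0 + b * q 2)) (hp2 : p 2 ≠ 0) (hq2 : q 2 ≠ 0)
    (hpq : ell p q ≠ 0) (hrp : bev n r (p 0) (p 2) ≠ 0) (hrq : bev n r (q 0) (q 2) ≠ 0)
    (hsub : ∀ P : MvPolynomial (Fin 3) K, P.IsHomogeneous (n+5) → L P = L (aeval (sb a b) P))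
    (hR : ∀ r', L (lf p ^ 3 * lf q ^ 2 * Rp n r') = 0)
    (hp : L (lf p ^ 2 * lf q ^ 2 * Rp n r * lf q) = 0)
    (hq : L (lf p ^ 3 * lf q * Rp n r * lf p) = 0)
    (P : MvPolynomial (Fin 3) K) (hP : P.IsHomogeneous (n+5)) (h0 : eval p P = 0) (h1 : der p q P = 0) (h2 : eval q P = 0) :
    L P = 0 := by
  have hqp : ell q p ≠ 0 := by
    have : ell q p = - ell p q := by simp only [ell]; ring
    rw [this]; exact neg_ne_zero.2 hpq
  rw [hsub P hP]
  obtain ⟨r0, e0⟩ := sb_Rp a b P hP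
  have l0 := lp_sb a b P p q hp1 hq1
  have l0' := lp_sb a b P q p hq1 hp1
  rw [e0] at l0 l0' ⊢
  rw [← lp_coeff0 p q, ← l0, lp_coeff0, eval_Rp] at h0
  rw [← lp_coeff0 q p, ← l0', lp_coeff0, eval_Rp] at h2
  rw [der, ← l0] at h1
  obtain ⟨r1, e1⟩ := Rp_div _ r0 p hp2 h0
  have h1' : der p q (Rp (n+5) r0) = 0 := h1
  rw [e1, der_mul, eval_lf, ell_self, zero_mul, zero_add, der_lf, eval_Rp] at h1'
  obtain ⟨r2, e2⟩ := Rp_div _ r1 p hp2 ((mul_eq_zero.1 h1').resolve_left hpq)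
  have h2' : eval q (Rp (n+5) r0) = 0 := by rw [eval_Rp]; exact h2
  rw [e1, e2, map_mul, map_mul, eval_lf, eval_Rp] at h2'
  obtain ⟨r3, e3⟩ := Rp_div _ r2 q hq2 (((mul_eq_zero.1 ((mul_eq_zero.1 h2').resolve_left hpq)).resolve_left hpq))
  set α := bev (n+2) r3 (p 0) (p 2) / (ell q p ^ 2 * bev n r (p 0) (p 2)) with hα
  set β := bev (n+2) r3 (q 0) (q 2) / (ell p q ^ 2 * bev n r (q 0) (q 2)) with hβ
  have hS : ∃ r4, Rp (n+2) r4 = Rp (n+2) r3 - C α * (lf q ^ 2 * Rp n r) - C β * (lf p ^ 2 * Rp n r) := by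
    have hlf : ∀ p : Fin 3 → K, (lf p).IsHomogeneous 1 := fun p => (isHomogeneous_C_mul_X _ _).sub (isHomogeneous_C_mul_X _ _)
    have hRp : ∀ (m) (r : ℕ → K), (Rp m r).IsHomogeneous m := fun m r => hom_bev m r 0 2
    have hh : ∀ (p : Fin 3 → K) (t : K), (C t * (lf p ^ 2 * Rp n r)).IsHomogeneous (n+2) := by
      intro p t
      have := (isHomogeneous_C (Fin 3) t).mul (((hlf p).pow 2).mul (hRp n r))
      rwa [show 0 + (1 * 2 + n) = n + 2 by ring] at this
    obtain ⟨r4, h4⟩ := sb_Rp 0 0 _ (((hRp (n+2) r3).sub (hh q α)).sub (hh p β))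
    refine ⟨r4, ?_⟩
    rw [← h4]
    apply MvPolynomial.funext
    intro v
    rw [eval_sb]
    simp [ell]
  obtain ⟨r4, h4⟩ := hS
  have hp4 := congrArg (eval p) h4
  have hq4 := congrArg (eval q) h4
  simp only [map_sub, map_mul, map_pow, eval_C, eval_lf, eval_Rp, ell_self] at hp4 hq4
  have hp5 : bev (n+2) r4 (p 0) (p 2) = 0 := by
    rw [hp4, hα]; field_simp; ring
  have hq5 : bev (n+2) r4 (q 0) (q 2) = 0 := by
    rw [hq4, hβ]; field_simp; ring
  obtain ⟨r5, e5⟩ := Rp_div _ r4 p hp2 hp5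
  have hq6 : eval q (Rp (n+2) r4) = 0 := by rw [eval_Rp]; exact hq5
  rw [e5, map_mul, eval_lf, eval_Rp] at hq6
  obtain ⟨r6, e6⟩ := Rp_div _ r5 q hq2 ((mul_eq_zero.1 hq6).resolve_left hpq)
  have hfin : Rp (n+5) r0 = lf p ^ 3 * lf q ^ 2 * Rp n r6 + α • (lf p ^ 2 * lf q ^ 2 * Rp n r * lf q) +
     β • (lf p ^ 3 * lf q * Rp n r * lf p) := by
    rw [e1, e2, e3, smul_eq_C_mul, smul_eq_C_mul]
    have : Rp (n+2) r3 = lf p * (lf q * Rp n r6) + C α * (lf q ^ 2 * Rp n r) + C β * (lf p ^ 2 * Rp n r) := by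
      rw [← e6, ← e5, h4]; ring
    rw [this]; ring
  rw [hfin, map_add, map_add, map_smul, map_smul, hR, hp, hq]; simp
end ker
end FB

end

end part15

section part16
open MvPolynomial

set_option linter.all false
noncomputable section
namespace FB
variable {d : ℕ}

def pn (d : ℕ) (s : Fin 2) : Fin 3 → KK d := fun i => yn (gy d Set.univ) (gp s i)
def po (d : ℕ) (s : Fin 2) : Fin 3 → KK d := fun i => gy d Set.univ (gp s i)

lemma po_ne (s i) : po d s i ≠ 0 := gy_ne _ _

lemma pn_eq (s i) : pn d s i = po d s i / po d s 0 := by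
  fin_cases s <;> rfl

lemma pn0 (s) : pn d s 0 = 1 := by rw [pn_eq, div_self (po_ne _ _)]
lemma pn_ne (s i) : pn d s i ≠ 0 := by rw [pn_eq]; exact div_ne_zero (po_ne _ _) (po_ne _ _)

lemma po_0 (s) : po d s 0 = ii d (og (gp s 0)) := by
  show ii d (oy d Set.univ (gp s 0)) = _; simp [oy]
lemma po_2 (s) : po d s 2 = ii d (og (gp s 2)) := by
  show ii d (oy d Set.univ (gp s 2)) = _; simp [oy]
lemma po_1 (s) : po d s 1 = -(ii d (og (gu 0)) * po d s 0 + ii d (og (gu 2)) * po d s 2) := by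
  rw [po_0, po_2]
  show ii d (oy d Set.univ (gp s 1)) = _; simp [oy]

lemma pn_1 (s) : pn d s 1 = -(ii d (og (gu 0)) * pn d s 0 + ii d (og (gu 2)) * pn d s 2) := by
  rw [pn_eq, po_1, pn_eq, pn_eq]; ring



lemma lf_pn (s) : lf (pn d s) = C (po d s 0)⁻¹ * map (ii d : Om d →+* KK d) (oell s) := by
  rw [lf, oell, pn_eq, pn_eq, div_eq_inv_mul, div_eq_inv_mul]
  simp only [map_sub, map_mul, map_C, map_X, RingHom.coe_coe, ← po_0, ← po_2]
  ring

lemma ell_pn : ell (pn d 0) (pn d 1) ≠ 0 := by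
  intro h
  have h1 : po d 0 2 * po d 1 0 - po d 0 0 * po d 1 2 = 0 := by
    simp only [ell, pn_eq] at h
    have h0 := po_ne (d := d) 0 0
    have h1 := po_ne (d := d) 1 0
    field_simp at h
    linear_combination h
  rw [po_0, po_0, po_2, po_2, ← map_mul, ← map_mul, ← map_sub] at h1
  have h2 : (og (gp 0 2) * og (gp 1 0) - og (gp 0 0) * og (gp 1 2) : Om d) = 0 := ii_inj (by rw [h1, map_zero])
  classical
  have := congrArg (aeval (fun i => if i = Sum.inr (Sum.inl (gp 0 2)) ∨ i = Sum.inr (Sum.inl (gp 1 0)) then (1:ℂ) else 0)) h2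
  simp [og, gp] at this

def HK (d : ℕ) : MvPolynomial (Fin 3) (KK d) := map (ii d : Om d →+* KK d) (oH d)

lemma HK_hom : (HK d).IsHomogeneous d := by
  apply IsHomogeneous.map
  rw [oH]
  refine (mkF_hom _).add ?_
  have := (isHomogeneous_C (Fin 3) (og (gc 1) : Om d)).mul (mkF_hom (d := d) oG)
  rwa [zero_add] at this

lemma tgp (s : Fin 2) (i : Fin 3) (hi : i ≠ 1) : ∃ D : Derivation ℂ (Om d) (Om d), (∀ e, D (oF e) = 0) ∧ (∀ e, D (oG e) = 0) ∧
   (D (og (gc 1)) = 0) ∧ (∀ i, D (oR i) = 0) ∧ (∀ j, D (og (gu j)) = 0) ∧ ∀ s' i', D (og (gp s' i')) = if s' = s ∧ i' = i then 1 else 0 := by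
  refine ⟨pderiv (Sum.inr (Sum.inl (gp s i))), ?_, ?_, ?_, ?_, ?_, ?_⟩
  · intro e; rw [oF, pderiv_X_of_ne]; simp
  · intro e; rw [oG, pderiv_X_of_ne]; simp
  · rw [og, pderiv_X_of_ne]; simp [gc, gp]
  · intro e; rw [oR, pderiv_X_of_ne]; simp
  · intro e; rw [og, pderiv_X_of_ne]; simp [gu, gp]
  · intro s' i'
    split_ifs with h
    · rw [h.1, h.2, og, pderiv_X_self]
    · rw [og, pderiv_X_of_ne]
      simp only [gp, ne_eq, Sum.inr.injEq, Sum.inl.injEq, Prod.mk.injEq]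
      exact h

lemma tgu (i : Fin 3) (hi : i ≠ 1) : ∃ D : Derivation ℂ (Om d) (Om d), (∀ e, D (oF e) = 0) ∧ (∀ e, D (oG e) = 0) ∧
   (D (og (gc 1)) = 0) ∧ (∀ i, D (oR i) = 0) ∧ (∀ j, D (og (gu j)) = if j = i then 1 else 0) ∧ ∀ s' i', D (og (gp s' i')) = 0 := by
  refine ⟨pderiv (Sum.inr (Sum.inl (gu i))), ?_, ?_, ?_, ?_, ?_, ?_⟩
  · intro e; rw [oF, pderiv_X_of_ne]; simp
  · intro e; rw [oG, pderiv_X_of_ne]; simp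
  · rw [og, pderiv_X_of_ne]; simp [gc, gu]
  · intro e; rw [oR, pderiv_X_of_ne]; simp
  · intro j
    split_ifs with h
    · rw [h, og, pderiv_X_self]
    · rw [og, pderiv_X_of_ne]
      simp only [gu, ne_eq, Sum.inr.injEq, Sum.inl.injEq]
      exact h
  · intro s' i'; rw [og, pderiv_X_of_ne]; simp [gu, gp]

section
variable (n : ℕ) (B : Polynomial (A d))

def LK : MvPolynomial (Fin 3) (KK d) →ₗ[KK d] KK d where
  toFun P := ∑ e : E d, ii d (Lam n B e) * coeff e.1 P
  map_add' P Q := by simp [mul_add, Finset.sum_add_distrib]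
  map_smul' c P := by
    simp only [coeff_smul, smul_eq_mul, Finset.mul_sum, RingHom.id_apply]
    exact Finset.sum_congr rfl fun e _ => by ring

lemma LK_map (P : MvPolynomial (Fin 3) (Om d)) : LK n B (map (ii d : Om d →+* KK d) P) = ii d (LL n B P) := by
  show ∑ e : E d, ii d (Lam n B e) * coeff e.1 (map (ii d : Om d →+* KK d) P) = ii d (∑ e : E d, Lam n B e * coeff e.1 P)
  rw [map_sum]
  refine Finset.sum_congr rfl fun e _ => ?_
  rw [coeff_map, map_mul]; rfl

lemma map_osub (P : MvPolynomial (Fin 3) (Om d)) : map (ii d : Om d →+* KK d) (aeval (osub d) P) =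
    aeval (sb (ii d (og (gu 0))) (ii d (og (gu 2)))) (map (ii d : Om d →+* KK d) P) := by
  induction P using MvPolynomial.induction_on with
  | C a => simp [algebraMap_eq]
  | add p q hp hq => rw [map_add, map_add, map_add, map_add, hp, hq]
  | mul_X p i hp => 
    rw [map_mul, map_mul, map_mul, map_mul, hp, aeval_X, map_X, aeval_X]
    congr 1
    fin_cases i <;> simp [osub, sb]

lemma LK_smul (c : KK d) (P) : LK n B (C c * P) = c * LK n B P := by
  rw [← smul_eq_C_mul, map_smul, smul_eq_mul]

variable (hB : evp (ophi 3 2 n) (og (gc 1)) B = 0)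
include hB

lemma LK_sub (P : MvPolynomial (Fin 3) (KK d)) (hP : P.IsHomogeneous d) :
    LK n B P = LK n B (aeval (sb (ii d (og (gu 0))) (ii d (og (gu 2)))) P) := by
  conv_rhs => rw [← mkF_coeff P hP, mkF_term, map_sum, map_sum]
  show ∑ e : E d, ii d (Lam n B e) * coeff e.1 P = _
  refine Finset.sum_congr rfl fun e _ => ?_
  have h1 : monomial e.1 (coeff e.1 P) = C (coeff e.1 P) * map (ii d : Om d →+* KK d) (monomial e.1 1) := by
    rw [map_monomial, C_mul_monomial]; simp
  rw [h1, map_mul, ← map_osub, aeval_C, algebraMap_eq, LK_smul, LK_map, ← tF n B hB, mul_comm]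

lemma LK_R (r : ℕ → KK d) : LK n B (lf (pn d 0) ^ 3 * lf (pn d 1) ^ 2 * Rp n r) = 0 := by
  rw [Rp, bev, Finset.mul_sum, map_sum]
  apply Finset.sum_eq_zero
  intro i hi
  have := congrArg (ii d) (tR n B hB i hi)
  rw [← LK_map, map_zero] at this
  have e : lf (pn d 0) ^ 3 * lf (pn d 1) ^ 2 * (C (r i) * X 0 ^ i * X 2 ^ (n - i)) =
    C ((po d 0 0)⁻¹ ^ 3 * (po d 1 0)⁻¹ ^ 2 * r i) * map (ii d : Om d →+* KK d) (oell 0 ^ 3 * oell 1 ^ 2 * (X 0 ^ i * X 2 ^ (n - i))) := by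
    simp only [lf_pn, map_mul, map_pow, map_X]; ring
  rw [e, LK_smul, this, mul_zero]

lemma LL_p0 (i : Fin 3) (hi : i ≠ 1) : LL n B (oell 0 ^ 2 * oell 1 ^ 2 * orr d n * X i) = 0 := by
  obtain ⟨D, h1, h2, h3, h4, h5, h6⟩ := tgp (d := d) 0 (if i = 0 then 2 else 0) (by split_ifs <;> decide)
  have := tg n B hB D h1 h2 h3 h4
  simp only [h5, h6] at this
  fin_cases i
  · simp at this
    have e : (3 * oell 0 ^ 2 * oell 1 ^ 2 * orr d n * X 0 : MvPolynomial (Fin 3) (Om d)) = (3 : Om d) • (oell 0 ^ 2 * oell 1 ^ 2 * orr d n * X 0) := by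
      rw [smul_eq_C_mul, map_ofNat]; ring
    rw [e, map_smul, smul_eq_mul, mul_eq_zero] at this
    exact this.resolve_left (by norm_num)
  · exact absurd rfl hi
  · simp at this
    have e : (3 * oell 0 ^ 2 * oell 1 ^ 2 * orr d n * -X 2 : MvPolynomial (Fin 3) (Om d)) = (-3 : Om d) • (oell 0 ^ 2 * oell 1 ^ 2 * orr d n * X 2) := by
      rw [smul_eq_C_mul, map_neg, map_ofNat]; ring
    rw [e, map_smul, smul_eq_mul, mul_eq_zero] at this
    exact this.resolve_left (by norm_num)

lemma LL_p1 (i : Fin 3) (hi : i ≠ 1) : LL n B (oell 0 ^ 3 * oell 1 * orr d n * X i) = 0 := by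
  obtain ⟨D, h1, h2, h3, h4, h5, h6⟩ := tgp (d := d) 1 (if i = 0 then 2 else 0) (by split_ifs <;> decide)
  have := tg n B hB D h1 h2 h3 h4
  simp only [h5, h6] at this
  fin_cases i
  · simp at this
    have e : (2 * oell 0 ^ 3 * oell 1 * orr d n * X 0 : MvPolynomial (Fin 3) (Om d)) = (2 : Om d) • (oell 0 ^ 3 * oell 1 * orr d n * X 0) := by
      rw [smul_eq_C_mul, map_ofNat]; ring
    rw [e, map_smul, smul_eq_mul, mul_eq_zero] at this
    exact this.resolve_left (by norm_num)
  · exact absurd rfl hi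
  · simp at this
    have e : (2 * oell 0 ^ 3 * oell 1 * orr d n * -X 2 : MvPolynomial (Fin 3) (Om d)) = (-2 : Om d) • (oell 0 ^ 3 * oell 1 * orr d n * X 2) := by
      rw [smul_eq_C_mul, map_neg, map_ofNat]; ring
    rw [e, map_smul, smul_eq_mul, mul_eq_zero] at this
    exact this.resolve_left (by norm_num)

lemma LL_u (i : Fin 3) (hi : i ≠ 1) : LL n B (aeval (osub d) (pderiv 1 (oH d)) * X i) = 0 := by
  obtain ⟨D, h1, h2, h3, h4, h5, h6⟩ := tgu (d := d) i hi
  have := tg n B hB D h1 h2 h3 h4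
  simp only [h5, h6] at this
  fin_cases i
  · simpa using this
  · exact absurd rfl hi
  · simpa using this

lemma LK_p0 : LK n B (lf (pn d 0) ^ 2 * lf (pn d 1) ^ 2 * Rp n (fun i => ii d (oR i)) * lf (pn d 1)) = 0 := by
  have e : lf (pn d 0) ^ 2 * lf (pn d 1) ^ 2 * Rp n (fun i => ii d (oR i)) * lf (pn d 1) =
     C ((po d 0 0)⁻¹ ^ 2 * (po d 1 0)⁻¹ ^ 2) * (C (pn d 1 2) * map (ii d : Om d →+* KK d) (oell 0 ^ 2 * oell 1 ^ 2 * orr d n * X 0)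
       + C (- pn d 1 0) * map (ii d : Om d →+* KK d) (oell 0 ^ 2 * oell 1 ^ 2 * orr d n * X 2)) := by
    conv_lhs => arg 2; rw [lf]
    rw [lf_pn, lf_pn, orr]
    simp only [map_mul, map_pow, map_X, map_bev, map_C, map_neg, Rp, RingHom.coe_coe]; ring
  rw [e, LK_smul, map_add, LK_smul, LK_smul, LK_map, LK_map, LL_p0 n B hB 0 (by decide), LL_p0 n B hB 2 (by decide)]
  simp

lemma LK_p1 : LK n B (lf (pn d 0) ^ 3 * lf (pn d 1) * Rp n (fun i => ii d (oR i)) * lf (pn d 0)) = 0 := by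
  have e : lf (pn d 0) ^ 3 * lf (pn d 1) * Rp n (fun i => ii d (oR i)) * lf (pn d 0) =
     C ((po d 0 0)⁻¹ ^ 3 * (po d 1 0)⁻¹) * (C (pn d 0 2) * map (ii d : Om d →+* KK d) (oell 0 ^ 3 * oell 1 * orr d n * X 0)
       + C (- pn d 0 0) * map (ii d : Om d →+* KK d) (oell 0 ^ 3 * oell 1 * orr d n * X 2)) := by
    conv_lhs => arg 2; rw [lf]
    rw [lf_pn, lf_pn, orr]
    simp only [map_mul, map_pow, map_X, map_bev, map_C, map_neg, Rp, RingHom.coe_coe]; ring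
  rw [e, LK_smul, map_add, LK_smul, LK_smul, LK_map, LK_map, LL_p1 n B hB 0 (by decide), LL_p1 n B hB 2 (by decide)]
  simp

lemma LK_u (hd : 1 ≤ d) (i : Fin 3) (hi : i ≠ 1) : LK n B (pderiv 1 (HK d) * X i) = 0 := by
  have hh : (pderiv 1 (HK d) * X i).IsHomogeneous d := by
    have := (HK_hom (d := d)).pderiv (i := 1) |>.mul (isHomogeneous_X (KK d) i)
    rwa [Nat.sub_add_cancel hd] at this
  rw [LK_sub n B hB _ hh]
  have e : pderiv 1 (HK d) * X i = map (ii d : Om d →+* KK d) (pderiv 1 (oH d) * X i) := by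
    rw [HK, map_mul, map_X, pderiv_map]
  have h3 : osub d i = X i := by
    fin_cases i
    · rfl
    · exact absurd rfl hi
    · rfl
  rw [e, ← map_osub, LK_map, map_mul, aeval_X, h3, LL_u n B hB i hi, map_zero]

lemma LK_G : LK n B (mkF fun e => ii d (oG e)) = ii d (evp (ophi 3 2 n) (og (gc 1)) B.derivative) := by
  have e : (mkF fun e => ii d (oG e)) = map (ii d : Om d →+* KK d) (mkF oG) := by
    rw [mkF, mkF, map_fev]; simp
  rw [LK_sub n B hB _ (mkF_hom _), ← tc n B hB, ← LK_map, map_osub, e]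

end

lemma LK_ker (n : ℕ) (B : Polynomial (A (n+5))) (hB : evp (ophi 3 2 n) (og (gc 1)) B = 0)
    (P : MvPolynomial (Fin 3) (KK (n+5))) (hP : P.IsHomogeneous (n+5)) (h0 : eval (pn (n+5) 0) P = 0)
    (h1 : der (pn (n+5) 0) (pn (n+5) 1) P = 0) (h2 : eval (pn (n+5) 1) P = 0) : LK n B P = 0 := by
  have hr : ∀ s, bev n (fun i => ii (n+5) (oR i)) (pn (n+5) s 0) (pn (n+5) s 2) ≠ 0 := by
    intro s
    have h := gen_r_ne (d := n+5) n s
    rw [pn_eq, pn_eq, div_eq_inv_mul, div_eq_inv_mul, bev_smul]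
    exact mul_ne_zero (pow_ne_zero _ (inv_ne_zero (po_ne _ _))) h
  exact ker_lemma n (LK n B) _ _ (pn (n+5) 0) (pn (n+5) 1) (fun i => ii (n+5) (oR i)) (pn_1 0) (pn_1 1) (pn_ne _ _) (pn_ne _ _)
    ell_pn (hr 0) (hr 1) (LK_sub n B hB) (LK_R n B hB) (LK_p0 n B hB) (LK_p1 n B hB) P hP h0 h1 h2

lemma h_ne (hd : 1 ≤ d) (s : Fin 2) : eval (pn d s) (pderiv 1 (HK d)) ≠ 0 := by
  intro h
  have hh := (HK_hom (d := d)).pderiv (i := 1)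
  have h1 : eval (po d s) (pderiv 1 (HK d)) = 0 := by
    have e : po d s = po d s 0 • pn d s := by
      ext i
      rw [Pi.smul_apply, smul_eq_mul, pn_eq, mul_div_cancel₀ _ (po_ne _ _)]
    rw [e, ← fev_coeff (d := d-1) _ hh]
    have := fev_smul (d := d - 1) (fun e => coeff e.1 (pderiv 1 (HK d))) (po d s 0) (pn d s)
    rw [fev_coeff (d := d-1) _ hh (pn d s), h, mul_zero] at this
    exact this
  have h2 : eval (fun i => oy d Set.univ (gp s i)) (pderiv 1 (oH d)) = 0 := by
    apply ii_inj (d := d)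
    rw [map_zero, ← h1, HK, pderiv_map, eval_map, ← eval₂_id]
    exact hom_eval₂ _ _ (ii d : Om d →+* KK d) _
  let P : MvPolynomial (Fin 3) ℂ := X 0 ^ (d-1) * X 1
  have hP : P.IsHomogeneous d := by
    have := (isHomogeneous_X_pow (R := ℂ) (0 : Fin 3) (d-1)).mul (isHomogeneous_X ℂ (1 : Fin 3))
    rwa [Nat.sub_add_cancel hd] at this
  let w : Sg d ⊕ Gv ⊕ ℕ → ℂ := Sum.elim (Sum.elim (fun e => coeff e.1 P) 0) 1
  let ψ : Om d →ₐ[ℂ] ℂ := aeval w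
  have h3 : map (ψ : Om d →+* ℂ) (oH d) = P := by
    rw [oH, mkF, mkF]
    simp only [map_add, map_mul, map_fev, map_C, map_X]
    have e1 : ∀ e : E d, (ψ : Om d →+* ℂ) (oF e) = coeff e.1 P := by intro e; simp [ψ, oF, w]
    have e2 : ∀ e : E d, (ψ : Om d →+* ℂ) (oG e) = 0 := by intro e; simp [ψ, oG, w]
    simp only [e1, e2]
    have := mkF_coeff P hP
    rw [mkF] at this
    rw [this]
    simp [fev]
  have h4 := congrArg (ψ : Om d →+* ℂ) h2
  rw [map_zero, ← eval₂_id, hom_eval₂] at h4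
  have h5 : eval₂ ((ψ : Om d →+* ℂ).comp (RingHom.id _)) (fun i => (ψ : Om d →+* ℂ) (oy d Set.univ (gp s i))) (pderiv 1 (oH d)) = eval (fun i => (ψ : Om d →+* ℂ) (oy d Set.univ (gp s i))) (pderiv 1 (map (ψ : Om d →+* ℂ) (oH d))) := by
    rw [pderiv_map, eval_map]; rfl
  have h6 := h5.symm.trans h4
  rw [h3] at h6
  have h7 : ψ (oy d Set.univ (gp s 0)) = 1 := by simp [oy, ψ, og, w]
  simp [P, Derivation.leibniz, Derivation.leibniz_pow, pderiv_X, h7] at h6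
end FB

end

end part16

section part17
open MvPolynomial

set_option linter.all false
noncomputable section
namespace FB
variable {d : ℕ}

section two
variable {L : Type*} [Field L]

def rep (x y z : L) (p q : Fin 3 → L) (P : MvPolynomial (Fin 3) L) : L :=
  x * eval p P + y * der p q P + z * eval q P

lemma exists_sep (a b : Fin 3 → L) (ha : a 0 = 1) (hb : b 0 = 1) (h : a ≠ b) :
    ∃ l : MvPolynomial (Fin 3) L, l.IsHomogeneous 1 ∧ eval a l = 0 ∧ eval b l ≠ 0 ∧ ∀ v w, der v w l = eval w l := by
  obtain ⟨i, hi⟩ := Function.ne_iff.1 h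
  refine ⟨X i + C (- a i) * X 0, (isHomogeneous_X _ _).add (isHomogeneous_C_mul_X _ _), ?_, ?_, ?_⟩
  · simp [ha]
  · simp [hb]; intro h; apply hi; linear_combination -h
  · intro v w; rw [der_add, der_mul, der_C]; simp

lemma two_pt (n : ℕ) (p q p' q' : Fin 3 → L) (x y z x' y' z' : L) (hp : p 0 = 1) (hq : q 0 = 1) (hp' : p' 0 = 1) (hq' : q' 0 = 1)
    (hpq : p ≠ q) (hpq' : p' ≠ q') (hy : y ≠ 0) (hz : z' ≠ 0)
    (h : ∀ P : MvPolynomial (Fin 3) L, P.IsHomogeneous (n+5) → rep x y z p q P = rep x' y' z' p' q' P) : p = p' ∧ q = q' := by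
  have hX : (X 0 : MvPolynomial (Fin 3) L).IsHomogeneous 1 := isHomogeneous_X _ _
  have h1 : p = p' := by
    by_contra hne
    obtain ⟨l1, a1, b1, c1, d1⟩ := exists_sep p' p hp' hp (Ne.symm hne)
    obtain ⟨m, a2, b2, c2, d2⟩ := exists_sep p q hp hq hpq
    obtain ⟨l2, a3, b3, c3, d3⟩ := exists_sep q p hq hp hpq.symm
    obtain ⟨l3, a4, b4, c4⟩ : ∃ l3 : MvPolynomial (Fin 3) L, l3.IsHomogeneous 1 ∧ eval q' (m * l3) = 0 ∧ eval p l3 ≠ 0 := by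
      by_cases hqp : q' = p
      · exact ⟨X 0, hX, by rw [hqp, map_mul, b2, zero_mul], by simp [hp]⟩
      · obtain ⟨l3, a4, b4, c4, d4⟩ := exists_sep q' p hq' hp hqp
        exact ⟨l3, a4, by rw [map_mul, b4, mul_zero], c4⟩
    have hh : (m * ((l1 * (l1 * (l2 * l3))) * X 0 ^ n)).IsHomogeneous (n+5) := by
      have := a2.mul ((a1.mul (a1.mul (a3.mul a4))).mul (hX.pow n))
      rwa [show 1 + (1 + (1 + (1 + 1)) + 1 * n) = n + 5 by ring] at this
    have := h _ hh
    have e1 : eval p' (m * ((l1 * (l1 * (l2 * l3))) * X 0 ^ n)) = 0 := by simp [b1]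
    have e2 : der p' q' (m * ((l1 * (l1 * (l2 * l3))) * X 0 ^ n)) = 0 := by
      rw [der_mul, der_mul, der_mul, der_mul]; simp [b1]
    have e3 : eval q' (m * ((l1 * (l1 * (l2 * l3))) * X 0 ^ n)) = 0 := by
      have : m * ((l1 * (l1 * (l2 * l3))) * X 0 ^ n) = m * l3 * (l1 * l1 * l2 * X 0 ^ n) := by ring
      rw [this, map_mul, b4, zero_mul]
    have e4 : eval p (m * ((l1 * (l1 * (l2 * l3))) * X 0 ^ n)) = 0 := by simp [b2]
    have e5 : eval q (m * ((l1 * (l1 * (l2 * l3))) * X 0 ^ n)) = 0 := by simp [b3]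
    have e6 : der p q (m * ((l1 * (l1 * (l2 * l3))) * X 0 ^ n)) = eval q m * (eval p l1 * (eval p l1 * (eval p l2 * eval p l3))) := by
      rw [der_mul, d2]; simp [b2, hp]
    rw [rep, rep, e1, e2, e3, e4, e5, e6] at this
    simp only [mul_zero, zero_add, add_zero, mul_eq_zero] at this
    tauto
  refine ⟨h1, ?_⟩
  subst h1
  by_contra hne
  obtain ⟨l1, a1, b1, c1, d1⟩ := exists_sep p q' hp' hq' hpq'
  obtain ⟨l2, a2, b2, c2, d2⟩ := exists_sep q q' hq hq' hne
  have hh : (l1 * (l1 * l2) * X 0 ^ (n+2)).IsHomogeneous (n+5) := by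
    have := (a1.mul (a1.mul a2)).mul (hX.pow (n+2))
    rwa [show 1 + (1 + 1) + 1 * (n+2) = n + 5 by ring] at this
  have := h _ hh
  have e1 : ∀ q, der p q (l1 * (l1 * l2) * X 0 ^ (n+2)) = 0 := by
    intro q
    rw [der_mul, der_mul, der_mul]; simp [b1]
  have e2 : eval p (l1 * (l1 * l2) * X 0 ^ (n+2)) = 0 := by simp [b1]
  have e3 : eval q (l1 * (l1 * l2) * X 0 ^ (n+2)) = 0 := by simp [b2]
  have e4 : eval q' (l1 * (l1 * l2) * X 0 ^ (n+2)) = eval q' l1 * (eval q' l1 * eval q' l2) := by simp [hq']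
  rw [rep, rep, e1, e1, e2, e3, e4] at this
  simp only [mul_zero, zero_add, add_zero, zero_eq_mul, mul_eq_zero] at this
  tauto

def mkL (R : Type*) [CommRing R] : (E d → R) →ₗ[R] MvPolynomial (Fin 3) R where
  toFun := mkF
  map_add' a b := by rw [mkF_term, mkF_term, mkF_term, ← Finset.sum_add_distrib]; simp
  map_smul' c a := by
    rw [mkF_term, mkF_term, Finset.smul_sum]; simp [smul_monomial]

def evL {R : Type*} [CommRing R] (p : Fin 3 → R) : MvPolynomial (Fin 3) R →ₗ[R] R where
  toFun := eval p
  map_add' := map_add _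
  map_smul' c a := by simp [smul_eval]

def derL {R : Type*} [CommRing R] (p q : Fin 3 → R) : MvPolynomial (Fin 3) R →ₗ[R] R where
  toFun := der p q
  map_add' := der_add p q
  map_smul' c a := by rw [smul_eq_C_mul, der_mul, der_C]; simp

lemma eval_map_hom {R S : Type*} [CommRing R] [CommRing S] (f : R →+* S) (p : Fin 3 → R) (P : MvPolynomial (Fin 3) R) :
    eval (fun i => f (p i)) (map f P) = f (eval p P) := by
  rw [eval_map, ← eval₂_id, hom_eval₂]; rfl

lemma rep_ker (n : ℕ) (B : Polynomial (A (n+5))) (hB : evp (ophi 3 2 n) (og (gc 1)) B = 0)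
    (am : L →+* KK (n+5)) (p q : Fin 3 → L) (hp : (fun i => am (p i)) = pn (n+5) 0)
    (hq : (fun i => am (q i)) = pn (n+5) 1) (lam : E (n+5) → L)
    (hl : ∀ e, am (lam e) = ii (n+5) (Lam n B e)) (a : E (n+5) → L) (h0 : eval p (mkF a) = 0) (h1 : der p q (mkF a) = 0)
    (h2 : eval q (mkF a) = 0) : ∑ e, lam e * a e = 0 := by
  have hLK := LK_ker n B hB (map am (mkF a)) ((mkF_hom a).map _)
      (by rw [← hp, eval_map_hom, h0, map_zero]) (by rw [← hp, ← hq, der_map, h1, map_zero])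
      (by rw [← hq, eval_map_hom, h2, map_zero])
  have h3 : LK n B (map am (mkF a)) = ∑ e : E (n+5), ii (n+5) (Lam n B e) * coeff e.1 (map am (mkF a)) := rfl
  apply am.injective
  rw [map_zero, ← hLK, h3, map_sum]
  refine Finset.sum_congr rfl fun e _ => ?_
  rw [map_mul, hl, coeff_map, coeff_mkF]

lemma three_ker {V : Type*} [AddCommGroup V] [Module L V] (f0 f1 f2 K : V →ₗ[L] L)
    (h : ∀ a, f0 a = 0 → f1 a = 0 → f2 a = 0 → K a = 0) : ∃ x y z : L, ∀ a, K a = x * f0 a + y * f1 a + z * f2 a := by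
  have hs := mem_span_of_iInf_ker_le_ker (L := ![f0, f1, f2]) (K := K) (by
    intro a ha
    rw [Submodule.mem_iInf] at ha
    have h0 := ha 0
    have h1 := ha 1
    have h2 := ha 2
    simp only [LinearMap.mem_ker, Matrix.cons_val] at h0 h1 h2 ⊢
    exact h a h0 h1 h2)
  rw [Submodule.mem_span_range_iff_exists_fun] at hs
  obtain ⟨c, hc⟩ := hs
  refine ⟨c 0, c 1, c 2, fun a => ?_⟩
  rw [← hc, Fin.sum_univ_three]
  simp

lemma rep_exists0 (p q : Fin 3 → L) (lam : E d → L) 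
    (H : ∀ a : E d → L, eval p (mkF a) = 0 → der p q (mkF a) = 0 → eval q (mkF a) = 0 → ∑ e, lam e * a e = 0) :
    ∃ x y z : L, ∀ e, lam e = rep x y z p q (monomial e.1 1) := by
  classical
  let K : (E (d) → L) →ₗ[L] L := ∑ e, lam e • LinearMap.proj e
  have hK : ∀ a, K a = ∑ e, lam e * a e := by intro a; simp [K]
  obtain ⟨x, y, z, hc⟩ := three_ker ((evL p).comp (mkL L)) ((derL p q).comp (mkL L)) ((evL q).comp (mkL L)) K (by
    intro a h0 h1 h2
    rw [hK]
    exact H a h0 h1 h2)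
  refine ⟨x, y, z, fun e => ?_⟩
  have := hc (Pi.single e 1)
  have e1 : mkL L (Pi.single e 1) = monomial e.1 1 := by
    show mkF _ = _
    rw [mkF_term, Finset.sum_eq_single e]
    · simp
    · intro b _ hb; simp [Pi.single_eq_of_ne hb]
    · simp
  have e2 : K (Pi.single e 1) = lam e := by
    rw [hK, Finset.sum_eq_single e]
    · simp
    · intro b _ hb; simp [Pi.single_eq_of_ne hb]
    · simp
  rw [e2] at this
  rw [this, LinearMap.comp_apply, LinearMap.comp_apply, LinearMap.comp_apply, e1]
  rfl

lemma rep_exists (n : ℕ) (B : Polynomial (A (n+5))) (hB : evp (ophi 3 2 n) (og (gc 1)) B = 0)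
    (am : L →+* KK (n+5)) (p q : Fin 3 → L) (hp : ∀ i, am (p i) = pn (n+5) 0 i)
    (hq : ∀ i, am (q i) = pn (n+5) 1 i) (lam : E (n+5) → L)
    (hl : ∀ e, am (lam e) = ii (n+5) (Lam n B e)) :
    ∃ x y z : L, ∀ e, lam e = rep x y z p q (monomial e.1 1) := by
  exact rep_exists0 p q lam (rep_ker n B hB am p q (funext hp) (funext hq) lam hl)

lemma rep_lin (x y z : L) (p q : Fin 3 → L) (a : E d → L) : rep x y z p q (mkF a) = ∑ e, rep x y z p q (monomial e.1 1) * a e := by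
  let R : MvPolynomial (Fin 3) L →ₗ[L] L := x • evL p + y • derL p q + z • evL q
  have hR : ∀ P, R P = rep x y z p q P := fun P => rfl
  rw [← hR, mkF_term, map_sum]
  refine Finset.sum_congr rfl fun e _ => ?_
  rw [← hR, mul_comm, ← smul_eq_mul, ← map_smul, smul_monomial]; simp

lemma rep_ne (n : ℕ) (B : Polynomial (A (n+5))) (hB : evp (ophi 3 2 n) (og (gc 1)) B = 0)
    (hB' : evp (ophi 3 2 n) (og (gc 1)) B.derivative ≠ 0) (x y z : KK (n+5))
    (h : ∀ e : E (n+5), ii (n+5) (Lam n B e) = rep x y z (pn (n+5) 0) (pn (n+5) 1) (monomial e.1 1)) : y ≠ 0 ∧ z ≠ 0 := by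
  set p := pn (n+5) 0 with hp
  set q := pn (n+5) 1 with hq
  have hL : ∀ P : MvPolynomial (Fin 3) (KK (n+5)), P.IsHomogeneous (n+5) → LK n B P = rep x y z p q P := by
    intro P hP
    rw [← mkF_coeff P hP, rep_lin]
    show ∑ e : E (n+5), ii (n+5) (Lam n B e) * _ = _
    refine Finset.sum_congr rfl fun e _ => ?_
    rw [h, coeff_mkF]
  set hh := pderiv 1 (HK (n+5)) with hhh
  have hpq : ell p q ≠ 0 := ell_pn
  have hqp : ell q p ≠ 0 := by
    have : ell q p = - ell p q := by simp only [ell]; ring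
    rw [this]; exact neg_ne_zero.2 hpq
  have hhom : ∀ l : Fin 3 → KK (n+5), (hh * lf l).IsHomogeneous (n+5) := by
    intro l
    have h1 : (lf l).IsHomogeneous 1 := (isHomogeneous_C_mul_X _ _).sub (isHomogeneous_C_mul_X _ _)
    have := (HK_hom (d := n+5)).pderiv (i := 1) |>.mul h1
    rwa [Nat.sub_add_cancel (by omega)] at this
  have h0 : ∀ l : Fin 3 → KK (n+5), rep x y z p q (hh * lf l) = 0 := by
    intro l
    rw [← hL _ (hhom l), lf, mul_sub, map_sub]
    have e : ∀ i : Fin 3, i ≠ 1 → ∀ c : KK (n+5), LK n B (hh * (C c * X i)) = 0 := by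
      intro i hi c
      rw [show hh * (C c * X i) = C c * (hh * X i) by ring, LK_smul, LK_u n B hB (by omega) i hi, mul_zero]
    rw [e 0 (by decide), e 2 (by decide), sub_zero]
  have hhp : eval p hh ≠ 0 := h_ne (by omega) 0
  have hhq : eval q hh ≠ 0 := h_ne (by omega) 1
  have r1 := h0 p
  have r2 := h0 q
  rw [rep, der_mul, der_lf, map_mul, map_mul, eval_lf, eval_lf, ell_self] at r1 r2
  have r1' : y * eval p hh + z * eval q hh = 0 := by
    apply mul_right_cancel₀ hpq; linear_combination r1
  have r2' : x * eval p hh + y * der p q hh = 0 := by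
    apply mul_right_cancel₀ hqp; linear_combination r2
  have hy : y ≠ 0 := by
    intro hy
    rw [hy] at r1' r2'
    have hz : z = 0 := by simpa [hhq] using r1'
    have hx : x = 0 := by simpa [hhp] using r2'
    have := LK_G n B hB
    rw [hL _ (mkF_hom _), hx, hy, hz, rep] at this
    simp only [zero_mul, add_zero] at this
    exact hB' (ii_inj (by rw [← this, map_zero]))
  refine ⟨hy, fun hz => ?_⟩
  rw [hz, zero_mul, add_zero] at r1'
  exact (mul_ne_zero hy hhp) r1'
end two
end FB

end

end part17

section part18
open MvPolynomial

set_option linter.all false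
noncomputable section
namespace FB
variable {d : ℕ}

lemma rep_map {L M : Type*} [Field L] [Field M] (σ : L →+* M) (x y z : L) (p q : Fin 3 → L) (P : MvPolynomial (Fin 3) L) :
    σ (rep x y z p q P) = rep (σ x) (σ y) (σ z) (fun i => σ (p i)) (fun i => σ (q i)) (map σ P) := by
  rw [rep, rep, eval_map_hom, eval_map_hom, der_map, map_add, map_add, map_mul, map_mul, map_mul]

lemma det_hom {L M : Type*} [Field L] [Field M] (σ τ : L →+* M) (n : ℕ) (p q : Fin 3 → L) (u0 u2 x y z : L)
    (lam : E (n+5) → L) (hp : p 0 = 1) (hq : q 0 = 1) (hpq : p 2 ≠ q 2) (hp1 : p 1 = -(u0 * p 0 + u2 * p 2))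
    (hq1 : q 1 = -(u0 * q 0 + u2 * q 2)) (hy : y ≠ 0) (hz : z ≠ 0)
    (hl : ∀ e, lam e = rep x y z p q (monomial e.1 1)) (h : ∀ e, σ (lam e) = τ (lam e)) :
    (∀ i, σ (p i) = τ (p i)) ∧ (∀ i, σ (q i) = τ (q i)) ∧ σ u0 = τ u0 ∧ σ u2 = τ u2 := by
  have hne : ∀ σ : L →+* M, (fun i => σ (p i)) ≠ (fun i => σ (q i)) := fun σ hh => hpq (σ.injective (congrFun hh 2))
  have hlin : ∀ P : MvPolynomial (Fin 3) M, P.IsHomogeneous (n+5) →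
     rep (σ x) (σ y) (σ z) (fun i => σ (p i)) (fun i => σ (q i)) P = rep (τ x) (τ y) (τ z) (fun i => τ (p i)) (fun i => τ (q i)) P := by
    intro P hP
    rw [← mkF_coeff P hP, rep_lin, rep_lin]
    refine Finset.sum_congr rfl fun e _ => ?_
    have := h e
    rw [hl, rep_map, rep_map, map_monomial, map_monomial, map_one σ, map_one τ] at this
    rw [this]
  have h2 := two_pt n _ _ _ _ _ _ _ _ _ _ (by rw [hp, map_one]) (by rw [hq, map_one]) (by rw [hp, map_one]) (by rw [hq, map_one])
    (hne σ) (hne τ) ((map_ne_zero σ).2 hy) ((map_ne_zero τ).2 hz) hlin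
  have hP : ∀ i, σ (p i) = τ (p i) := fun i => congrFun h2.1 i
  have hQ : ∀ i, σ (q i) = τ (q i) := fun i => congrFun h2.2 i
  have hu2 : u2 = -(p 1 - q 1) / (p 2 - q 2) := by
    rw [eq_div_iff (sub_ne_zero.2 hpq), hp1, hq1, hp, hq]; ring
  have hu2' : σ u2 = τ u2 := by
    rw [hu2, map_div₀, map_div₀, map_neg, map_neg, map_sub, map_sub, map_sub, map_sub, hP, hP, hQ, hQ]
  refine ⟨hP, hQ, ?_, hu2'⟩
  have hu0 : u0 = - p 1 - u2 * p 2 := by rw [hp1, hp]; ring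
  rw [hu0, map_sub, map_sub, map_mul, map_mul, map_neg, map_neg, hP, hP, hu2']

section prim
variable {K : Type*} [Field K] {k : Type*} [Field k] [Algebra (A d) k] [IsFractionRing (A d) k]
  [Algebra (A d) K] [Algebra k K] [IsScalarTower (A d) k K] 


variable (k) in
lemma ck (d : ℕ) [Algebra (A d) k] [IsFractionRing (A d) k] : CharZero k :=
  charZero_of_injective_algebraMap (IsFractionRing.injective (A d) k)

variable (k) in
lemma exists_B (c : K) (hc : IsIntegral k c) : ∃ B : Polynomial (A d), ∃ b : A d, b ≠ 0 ∧
    B.map (algebraMap (A d) k) = Polynomial.C (algebraMap (A d) k b) * minpoly k c ∧ Polynomial.aeval c B = 0 ∧ Polynomial.aeval c B.derivative ≠ 0 := by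
  have := ck k d
  obtain ⟨b, hb, h⟩ := IsLocalization.integerNormalization_spec (nonZeroDivisors (A d)) (minpoly k c)
  set B := IsLocalization.integerNormalization (nonZeroDivisors (A d)) (minpoly k c)
  have hb0 : b ≠ 0 := nonZeroDivisors.ne_zero hb
  have hbk : algebraMap (A d) k b ≠ 0 := by
    rw [Ne, FaithfulSMul.algebraMap_eq_zero_iff]; exact hb0
  have hm : B.map (algebraMap (A d) k) = Polynomial.C (algebraMap (A d) k b) * minpoly k c := by
    rw [h, Algebra.smul_def, Polynomial.algebraMap_apply]
  refine ⟨B, b, hb0, hm, ?_, ?_⟩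
  · rw [← Polynomial.aeval_map_algebraMap k, hm, map_mul, minpoly.aeval, mul_zero]
  · rw [← Polynomial.aeval_map_algebraMap k, ← Polynomial.derivative_map, hm, Polynomial.derivative_C_mul, map_mul, Polynomial.aeval_C]
    refine mul_ne_zero ((map_ne_zero _).2 hbk) ?_
    exact (minpoly.irreducible hc).separable.aeval_derivative_ne_zero (minpoly.aeval _ _)

end prim

theorem prim {K : Type*} [Field K] {k : Type*} [Field k] (n : ℕ) [Algebra (A (n+5)) k] [IsFractionRing (A (n+5)) k]
  [Algebra (A (n+5)) K] [Algebra k K] [IsScalarTower (A (n+5)) k K] (Y : Gv → K)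
  (h0 : ∀ i, Y (bs i) = 1) (hpq : Y (gp 0 2) ≠ Y (gp 1 2)) (hinc : ∀ s, Y (gp s 1) = -(Y (gu 0) * Y (gp s 0) + Y (gu 2) * Y (gp s 2)))
  (N : ℕ) (hfin : Module.Finite k (Algebra.adjoin k (Set.range Y))) (hN : Module.finrank k (Algebra.adjoin k (Set.range Y)) = N)
  (H : ∀ B : Polynomial (A (n+5)), Polynomial.aeval (Y (gc 1)) B = 0 → Polynomial.aeval (Y (gc 1)) B.derivative ≠ 0 →
     ∀ (L : IntermediateField k K) (p q : Fin 3 → L) (lam : E (n+5) → L), (∀ i, (p i : K) = Y (gp 0 i)) →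
      (∀ i, (q i : K) = Y (gp 1 i)) → (∀ e, (lam e : K) = Polynomial.aeval (Y (gc 1)) (pd (Sum.inl e) B)) →
     ∃ x y z : L, y ≠ 0 ∧ z ≠ 0 ∧ ∀ e, lam e = rep x y z p q (monomial e.1 1)) :
  IsIntegral k (Y (gc 1)) ∧ (minpoly k (Y (gc 1))).natDegree = N ∧ ∀ g, Y g ∈ Algebra.adjoin k {Y (gc 1)} := by
  have hck := ck k (n+5)
  have hIntg : ∀ x ∈ Set.range Y, IsIntegral k x := by
    intro x hx
    have h1 : IsIntegral k (⟨x, Algebra.subset_adjoin hx⟩ : Algebra.adjoin k (Set.range Y)) := Algebra.IsIntegral.isIntegral _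
    exact h1.map (Algebra.adjoin k (Set.range Y)).val
  let L : IntermediateField k K := IntermediateField.adjoin k (Set.range Y)
  have hLS : L.toSubalgebra = Algebra.adjoin k (Set.range Y) :=
    IntermediateField.adjoin_toSubalgebra_of_isAlgebraic (fun x hx => (hIntg x hx).isAlgebraic)
  have hmem : ∀ g, Y g ∈ L := fun g => IntermediateField.subset_adjoin _ _ ⟨g, rfl⟩
  have hfL : FiniteDimensional k L := by
    have : Module.Finite k L.toSubalgebra := by rw [hLS]; exact hfin
    exact this
  have hNL : Module.finrank k L = N := by
    rw [← hN, ← hLS]; rfl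
  let YL : Gv → L := fun g => ⟨Y g, hmem g⟩
  obtain ⟨B, b, hb, hB1, hB2, hB3⟩ := exists_B (d := n+5) k (Y (gc 1)) (hIntg _ ⟨_, rfl⟩)
  let lam : E (n+5) → L := fun e => Polynomial.aeval (YL (gc 1)) ((pd (Sum.inl e) B).map (algebraMap (A (n+5)) k))
  have hlam : ∀ e, (lam e : K) = Polynomial.aeval (Y (gc 1)) (pd (Sum.inl e) B) := by
    intro e
    rw [← Polynomial.aeval_map_algebraMap k]
    show L.val (lam e) = _
    rw [← Polynomial.aeval_algHom_apply]; rfl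
  obtain ⟨x, y, z, hy, hz, hr⟩ := H B hB2 hB3 L (fun i => YL (gp 0 i)) (fun i => YL (gp 1 i)) lam (fun _ => rfl) (fun _ => rfl) hlam
  have hb1 : ∀ i, YL (bs i) = 1 := fun i => Subtype.ext (h0 i)
  have htop : IntermediateField.adjoin k {YL (gc 1)} = ⊤ := by
    rw [Field.primitive_element_iff_algHom_eq_of_eval' k (AlgebraicClosure K) (fun x => IsAlgClosed.splits _)]
    intro σ τ hστ
    have hst : σ (YL (gc 1)) = τ (YL (gc 1)) := hστ
    obtain ⟨k1, k2, k3, k4⟩ := det_hom (σ : L →+* AlgebraicClosure K) (τ : L →+* AlgebraicClosure K) n (fun i => YL (gp 0 i)) (fun i => YL (gp 1 i))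
      (YL (gu 0)) (YL (gu 2)) x y z lam (hb1 1) (hb1 2) (fun h => hpq (congrArg Subtype.val h)) (Subtype.ext (hinc 0)) (Subtype.ext (hinc 1))
      hy hz hr (fun e => by
        show σ (lam e) = τ (lam e)
        rw [← Polynomial.aeval_algHom_apply, ← Polynomial.aeval_algHom_apply, hst])
    refine IntermediateField.algHom_ext_of_eq_adjoin k (s := Set.range Y) rfl ?_
    rintro _ ⟨g, rfl⟩
    show σ (YL g) = τ (YL g)
    have e1 : ∀ i, σ (YL (bs i)) = τ (YL (bs i)) := fun i => by rw [hb1, map_one, map_one]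
    rcases g with i | ⟨s, i⟩ | i
    · fin_cases i
      · exact e1 0
      · exact hst
    · fin_cases s
      · exact k1 i
      · exact k2 i
    · fin_cases i
      · exact k3
      · exact e1 3
      · exact k4
  have hd := (Field.primitive_element_iff_minpoly_natDegree_eq k (YL (gc 1))).1 htop
  have hmp : minpoly k (YL (gc 1)) = minpoly k (Y (gc 1)) := (minpoly.algebraMap_eq (algebraMap L K).injective (YL (gc 1))).symm
  refine ⟨hIntg _ ⟨_, rfl⟩, by rw [← hmp, hd, hNL], fun g => ?_⟩
  have h1 : YL g ∈ IntermediateField.adjoin k {YL (gc 1)} := by rw [htop]; trivial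
  rw [← IntermediateField.mem_toSubalgebra, IntermediateField.adjoin_simple_toSubalgebra_of_isAlgebraic (Algebra.IsAlgebraic.isAlgebraic _), Algebra.adjoin_singleton_eq_range_aeval] at h1
  obtain ⟨f, hf⟩ := h1
  rw [Algebra.adjoin_singleton_eq_range_aeval]
  refine ⟨f, ?_⟩
  have := congrArg L.val hf
  rw [AlgHom.toRingHom_eq_coe, RingHom.coe_coe, ← Polynomial.aeval_algHom_apply] at this
  exact this
end FB

end

end part18

section part19
open MvPolynomial

set_option linter.all false
noncomputable section
namespace FB
variable {d : ℕ}

section spread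
variable {K : Type*} [Field K] {k : Type*} [Field k] [Algebra (A d) k] [IsFractionRing (A d) k]
  [Algebra (A d) K] [Algebra k K] [IsScalarTower (A d) k K]

variable (d) in
lemma clr_den (Q : Polynomial k) : ∃ Q' : Polynomial (A d), ∃ b : A d, b ≠ 0 ∧
    Q'.map (algebraMap (A d) k) = Polynomial.C (algebraMap (A d) k b) * Q := by
  obtain ⟨b, hb, h⟩ := IsLocalization.integerNormalization_spec (nonZeroDivisors (A d)) Q
  refine ⟨IsLocalization.integerNormalization (nonZeroDivisors (A d)) Q, b, nonZeroDivisors.ne_zero hb, ?_⟩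
  rw [h, Algebra.smul_def, Polynomial.algebraMap_apply]

variable (k) in
lemma map_inj (P Q : Polynomial (A d)) (h : P.map (algebraMap (A d) k) = Q.map (algebraMap (A d) k)) : P = Q :=
  Polynomial.map_injective _ (IsFractionRing.injective (A d) k) h

variable (k) in
lemma spec_zero (c : K) (B : Polynomial (A d)) (b : A d) (hB : B.map (algebraMap (A d) k) = Polynomial.C (algebraMap (A d) k b) * minpoly k c)
    (P : Polynomial (A d)) (hP : Polynomial.aeval c P = 0) (hb : b ≠ 0) :
    ∃ a : A d, a ≠ 0 ∧ ∀ (ψ : A d →+* ℂ) (r : ℂ), ψ a ≠ 0 → B.eval₂ ψ r = 0 → P.eval₂ ψ r = 0 := by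
  rw [← Polynomial.aeval_map_algebraMap k] at hP
  obtain ⟨Q, hQ⟩ := minpoly.dvd _ _ hP
  obtain ⟨Q', b2, hb2, h⟩ := clr_den d Q
  have e : Polynomial.C (b * b2) * P = B * Q' := by
    apply map_inj k
    rw [Polynomial.map_mul, Polynomial.map_mul, hB, h, hQ, Polynomial.map_C, map_mul, Polynomial.C_mul]; ring
  refine ⟨b * b2, mul_ne_zero hb hb2, fun ψ r ha hr => ?_⟩
  have := congrArg (Polynomial.eval₂ ψ r) e
  rw [Polynomial.eval₂_mul, Polynomial.eval₂_mul, hr, zero_mul, Polynomial.eval₂_C] at this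
  exact (mul_eq_zero.1 this).resolve_left ha

variable (k) in
lemma spec_ne (c : K) (hc : IsIntegral k c) (B : Polynomial (A d)) (b : A d) (hB : B.map (algebraMap (A d) k) = Polynomial.C (algebraMap (A d) k b) * minpoly k c)
    (P : Polynomial (A d)) (hP : Polynomial.aeval c P ≠ 0) (hb : b ≠ 0) :
    ∃ a : A d, a ≠ 0 ∧ ∀ (ψ : A d →+* ℂ) (r : ℂ), ψ a ≠ 0 → B.eval₂ ψ r = 0 → P.eval₂ ψ r ≠ 0 := by
  rw [← Polynomial.aeval_map_algebraMap k] at hP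
  have hco : IsCoprime (minpoly k c) (P.map (algebraMap (A d) k)) := by
    rw [(minpoly.irreducible hc).coprime_iff_not_dvd]
    intro h
    rw [minpoly.dvd_iff] at h
    exact hP h
  obtain ⟨u, v, huv⟩ := hco
  obtain ⟨u', b2, hb2, hu⟩ := clr_den d u
  obtain ⟨v', b3, hb3, hv⟩ := clr_den d v
  have e : Polynomial.C b3 * u' * B + Polynomial.C (b * b2) * v' * P = Polynomial.C (b * b2 * b3) := by
    apply map_inj k
    simp only [Polynomial.map_add, Polynomial.map_mul, Polynomial.map_C, hB, hu, hv, map_mul, Polynomial.C_mul]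
    linear_combination (Polynomial.C (algebraMap (A d) k b) * Polynomial.C (algebraMap (A d) k b2) * Polynomial.C (algebraMap (A d) k b3)) * huv
  refine ⟨b * b2 * b3, mul_ne_zero (mul_ne_zero hb hb2) hb3, fun ψ r ha hr hP0 => ha ?_⟩
  have := congrArg (Polynomial.eval₂ ψ r) e
  simp only [Polynomial.eval₂_add, Polynomial.eval₂_mul, hr, hP0, mul_zero, add_zero, Polynomial.eval₂_C] at this
  exact this.symm

variable (k) in
lemma adj_num (c x : K) (hx : x ∈ Algebra.adjoin k {c}) : ∃ a : A d, ∃ P : Polynomial (A d), a ≠ 0 ∧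
    x * algebraMap (A d) K a = Polynomial.aeval c P := by
  rw [Algebra.adjoin_singleton_eq_range_aeval] at hx
  obtain ⟨f, hf⟩ := hx
  obtain ⟨P, a, ha, h⟩ := clr_den d f
  refine ⟨a, P, ha, ?_⟩
  rw [← Polynomial.aeval_map_algebraMap k, h, map_mul, Polynomial.aeval_C, ← IsScalarTower.algebraMap_apply, mul_comm, ← hf]
  rfl

lemma T_num (a : Gv → A d) (ha : ∀ g, a g ≠ 0) (Y : Gv → Polynomial (A d)) (g : T d) :
    ∃ m : A d, ∃ P : Polynomial (A d), m ≠ 0 ∧ ∀ (R : Type _) [Field R] (ψ : A d →+* R) (r : R) (z : Gv → R),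
      (∀ g, z g * ψ (a g) = (Y g).eval₂ ψ r) → eval₂ ψ z g * ψ m = P.eval₂ ψ r := by
  induction g using MvPolynomial.induction_on with
  | C x => exact ⟨1, Polynomial.C x, one_ne_zero, fun R _ ψ r z _ => by rw [eval₂_C, Polynomial.eval₂_C, map_one, mul_one]⟩
  | add p q hp hq =>
    obtain ⟨m, P, hm, h⟩ := hp
    obtain ⟨m', P', hm', h'⟩ := hq
    refine ⟨m * m', P * Polynomial.C m' + P' * Polynomial.C m, mul_ne_zero hm hm', fun R _ ψ r z hz => ?_⟩
    rw [eval₂_add, Polynomial.eval₂_add, Polynomial.eval₂_mul, Polynomial.eval₂_mul, ← h R ψ r z hz, ← h' R ψ r z hz, Polynomial.eval₂_C, Polynomial.eval₂_C, map_mul]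
    ring
  | mul_X p g hp =>
    obtain ⟨m, P, hm, h⟩ := hp
    refine ⟨m * a g, P * Y g, mul_ne_zero hm (ha g), fun R _ ψ r z hz => ?_⟩
    rw [eval₂_mul, eval₂_X, Polynomial.eval₂_mul, ← h R ψ r z hz, ← hz, map_mul]; ring

lemma common {ι : Type*} (s : Finset ι) (Pr : ι → (A d →+* ℂ) → Prop) (h : ∀ i ∈ s, ∃ a : A d, a ≠ 0 ∧ ∀ ψ : A d →+* ℂ, ψ a ≠ 0 → Pr i ψ) :
    ∃ a : A d, a ≠ 0 ∧ ∀ ψ : A d →+* ℂ, ψ a ≠ 0 → ∀ i ∈ s, Pr i ψ := by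
  classical
  induction s using Finset.induction_on with
  | empty => exact ⟨1, one_ne_zero, fun _ _ i hi => by simp at hi⟩
  | insert i s hi ih =>
    obtain ⟨a, ha, h1⟩ := ih (fun j hj => h j (Finset.mem_insert_of_mem hj))
    obtain ⟨b, hb, h2⟩ := h i (Finset.mem_insert_self _ _)
    refine ⟨a * b, mul_ne_zero ha hb, fun ψ hψ j hj => ?_⟩
    rw [map_mul] at hψ
    rcases Finset.mem_insert.1 hj with rfl | hj
    · exact h2 ψ (right_ne_zero_of_mul hψ)
    · exact h1 ψ (left_ne_zero_of_mul hψ) j hj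
end spread

theorem spread {K : Type} [Field K] {k : Type*} [Field k] [Algebra (A d) k] [IsFractionRing (A d) k]
  [Algebra (A d) K] [Algebra k K] [IsScalarTower (A d) k K] (Y : Gv → K) (hc : IsIntegral k (Y (gc 1)))
  (hY : ∀ g, Y g ∈ Algebra.adjoin k {Y (gc 1)}) (Z U : Finset (T d)) (hZ : ∀ g ∈ Z, eval₂ (algebraMap (A d) K) Y g = 0)
  (hU : ∀ g ∈ U, eval₂ (algebraMap (A d) K) Y g ≠ 0) :
  ∃ (B : Polynomial (A d)) (a : A d), a ≠ 0 ∧ Polynomial.aeval (Y (gc 1)) B = 0 ∧ B.natDegree = (minpoly k (Y (gc 1))).natDegree ∧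
    ∀ ψ : A d →+* ℂ, ψ a ≠ 0 → ψ B.leadingCoeff ≠ 0 ∧ (∀ r, B.eval₂ ψ r = 0 → B.derivative.eval₂ ψ r ≠ 0) ∧
      ∀ r, B.eval₂ ψ r = 0 → ∃ z : Gv → ℂ, z (gc 1) = r ∧ (∀ g ∈ Z, eval₂ ψ z g = 0) ∧ ∀ g ∈ U, eval₂ ψ z g ≠ 0 := by
  classical
  obtain ⟨B, b, hb, hB1, hB2, hB3⟩ := exists_B (d := d) k (Y (gc 1)) hc
  choose a P ha hP using fun g => adj_num (d := d) k (Y (gc 1)) (Y g) (hY g)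
  have hdeg : B.natDegree = (minpoly k (Y (gc 1))).natDegree := by
    rw [← Polynomial.natDegree_map_eq_of_injective (IsFractionRing.injective (A d) k) B, hB1,
      Polynomial.natDegree_C_mul ((FaithfulSMul.algebraMap_eq_zero_iff (A d) k).not.2 hb)]
  have hB0 : B ≠ 0 := by
    intro h; rw [h, Polynomial.derivative_zero, map_zero] at hB3; exact hB3 rfl
  have hlc : B.leadingCoeff ≠ 0 := Polynomial.leadingCoeff_ne_zero.2 hB0
  obtain ⟨a1, h1, k1⟩ := spec_ne k _ hc B b hB1 B.derivative hB3 hb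
  have hzY : ∀ g, Y g * algebraMap (A d) K (a g) = (P g).eval₂ (algebraMap (A d) K) (Y (gc 1)) := fun g => hP g
  obtain ⟨a2, h2, k2⟩ := common (d := d) Z (fun g ψ => ∀ r, B.eval₂ ψ r = 0 → ∀ z : Gv → ℂ, (∀ g, z g * ψ (a g) = (P g).eval₂ ψ r) → eval₂ ψ z g = 0) (by
    intro g hg
    obtain ⟨m, Q, hm, h⟩ := T_num a ha P g
    have hQ : Polynomial.aeval (Y (gc 1)) Q = 0 := by
      rw [Polynomial.aeval_def, ← h K (algebraMap (A d) K) _ Y hzY, hZ g hg, zero_mul]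
    obtain ⟨a', ha', h'⟩ := spec_zero k _ B b hB1 Q hQ hb
    refine ⟨a' * m, mul_ne_zero ha' hm, fun ψ hψ r hr z hz => ?_⟩
    rw [map_mul] at hψ
    have := h ℂ ψ r z hz
    rw [h' ψ r (left_ne_zero_of_mul hψ) hr] at this
    exact (mul_eq_zero.1 this).resolve_right (right_ne_zero_of_mul hψ))
  obtain ⟨a3, h3, k3⟩ := common (d := d) U (fun g ψ => ∀ r, B.eval₂ ψ r = 0 → ∀ z : Gv → ℂ, (∀ g, z g * ψ (a g) = (P g).eval₂ ψ r) → eval₂ ψ z g ≠ 0) (by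
    intro g hg
    obtain ⟨m, Q, hm, h⟩ := T_num a ha P g
    have hmK : algebraMap (A d) K m ≠ 0 := by
      rw [IsScalarTower.algebraMap_apply (A d) k K]
      exact (map_ne_zero _).2 ((FaithfulSMul.algebraMap_eq_zero_iff (A d) k).not.2 hm)
    have hQ : Polynomial.aeval (Y (gc 1)) Q ≠ 0 := by
      rw [Polynomial.aeval_def, ← h K (algebraMap (A d) K) _ Y hzY]
      exact mul_ne_zero (hU g hg) hmK
    obtain ⟨a', ha', h'⟩ := spec_ne k _ hc B b hB1 Q hQ hb
    refine ⟨a', ha', fun ψ hψ r hr z hz h0 => ?_⟩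
    have := h ℂ ψ r z hz
    rw [h0, zero_mul] at this
    exact h' ψ r hψ hr this.symm)
  obtain ⟨a4, h4, k4⟩ := spec_zero k _ B b hB1 (P (gc 1) - Polynomial.X * Polynomial.C (a (gc 1))) (by
    rw [map_sub, map_mul, Polynomial.aeval_X, Polynomial.aeval_C, ← hP, sub_self]) hb
  refine ⟨B, B.leadingCoeff * a1 * a2 * a3 * a4 * ∏ g, a g, ?_, hB2, hdeg, ?_⟩
  · exact mul_ne_zero (mul_ne_zero (mul_ne_zero (mul_ne_zero (mul_ne_zero hlc h1) h2) h3) h4) (Finset.prod_ne_zero_iff.2 fun g _ => ha g)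
  · intro ψ hψ
    simp only [map_mul, map_prod, mul_ne_zero_iff, Finset.prod_ne_zero_iff] at hψ
    obtain ⟨⟨⟨⟨⟨w0, w1⟩, w2⟩, w3⟩, w4⟩, w5⟩ := hψ
    refine ⟨w0, fun r hr => k1 ψ r w1 hr, fun r hr => ?_⟩
    have hz : ∀ g, (P g).eval₂ ψ r / ψ (a g) * ψ (a g) = (P g).eval₂ ψ r := fun g => div_mul_cancel₀ _ (w5 g (Finset.mem_univ _))
    refine ⟨fun g => (P g).eval₂ ψ r / ψ (a g), ?_, fun g hg => k2 ψ w2 g hg r hr _ hz, fun g hg => k3 ψ w3 g hg r hr _ hz⟩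
    have := k4 ψ r w4 hr
    rw [Polynomial.eval₂_sub, Polynomial.eval₂_mul, Polynomial.eval₂_X, Polynomial.eval₂_C, sub_eq_zero] at this
    show (P (gc 1)).eval₂ ψ r / ψ (a (gc 1)) = r
    rw [this, mul_div_cancel_right₀ _ (w5 _ (Finset.mem_univ _))]
end FB

end

end part19

section part20
open MvPolynomial

set_option linter.all false
noncomputable section
namespace FB
variable {d : ℕ}

/-- the universal member, normalised coordinates -/
def Fm (d : ℕ) : MvPolynomial (Fin 3) (T d) := mkF (fun e : E d => X (gc 0) * C (X (Sum.inl e)) + X (gc 1) * C (X (Sum.inr e)))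

def ctc (s s' : Fin 2) (j : ℕ) : T d := (lp (fun i => X (gp s i)) (fun i => X (gp s' i)) (Fm d)).coeff j

def Mem {R : Type*} [CommRing R] (a : Sg d → R) (c0 c1 : R) : MvPolynomial (Fin 3) R :=
  mkF (fun e : E d => c0 * a (Sum.inl e) + c1 * a (Sum.inr e))

lemma eval_ctc {R : Type*} [CommRing R] (ψ : A d →+* R) (z : Gv → R) (s s' : Fin 2) (j : ℕ) :
    eval₂ ψ z (ctc s s' j : T d) = (lp (pp z s) (pp z s') (Mem (fun i => ψ (X i)) (z (gc 0)) (z (gc 1)))).coeff j := by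
  have h := lp_map (eval₂Hom ψ z) (fun i => X (gp s i)) (fun i => X (gp s' i)) (Fm d)
  have h2 := congrArg (fun P => Polynomial.coeff P j) h
  rw [Polynomial.coeff_map] at h2
  refine h2.trans ?_
  have e : map (eval₂Hom ψ z) (Fm d) = Mem (fun i => ψ (X i)) (z (gc 0)) (z (gc 1)) := by
    rw [Fm, Mem, mkF, mkF, map_fev]
    simp
  rw [e]
  simp

lemma lp_eval {R : Type*} [CommRing R] (v w : Fin 3 → R) (P : MvPolynomial (Fin 3) R) (t : R) :
    (lp v w P).eval t = eval (fun i => v i + t * w i) P := by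
  induction P using MvPolynomial.induction_on with
  | C a => simp
  | add p q hp hq => rw [lp_add, Polynomial.eval_add, hp, hq, map_add]
  | mul_X p i hp => rw [lp_mul, Polynomial.eval_mul, hp, map_mul, lp_X]; simp; ring

lemma gen_contact_aux {K : Type} [Field K] [Algebra ℂ K] (φ : Sg d → K) (m0 m1 n : ℕ) (y : Gv → K) (hy : ∀ g, y g ≠ 0) (hc : InC m0 m1 n φ y) :
    (Polynomial.X ^ m0 ∣ lp (pp (yn y) 0) (pp (yn y) 1) (Mem φ (yn y (gc 0)) (yn y (gc 1)))) ∧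
    (Polynomial.X ^ m1 ∣ lp (pp (yn y) 1) (pp (yn y) 0) (Mem φ (yn y (gc 0)) (yn y (gc 1)))) := by
  obtain ⟨r, hr⟩ := hc.ex
  have hI := hc.b.inc
  have hyn : ∀ s i, yn y (gp s i) = (y (gp s 0))⁻¹ * y (gp s i) := by
    intro s i; rw [← div_eq_inv_mul]; fin_cases s <;> rfl
  have hyc : ∀ i, yn y (gc i) = (y (gc 0))⁻¹ * y (gc i) := by
    intro i; rw [← div_eq_inv_mul]; rfl
  have hdt : ∀ s, dt (uu y) (pp (yn y) s) = 0 := by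
    intro s
    have := hI s (Set.mem_univ _)
    simp only [dt, hyn] at this ⊢
    linear_combination (y (gp s 0))⁻¹ * this
  have hM : ∀ v, dt (uu y) v = 0 → eval v (Mem φ (yn y (gc 0)) (yn y (gc 1))) = 
      ell (pp y 0) v ^ m0 * ell (pp y 1) v ^ m1 * bev n r (v 0) (v 2) := by
    intro v hv
    have h1 : eval v (Mem φ (yn y (gc 0)) (yn y (gc 1))) = (y (gc 0))⁻¹ * Fc φ y v := by
      rw [Mem, mkF_eval, Fc, fev, fev, fev, hyc, hyc, Finset.mul_sum, Finset.mul_sum, ← Finset.sum_add_distrib, Finset.mul_sum]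
      exact Finset.sum_congr rfl fun e _ => by ring
    rw [h1, hr v hv, ← mul_assoc, ← mul_assoc, ← mul_assoc, inv_mul_cancel₀ (hy _), one_mul]
  have hl : ∀ s s' t, ell (pp y s) (fun i => pp (yn y) s i + t * pp (yn y) s' i) = t * ell (pp y s) (pp (yn y) s') := by
    intro s s' t
    have := hy (gp s 0)
    simp only [ell, hyn]; field_simp; ring
  have hlin : ∀ s s' t, dt (uu y) (fun i => pp (yn y) s i + t * pp (yn y) s' i) = 0 := by
    intro s s' t
    have h1 := hdt s
    have h2 := hdt s'
    simp only [dt] at h1 h2 ⊢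
    linear_combination h1 + t * h2
  have key : ∀ s s', lp (pp (yn y) s) (pp (yn y) s') (Mem φ (yn y (gc 0)) (yn y (gc 1))) =
     lp (pp (yn y) s) (pp (yn y) s') (lf (pp y 0) ^ m0 * lf (pp y 1) ^ m1 * Rp n r) := by
    intro s s'
    apply Polynomial.funext
    intro t
    rw [lp_eval, lp_eval, hM _ (hlin s s' t), map_mul, map_mul, map_pow, map_pow, eval_lf, eval_lf, eval_Rp]
  have hlf : ∀ s s', Polynomial.X ∣ lp (pp (yn y) s) (pp (yn y) s') (lf (pp y s)) := by
    intro s s'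
    rw [Polynomial.X_dvd_iff, lp_coeff0, eval_lf]
    simp only [ell, hyn]; ring
  constructor
  · rw [key, lp_mul, lp_mul, lp_pow, lp_pow, mul_assoc]
    exact Dvd.dvd.mul_right (pow_dvd_pow_of_dvd (hlf 0 1) _) _
  · rw [key, lp_mul, lp_mul, lp_pow, lp_pow]
    exact Dvd.dvd.mul_right (Dvd.dvd.mul_left (pow_dvd_pow_of_dvd (hlf 1 0) _) _) _
end FB

end

end part20

section part21
open MvPolynomial

set_option linter.all false
noncomputable section
namespace FB
variable {d : ℕ}

lemma ii_evp (m0 m1 n : ℕ) (B : Polynomial (A d)) : ii d (evp (ophi m0 m1 n) (og (gc 1)) B) =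
    B.eval₂ ((aeval (gphi m0 m1 n) : A d →ₐ[ℂ] KK d) : A d →+* KK d) (ii d (og (gc 1))) := by
  rw [evp]
  have h := Polynomial.hom_eval₂ B ((aeval (ophi m0 m1 n) : A d →ₐ[ℂ] Om d).toRingHom) ((ii d : Om d →ₐ[ℂ] KK d) : Om d →+* KK d) (og (gc 1))
  refine h.trans ?_
  congr 1
  ext i
  · simp
  · simp [gphi]

lemma yn_gc1 : yn (gy d Set.univ) (gc 1) = ii d (og (gc 1)) := by
  have h0 : gy d Set.univ (gc 0) = ii d (og (gc 0)) := by
    show ii d (oy d Set.univ (gc 0)) = _; simp [oy, gc]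
  have h1 : gy d Set.univ (gc 1) = ii d (og (gc 0)) * ii d (og (gc 1)) := by
    rw [← map_mul]
    show ii d (oy d Set.univ (gc 1)) = _; simp [oy, gc]
  have hne := gy_ne (d := d) Set.univ (gc 0)
  have : yn (gy d Set.univ) (gc 1) = gy d Set.univ (gc 1) / gy d Set.univ (gc 0) := rfl
  rw [this, h1, ← h0, mul_div_cancel_left₀ _ hne]

lemma yn_gu (i : Fin 3) (hi : i ≠ 1) : yn (gy d Set.univ) (gu i) = ii d (og (gu i)) := by
  have h0 : gy d Set.univ (gu 1) = ii d (og (gu 1)) := by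
    show ii d (oy d Set.univ (gu 1)) = _; simp [oy, gu]
  have h1 : gy d Set.univ (gu i) = ii d (og (gu i)) * ii d (og (gu 1)) := by
    rw [← map_mul]
    show ii d (oy d Set.univ (gu i)) = _; simp [oy, gu, hi]
  have hne := gy_ne (d := d) Set.univ (gu 1)
  have : yn (gy d Set.univ) (gu i) = gy d Set.univ (gu i) / gy d Set.univ (gu 1) := rfl
  rw [this, h1, ← h0, mul_div_cancel_right₀ _ hne]

lemma H_gen (n : ℕ) (B : Polynomial (A (n+5))) (L : Type) [Field L] (am : L →+* KK (n+5))
    (hB : B.eval₂ ((aeval (gphi 3 2 n) : A (n+5) →ₐ[ℂ] KK (n+5)) : A (n+5) →+* KK (n+5)) (ii (n+5) (og (gc 1))) = 0)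
    (hB' : B.derivative.eval₂ ((aeval (gphi 3 2 n) : A (n+5) →ₐ[ℂ] KK (n+5)) : A (n+5) →+* KK (n+5)) (ii (n+5) (og (gc 1))) ≠ 0)
    (p q : Fin 3 → L) (lam : E (n+5) → L) (hp : ∀ i, am (p i) = pn (n+5) 0 i) (hq : ∀ i, am (q i) = pn (n+5) 1 i)
    (hl : ∀ e, am (lam e) = (pd (Sum.inl e) B).eval₂ ((aeval (gphi 3 2 n) : A (n+5) →ₐ[ℂ] KK (n+5)) : A (n+5) →+* KK (n+5)) (ii (n+5) (og (gc 1)))) :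
    ∃ x y z : L, y ≠ 0 ∧ z ≠ 0 ∧ ∀ e, lam e = rep x y z p q (monomial e.1 1) := by
  rw [← ii_evp] at hB hB'
  simp only [← ii_evp] at hl
  have h1 : evp (ophi 3 2 n) (og (gc 1)) B = 0 := ii_inj (by rw [hB, map_zero])
  have h2 : evp (ophi 3 2 n) (og (gc 1)) B.derivative ≠ 0 := fun h => hB' (by rw [h, map_zero])
  obtain ⟨x, y, z, h⟩ := rep_exists n B h1 am p q hp hq lam hl
  have h3 := rep_ne n B h1 h2 (am x) (am y) (am z) (by
    intro e
    have h4 : ii (n+5) (Lam n B e) = am (lam e) := (hl e).symm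
    rw [h4, h, rep_map, funext hp, funext hq, map_monomial, map_one am])
  exact ⟨x, y, z, (map_ne_zero am).1 h3.1, (map_ne_zero am).1 h3.2, h⟩
end FB

end

end part21

section part22
open MvPolynomial

set_option linter.all false
noncomputable section
namespace FB
variable {d : ℕ}

def NNum (n : ℕ) : ℕ := 3*n^4+57*n^3+303*n^2+555*n+306

abbrev gA (d n : ℕ) : A d →+* KK d := ((aeval (gphi 3 2 n) : A d →ₐ[ℂ] KK d) : A d →+* KK d)

def cts (d : ℕ) : Finset (T d) := by
  classical
  exact ((Finset.range 3).image (ctc 0 1)) ∪ ((Finset.range 2).image (ctc 1 0)) ∪ {X (gc 0) - 1}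

lemma ell_pn' : pn d 0 2 ≠ pn d 1 2 := by
  intro h
  apply ell_pn (d := d)
  rw [ell, pn0, pn0, h]; ring

lemma gA_inj (n : ℕ) : Function.Injective (gA (n+5) n) := by
  rw [injective_iff_map_eq_zero]
  intro a ha
  obtain ⟨m0, hm⟩ := HI_final n
  refine inj_of_HI (gphi 3 2 n) (gy (n+5) Set.univ) (fun _ => m0) ?_ a ha
  have := hm (fun _ => m0) (fun _ => le_rfl)
  have e : HI (RingHom.ker (ev (gphi 3 2 n) (gy (n+5) Set.univ))) (fun _ => m0) = _ := this
  rw [e]; positivity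

lemma gen_zero (n : ℕ) (h : d = 3 + 2 + n) : ∀ g ∈ cts d, eval₂ (gA d n) (yn (gy d Set.univ)) g = 0 := by
  intro g hg
  have hX : (fun i => gA d n (X i)) = gphi 3 2 n := by
    funext i; exact aeval_X _ i
  have hc := gen_contact_aux (gphi 3 2 n) 3 2 n (gy d Set.univ) (gy_ne _) ⟨gy_inB _, _, gen_inC 3 2 n h⟩
  simp only [cts, Finset.mem_union, Finset.mem_image, Finset.mem_range, Finset.mem_singleton] at hg
  rcases hg with (⟨j, hj, rfl⟩ | ⟨j, hj, rfl⟩) | rfl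
  · rw [eval_ctc, hX]
    exact Polynomial.X_pow_dvd_iff.1 hc.1 j hj
  · rw [eval_ctc, hX]
    exact Polynomial.X_pow_dvd_iff.1 hc.2 j hj
  · rw [eval₂_sub, eval₂_X, eval₂_one]
    have := yn_bs (gy d Set.univ) (gy_ne _) 0
    rw [show gc 0 = bs 0 from rfl, this, sub_self]

def Concl (d n : ℕ) (B : Polynomial (A d)) (a : A d) : Prop := 
   a ≠ 0 ∧ B.eval₂ (gA d n) (ii d (og (gc 1))) = 0 ∧ B.natDegree = NNum n ∧
    ∀ ψ : A d →+* ℂ, ψ a ≠ 0 → ψ B.leadingCoeff ≠ 0 ∧ (∀ r, B.eval₂ ψ r = 0 → B.derivative.eval₂ ψ r ≠ 0) ∧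
      ∀ r, B.eval₂ ψ r = 0 → ∃ z : Gv → ℂ, z (gc 1) = r ∧ (∀ g ∈ cts d, eval₂ ψ z g = 0) ∧ 
        ∀ g ∈ ({X (gp 0 2) * X (gp 1 0) - X (gp 0 0) * X (gp 1 2)} : Finset (T d)), eval₂ ψ z g ≠ 0

lemma concl_of (n : ℕ) (k : Type) [Field k] [Algebra (A (n+5)) k] [IsFractionRing (A (n+5)) k] [Algebra (A (n+5)) (KK (n+5))]
    [Algebra k (KK (n+5))] [IsScalarTower (A (n+5)) k (KK (n+5))] (hA : algebraMap (A (n+5)) (KK (n+5)) = gA (n+5) n) :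
    ∃ B a, Concl (n+5) n B a := by
  have hA' : ∀ a, algebraMap (A (n+5)) (KK (n+5)) a = aeval (gphi 3 2 n) a := fun a => by rw [hA]; rfl
  have hf := field_finrank k (gphi 3 2 n) (gy (n+5) Set.univ) hA' (gy_ne _) (NNum n) (by rw [NNum]; positivity) (by
    obtain ⟨m0, hm⟩ := HI_final n
    refine ⟨m0, fun m h => ?_⟩
    rw [NNum]; push_cast
    exact hm m h)
  have hcc := yn_gc1 (d := n+5)
  obtain ⟨h1, h2, h3⟩ := prim (k := k) n (yn (gy (n+5) Set.univ)) (yn_bs _ (gy_ne _)) ell_pn' (by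
    intro s
    rw [yn_gu 0 (by decide), yn_gu 2 (by decide)]
    exact pn_1 s) (NNum n) hf.1 hf.2 (by
    intro B hB hB' L p q lam hp hq hl
    rw [Polynomial.aeval_def, hA, hcc] at hB hB'
    simp only [Polynomial.aeval_def, hA, hcc] at hl
    exact H_gen n B L (algebraMap L (KK (n+5))) hB hB' p q lam hp hq hl)
  obtain ⟨B, a, ha, hB, hdeg, hψ⟩ := spread (k := k) (yn (gy (n+5) Set.univ)) h1 h3 (cts (n+5)) {X (gp 0 2) * X (gp 1 0) - X (gp 0 0) * X (gp 1 2)}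
    (by rw [hA]; exact gen_zero n (by omega)) (by
      intro g hg
      rw [Finset.mem_singleton] at hg
      rw [hg, hA, eval₂_sub, eval₂_mul, eval₂_mul, eval₂_X, eval₂_X, eval₂_X, eval₂_X]
      exact ell_pn)
  refine ⟨B, a, ha, ?_, by rw [hdeg, h2], hψ⟩
  rw [Polynomial.aeval_def, hA, hcc] at hB
  exact hB

theorem main_gen (n : ℕ) : ∃ B a, Concl (n+5) n B a := by
  let f := gA (n+5) n
  letI i1 : Algebra (A (n+5)) (KK (n+5)) := f.toAlgebra
  letI i2 : Algebra (FractionRing (A (n+5))) (KK (n+5)) := (IsFractionRing.lift (K := FractionRing (A (n+5))) (gA_inj n)).toAlgebra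
  haveI i3 : IsScalarTower (A (n+5)) (FractionRing (A (n+5))) (KK (n+5)) := by
    apply IsScalarTower.of_algebraMap_eq
    intro x
    exact (IsFractionRing.lift_algebraMap (gA_inj n) x).symm
  exact concl_of n (FractionRing (A (n+5))) rfl
end FB

end

end part22

section part23
open MvPolynomial

set_option linter.all false
noncomputable section
namespace FB
variable {d : ℕ}

/-- binary form restricted to a line, as polynomial -/
def bpl (n : ℕ) (r : ℕ → ℂ) (v w : Fin 3 → ℂ) : Polynomial ℂ :=
  bev n (fun i => Polynomial.C (r i)) (Polynomial.C (v 0) + Polynomial.X * Polynomial.C (w 0))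
    (Polynomial.C (v 2) + Polynomial.X * Polynomial.C (w 2))

lemma bpl_eval (n : ℕ) (r : ℕ → ℂ) (v w : Fin 3 → ℂ) (t : ℂ) :
    (bpl n r v w).eval t = bev n r (v 0 + t * w 0) (v 2 + t * w 2) := by
  have := map_bev (Polynomial.evalRingHom t) n (fun i => Polynomial.C (r i)) (Polynomial.C (v 0) + Polynomial.X * Polynomial.C (w 0))
    (Polynomial.C (v 2) + Polynomial.X * Polynomial.C (w 2))
  rw [bpl]
  refine this.trans ?_
  simp only [Polynomial.coe_evalRingHom, Polynomial.eval_add, Polynomial.eval_mul, Polynomial.eval_C, Polynomial.eval_X]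

lemma bpl_div (n : ℕ) (r : ℕ → ℂ) (v w : Fin 3 → ℂ) (m : ℕ) (h2 : v 2 ≠ 0) (hl : ell v w ≠ 0)
    (h : Polynomial.X ^ (m+1) ∣ bpl (n+1) r v w) :
    ∃ r', (∀ x z, bev (n + 1) r x z = (v 2 * x - v 0 * z) * bev n r' x z) ∧ Polynomial.X ^ m ∣ bpl n r' v w := by
  have h0 : bev (n+1) r (v 0) (v 2) = 0 := by
    have h1 : Polynomial.X ∣ bpl (n+1) r v w := dvd_trans (dvd_pow_self _ (by omega)) h
    rw [Polynomial.X_dvd_iff, Polynomial.coeff_zero_eq_eval_zero, bpl_eval] at h1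
    simpa using h1
  obtain ⟨r', hr'⟩ := bev_div n r (v 0) (v 2) h2 h0
  refine ⟨r', hr', ?_⟩
  have e : bpl (n+1) r v w = Polynomial.X * (Polynomial.C (ell v w) * bpl n r' v w) := by
    apply Polynomial.funext
    intro t
    rw [bpl_eval, hr', Polynomial.eval_mul, Polynomial.eval_mul, Polynomial.eval_C, Polynomial.eval_X, bpl_eval, ell]
    ring
  rw [e, pow_succ', mul_dvd_mul_iff_left Polynomial.X_ne_zero] at h
  exact (IsUnit.dvd_mul_left (Polynomial.isUnit_C.2 (isUnit_iff_ne_zero.2 hl))).1 h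

lemma bpl_divs (m : ℕ) : ∀ (n : ℕ) (r : ℕ → ℂ) (v w : Fin 3 → ℂ) (h2 : v 2 ≠ 0) (hl : ell v w ≠ 0)
    (h : Polynomial.X ^ m ∣ bpl (m+n) r v w),
    ∃ r', (∀ x z, bev (m + n) r x z = (v 2 * x - v 0 * z)^m * bev n r' x z) := by
  induction m with
  | zero => intro n r v w _ _ _; exact ⟨r, by simp⟩
  | succ m ih =>
    intro n r v w h2 hl h
    rw [show m + 1 + n = (m + n) + 1 by ring] at h ⊢
    obtain ⟨r1, h1, h3⟩ := bpl_div _ _ _ _ _ h2 hl h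
    obtain ⟨r', h4⟩ := ih n r1 v w h2 hl h3
    exact ⟨r', fun x z => by rw [h1, h4]; ring⟩

/-- too much contact: zero -/
lemma bpl_zero (n : ℕ) : ∀ (m : ℕ) (r : ℕ → ℂ) (v w : Fin 3 → ℂ) (h2 : v 2 ≠ 0) (hl : ell v w ≠ 0) (hm : n < m)
    (h : Polynomial.X ^ m ∣ bpl n r v w), ∀ x z, bev n r x z = 0 := by
  induction n with
  | zero =>
    intro m r v w _ _ hm h x z
    have h1 : Polynomial.X ∣ bpl 0 r v w := dvd_trans (dvd_pow_self _ (by omega)) h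
    rw [Polynomial.X_dvd_iff, Polynomial.coeff_zero_eq_eval_zero, bpl_eval] at h1
    simpa [bev] using h1
  | succ n ih =>
    intro m r v w h2 hl hm h x z
    obtain ⟨m, rfl⟩ : ∃ k, m = k + 1 := ⟨m - 1, by omega⟩
    obtain ⟨r1, h1, h3⟩ := bpl_div _ _ _ _ _ h2 hl h
    rw [h1, ih m r1 v w h2 hl (by omega) h3, mul_zero]

/-- residual contact at the second point -/
lemma bpl_second (k n : ℕ) (r r' : ℕ → ℂ) (v w : Fin 3 → ℂ) (hl : ell v w ≠ 0)
    (h1 : ∀ x z, bev (k + n) r x z = (v 2 * x - v 0 * z)^k * bev n r' x z) (m : ℕ)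
    (h : Polynomial.X ^ m ∣ bpl (k+n) r w v) : Polynomial.X ^ m ∣ bpl n r' w v := by
  have e : bpl (k+n) r w v = Polynomial.C (ell v w ^ k) * bpl n r' w v := by
    apply Polynomial.funext
    intro t
    rw [bpl_eval, h1, Polynomial.eval_mul, Polynomial.eval_C, bpl_eval, ell]
    ring
  rw [e] at h
  exact (IsUnit.dvd_mul_left (Polynomial.isUnit_C.2 (isUnit_iff_ne_zero.2 (pow_ne_zero _ hl)))).1 h

/-- good position -/
structure Good (φ : Sg d → ℂ) (c0 c1 : ℂ) (v w : Fin 3 → ℂ) : Prop where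
  hc0 : c0 ≠ 0
  v2 : v 2 ≠ 0
  w2 : w 2 ≠ 0
  l : ell v w ≠ 0
  h0 : Polynomial.X ^ 3 ∣ lp v w (Mem φ c0 c1)
  h1 : Polynomial.X ^ 2 ∣ lp w v (Mem φ c0 c1)

def crs (v w : Fin 3 → ℂ) : Fin 3 → ℂ := ![v 1 * w 2 - v 2 * w 1, v 2 * w 0 - v 0 * w 2, v 0 * w 1 - v 1 * w 0]

lemma crs_v (v w : Fin 3 → ℂ) : dt (crs v w) v = 0 := by simp [dt, crs]; ring
lemma crs_w (v w : Fin 3 → ℂ) : dt (crs v w) w = 0 := by simp [dt, crs]; ring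

lemma good_bev {φ : Sg d → ℂ} {c0 c1 : ℂ} {v w : Fin 3 → ℂ} (h : Good φ c0 c1 v w) :
    ∃ r, (∀ x, dt (crs v w) x = 0 → eval x (Mem φ c0 c1) = bev d r (x 0) (x 2)) ∧
      Polynomial.X ^ 3 ∣ bpl d r v w ∧ Polynomial.X ^ 2 ∣ bpl d r w v := by
  obtain ⟨r, hr⟩ := restrict_bev (fun e : E d => c0 * φ (Sum.inl e) + c1 * φ (Sum.inr e)) (crs v w) h.l
  have hr' : ∀ x, dt (crs v w) x = 0 → eval x (Mem φ c0 c1) = bev d r (x 0) (x 2) := by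
    intro x hx; rw [Mem, mkF_eval, hr x hx]
  have hv := crs_v v w
  have hw := crs_w v w
  refine ⟨r, hr', ?_, ?_⟩
  · have e : bpl d r v w = lp v w (Mem φ c0 c1) := by
      apply Polynomial.funext
      intro t
      rw [bpl_eval, lp_eval, hr']
      simp only [dt] at hv hw ⊢
      linear_combination hv + t * hw
    rw [e]; exact h.h0
  · have e : bpl d r w v = lp w v (Mem φ c0 c1) := by
      apply Polynomial.funext
      intro t
      rw [bpl_eval, lp_eval, hr']
      simp only [dt] at hv hw ⊢
      linear_combination hw + t * hv
    rw [e]; exact h.h1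

lemma ell_swap (v w : Fin 3 → ℂ) : ell w v = - ell v w := by simp [ell]; ring

/-- coordinates of a triple -/
def mky (c0 c1 : ℂ) (v w : Fin 3 → ℂ) : Gv → ℂ
  | Sum.inl i => ![c0, c1] i
  | Sum.inr (Sum.inl (s, i)) => ![v, w] s i
  | Sum.inr (Sum.inr i) => crs v w i

lemma mky_inB {φ : Sg d → ℂ} {c0 c1 : ℂ} {v w : Fin 3 → ℂ} (h : Good φ c0 c1 v w) : InB Set.univ (mky c0 c1 v w) := by
  refine ⟨h.hc0, h.l, ?_⟩
  intro s _
  fin_cases s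
  · exact crs_v v w
  · exact crs_w v w

lemma mky_Fc (φ : Sg d → ℂ) (c0 c1 : ℂ) (v w x : Fin 3 → ℂ) : Fc φ (mky c0 c1 v w) x = eval x (Mem φ c0 c1) := by
  rw [Mem, mkF_eval, Fc, fev, fev, fev, Finset.mul_sum, Finset.mul_sum, ← Finset.sum_add_distrib]
  refine Finset.sum_congr rfl fun e _ => ?_
  change c0 * _ + c1 * _ = _
  ring

/-- `d ≥ 5` -/
lemma good_inC {n : ℕ} (hd : d = 3 + (2 + n)) {φ : Sg d → ℂ} {c0 c1 : ℂ} {v w : Fin 3 → ℂ} (h : Good φ c0 c1 v w) :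
    InC 3 2 n φ (mky c0 c1 v w) := by
  refine ⟨mky_inB h, ?_⟩
  obtain ⟨r, hr, h0, h1⟩ := good_bev h
  subst hd
  obtain ⟨r1, hr1⟩ := bpl_divs 3 (2+n) r v w h.v2 h.l h0
  have h2 := bpl_second 3 (2+n) r r1 v w h.l hr1 2 h1
  obtain ⟨r2, hr2⟩ := bpl_divs 2 n r1 w v h.w2 (by rw [ell_swap]; exact neg_ne_zero.2 h.l) h2
  refine ⟨fun i => c0⁻¹ * r2 i, ?_⟩
  intro x hx
  rw [mky_Fc, hr x hx, hr1, hr2, bev_mul_left]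
  have := h.hc0
  change _ = c0 * ell v x ^ 3 * ell w x ^ 2 * _
  simp only [ell]
  field_simp

/-- `d = 3, 4` -/
lemma good_zero (hd : 3 ≤ d) (hd' : d ≤ 4) {φ : Sg d → ℂ} {c0 c1 : ℂ} {v w : Fin 3 → ℂ} (h : Good φ c0 c1 v w) :
    ∀ x, dt (crs v w) x = 0 → eval x (Mem φ c0 c1) = 0 := by
  obtain ⟨r, hr, h0, h1⟩ := good_bev h
  obtain ⟨n, rfl⟩ : ∃ n, d = 3 + n := ⟨d - 3, by omega⟩
  obtain ⟨r1, hr1⟩ := bpl_divs 3 n r v w h.v2 h.l h0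
  have h2 := bpl_second 3 n r r1 v w h.l hr1 2 h1
  have := bpl_zero n 2 r1 w v h.w2 (by rw [ell_swap]; exact neg_ne_zero.2 h.l) (by omega) h2
  intro x hx
  rw [hr x hx, hr1, this, mul_zero]

def Kills (B : Polynomial (A d)) : Prop := ∀ (φ : Sg d → ℂ) c0 c1 v w, Good φ c0 c1 v w →
  B.eval₂ (aeval φ : A d →ₐ[ℂ] ℂ).toRingHom (c1 / c0) = 0

lemma kills_gen (n : ℕ) (hd : d = 3 + (2 + n)) (B : Polynomial (A d)) (h : B.eval₂ (gA d n) (ii d (og (gc 1))) = 0) :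
    Kills B := by
  intro φ c0 c1 v w hg
  have hC := good_inC hd hg
  obtain ⟨r, hr⟩ := hC.ex
  have h1 : B.eval₂ ((aeval (ophi 3 2 n) : A d →ₐ[ℂ] Om d) : A d →+* Om d) (og (gc 1)) = 0 := by
    apply ii_inj
    rw [map_zero]
    have := Polynomial.hom_eval₂ B ((aeval (ophi 3 2 n) : A d →ₐ[ℂ] Om d) : A d →+* Om d) (ii d : Om d →+* KK d) (og (gc 1))
    refine this.trans ?_
    convert h using 2
    apply MvPolynomial.ringHom_ext
    · intro a; simp
    · intro i; simp [gA, gphi]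
    · rfl
  have h2 := congrArg (psi φ (mky c0 c1 v w) r) h1
  rw [map_zero] at h2
  have h3 := Polynomial.hom_eval₂ B ((aeval (ophi 3 2 n) : A d →ₐ[ℂ] Om d) : A d →+* Om d) (psi φ (mky c0 c1 v w) r : Om d →+* ℂ) (og (gc 1))
  have h4 := h3.symm.trans h2
  refine Eq.trans ?_ h4
  have e1 : (psi φ (mky c0 c1 v w) r : Om d →+* ℂ) (og (gc 1)) = c1 / c0 := psi_c1 _ _ _
  rw [e1]
  congr 1
  apply MvPolynomial.ringHom_ext
  · intro a; simp
  · intro i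
    have := psi_ophi φ (mky c0 c1 v w) r 3 2 n hC.b hr i
    simp [this]
end FB

end

end part23

section part24
open MvPolynomial

set_option linter.all false
noncomputable section
namespace FB
variable {d : ℕ}

/-- homogenised evaluation -/
def hB {R : Type*} [CommRing R] [Algebra ℂ R] (B : Polynomial (A d)) (φ : Sg d → R) (c0 c1 : R) : R :=
  ∑ i ∈ Finset.range (B.natDegree + 1), aeval φ (B.coeff i) * c0 ^ (B.natDegree - i) * c1 ^ i

lemma hB_map {R S : Type*} [CommRing R] [Algebra ℂ R] [CommRing S] [Algebra ℂ S] (f : R →ₐ[ℂ] S) (B : Polynomial (A d)) (φ : Sg d → R) (c0 c1 : R) :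
    f (hB B φ c0 c1) = hB B (fun i => f (φ i)) (f c0) (f c1) := by
  rw [hB, hB, map_sum]
  refine Finset.sum_congr rfl fun i _ => ?_
  rw [map_mul, map_mul, map_pow, map_pow]
  congr 2
  rw [← AlgHom.comp_apply, comp_aeval]

lemma hB_eq (B : Polynomial (A d)) (φ : Sg d → ℂ) (c0 c1 : ℂ) (h : c0 ≠ 0) :
    hB B φ c0 c1 = c0 ^ B.natDegree * B.eval₂ (aeval φ : A d →ₐ[ℂ] ℂ).toRingHom (c1 / c0) := by
  rw [hB, Polynomial.eval₂_eq_sum_range, Finset.mul_sum]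
  refine Finset.sum_congr rfl fun i hi => ?_
  have : B.natDegree = (B.natDegree - i) + i := by have := Finset.mem_range.1 hi; omega
  conv_rhs => rw [this, pow_add]
  rw [div_pow]
  change _ = c0 ^ _ * c0 ^ _ * (aeval φ (B.coeff i) * _)
  field_simp

lemma hB_zero (B : Polynomial (A d)) (φ : Sg d → ℂ) (c1 : ℂ) :
    hB B φ 0 c1 = aeval φ B.leadingCoeff * c1 ^ B.natDegree := by
  rw [hB, Finset.sum_range_succ, Finset.sum_eq_zero]
  · simp
  · intro i hi
    have : B.natDegree - i ≠ 0 := by have := Finset.mem_range.1 hi; omega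
    rw [zero_pow this]; ring

lemma poly_dense (p q : Polynomial ℂ) (hq : q ≠ 0) (h : ∀ t, q.eval t ≠ 0 → p.eval t = 0) : p = 0 := by
  have : p * q = 0 := by
    apply Polynomial.funext
    intro t
    by_cases ht : q.eval t = 0
    · simp [ht]
    · simp [h t ht]
  exact (mul_eq_zero.1 this).resolve_right hq

lemma fev_inj (a b : E d → ℂ) (h : ∀ x, fev a x = fev b x) : a = b := by
  have : mkF a = mkF b := by
    apply MvPolynomial.funext
    intro x; rw [mkF_eval, mkF_eval, h]
  funext e
  rw [← coeff_mkF a, this, coeff_mkF]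

/-- substitution of a matrix -/
lemma sub_coeffs (a : E d → ℂ) (N : Fin 3 → Fin 3 → Polynomial ℂ) :
    ∃ a' : E d → Polynomial ℂ, ∀ t x, fev (fun e => (a' e).eval t) x = fev a (fun i => ∑ j, (N i j).eval t * x j) := by
  let P : MvPolynomial (Fin 3) (Polynomial ℂ) := fev (fun e => C (Polynomial.C (a e))) (fun i => ∑ j, C (N i j) * X j)
  have hP : P.IsHomogeneous d := by
    apply IsHomogeneous.sum
    intro e _
    refine IsHomogeneous.C_mul ?_ _
    have h1 : ∀ i : Fin 3, ((∑ j, C (N i j) * X j : MvPolynomial (Fin 3) (Polynomial ℂ)) ^ (e.1 i)).IsHomogeneous (1 * e.1 i) := by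
      intro i
      apply IsHomogeneous.pow
      apply IsHomogeneous.sum
      intro j _
      exact isHomogeneous_C_mul_X _ _
    have := IsHomogeneous.prod Finset.univ (fun i : Fin 3 => (∑ j, C (N i j) * X j : MvPolynomial (Fin 3) (Polynomial ℂ)) ^ (e.1 i)) (fun i => 1 * e.1 i) (fun i _ => h1 i)
    simp only [one_mul, E_sum] at this
    exact this
  refine ⟨fun e => coeff e.1 P, fun t x => ?_⟩
  have h1 : ∀ e : E d, (coeff e.1 P).eval t = coeff e.1 (map (Polynomial.evalRingHom t) P) := by
    intro e; rw [coeff_map]; rfl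
  simp only [h1]
  rw [fev_coeff _ (hP.map _)]
  change (eval x : MvPolynomial (Fin 3) ℂ →+* ℂ) (map (Polynomial.evalRingHom t) (fev _ _)) = _
  rw [map_fev, map_fev]
  simp

lemma exists_H0 (x x' : Fin 2 → Fin 3 → ℂ) (h : LinearIndependent ℂ x) :
    ∃ H : Matrix (Fin 3) (Fin 3) ℂ, ∀ i, H.mulVec (x i) = x' i := by
  obtain ⟨g, hg⟩ := LinearMap.exists_extend ((Finsupp.linearCombination ℂ x').comp h.repr)
  refine ⟨LinearMap.toMatrix' g, fun i => ?_⟩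
  have hi : x i ∈ Submodule.span ℂ (Set.range x) := Submodule.subset_span ⟨i, rfl⟩
  have := LinearMap.congr_fun hg ⟨_, hi⟩
  rw [LinearMap.toMatrix'_mulVec]
  refine this.trans ?_
  rw [LinearMap.comp_apply, h.repr_eq_single i ⟨_, hi⟩ rfl]
  simp

lemma exists_H (v w : Fin 3 → ℂ) (h : LinearIndependent ℂ ![v, w]) (v' w' : Fin 3 → ℂ) :
    ∃ H : Matrix (Fin 3) (Fin 3) ℂ, H.mulVec v = v' ∧ H.mulVec w = w' := by
  obtain ⟨H, hH⟩ := exists_H0 _ ![v', w'] h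
  exact ⟨H, hH 0, hH 1⟩

lemma Mem_eval (φ : Sg d → ℂ) (c0 c1 : ℂ) (x) : eval x (Mem φ c0 c1) = c0 * fev (fun e => φ (Sum.inl e)) x + c1 * fev (fun e => φ (Sum.inr e)) x := by
  rw [Mem, mkF_eval, fev, fev, fev, Finset.mul_sum, Finset.mul_sum, ← Finset.sum_add_distrib]
  exact Finset.sum_congr rfl fun e _ => by ring

lemma Mem_smul_eval (φ : Sg d → ℂ) (c0 c1 s : ℂ) (x) : eval (fun i => s * x i) (Mem φ c0 c1) = s ^ d * eval x (Mem φ c0 c1) := by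
  rw [Mem, mkF_eval, mkF_eval, fev_smul]

lemma kill1 (B : Polynomial (A d)) (hK : Kills B) (φ : Sg d → ℂ) (c0 c1 : ℂ) (v w : Fin 3 → ℂ) (hc : c0 ≠ 0)
    (hli : LinearIndependent ℂ ![v, w]) (h0 : Polynomial.X ^ 3 ∣ lp v w (Mem φ c0 c1)) 
    (h1 : Polynomial.X ^ 2 ∣ lp w v (Mem φ c0 c1)) : hB B φ c0 c1 = 0 := by
  obtain ⟨H, hv, hw⟩ := exists_H v w hli ![0,0,1] ![1,0,1]
  let M : Matrix (Fin 3) (Fin 3) (Polynomial ℂ) := 1 + (Polynomial.X : Polynomial ℂ) • H.map Polynomial.C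
  let N := M.adjugate
  obtain ⟨aF, haF⟩ := sub_coeffs (fun e => φ (Sum.inl e)) N
  obtain ⟨aG, haG⟩ := sub_coeffs (fun e => φ (Sum.inr e)) N
  have hMe : ∀ t x, (fun i => ∑ j, (M i j).eval t * x j) = fun i => x i + t * H.mulVec x i := by
    intro t x
    funext i
    simp only [M, Matrix.add_apply, Matrix.smul_apply, Matrix.map_apply, smul_eq_mul, Polynomial.eval_add, Polynomial.eval_mul,
      Polynomial.eval_X, Polynomial.eval_C, add_mul, Finset.sum_add_distrib, Matrix.mulVec, dotProduct, Finset.mul_sum]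
    congr 1
    · rw [Finset.sum_eq_single i] <;> simp +contextual [Matrix.one_apply]
      intro j hj; left; rw [if_neg (Ne.symm hj)]; simp
    · exact Finset.sum_congr rfl fun j _ => by ring
  have hNM : ∀ t (x : Fin 3 → ℂ), (fun i => ∑ j, (N i j).eval t * (∑ k, (M j k).eval t * x k)) = fun i => M.det.eval t * x i := by
    intro t x
    funext i
    have e : ∀ k, ∑ j, (N i j).eval t * (M j k).eval t = if i = k then M.det.eval t else 0 := by
      intro k
      have := congrArg (fun Z : Matrix (Fin 3) (Fin 3) (Polynomial ℂ) => (Z i k).eval t) (Matrix.adjugate_mul M)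
      simp only [Matrix.mul_apply, Polynomial.eval_finsetSum, Polynomial.eval_mul] at this
      rw [this]
      simp only [Matrix.smul_apply, Matrix.one_apply, smul_eq_mul]
      split_ifs <;> simp
    simp only [Finset.mul_sum]
    rw [Finset.sum_comm]
    simp only [← mul_assoc, ← Finset.sum_mul, e]
    simp
  let q : Polynomial ℂ := M.det * (Polynomial.C (v 2) + Polynomial.X) * (Polynomial.C (w 2) + Polynomial.X) *
    ((Polynomial.C (v 2) + Polynomial.X) * (Polynomial.C (w 0) + Polynomial.X) - Polynomial.C (v 0) * (Polynomial.C (w 2) + Polynomial.X))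
  have hM0 : M.det.eval 0 = 1 := by
    have : (M.map (Polynomial.evalRingHom 0)) = 1 := by
      ext i j; simp [M, Matrix.one_apply]; split_ifs <;> simp
    rw [← Polynomial.coe_evalRingHom, RingHom.map_det]
    change (M.map (Polynomial.evalRingHom 0)).det = 1
    rw [this, Matrix.det_one]
  have hXC : ∀ a : ℂ, (Polynomial.C a + Polynomial.X) ≠ 0 := fun a => by
    rw [add_comm]; exact Polynomial.X_add_C_ne_zero a
  have hq : q ≠ 0 := by
    refine mul_ne_zero (mul_ne_zero (mul_ne_zero ?_ (hXC _)) (hXC _)) ?_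
    · intro h; rw [h] at hM0; simp at hM0
    · intro h
      have := congrArg (fun p => Polynomial.coeff p 2) h
      simp [add_mul, mul_add, Polynomial.coeff_X, Polynomial.coeff_C] at this
  have hp : hB B (fun i => Sum.elim aF aG i) (Polynomial.C c0) (Polynomial.C c1) = 0 := by
    apply poly_dense _ q hq
    intro t ht
    have hm := hB_map (Polynomial.aeval t : Polynomial ℂ →ₐ[ℂ] ℂ) B (fun i => Sum.elim aF aG i) (Polynomial.C c0) (Polynomial.C c1)
    rw [Polynomial.coe_aeval_eq_eval] at hm
    rw [hm]
    simp only [q, Polynomial.eval_mul, Polynomial.eval_add, Polynomial.eval_sub, Polynomial.eval_C, Polynomial.eval_X] at ht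
    simp only [Polynomial.eval_C]
    set φ' : Sg d → ℂ := fun i => Polynomial.eval t (Sum.elim aF aG i) with hφ'
    have hMem : ∀ x, eval x (Mem φ' c0 c1) = eval (fun i => ∑ j, (N i j).eval t * x j) (Mem φ c0 c1) := by
      intro x
      rw [Mem_eval, Mem_eval, ← haF, ← haG]; rfl
    have hMem2 : ∀ x, eval (fun i => x i + t * H.mulVec x i) (Mem φ' c0 c1) = M.det.eval t ^ d * eval x (Mem φ c0 c1) := by
      intro x
      rw [← hMe, hMem, ← Mem_smul_eval, ← hNM]
    have hlp : ∀ x y, lp (fun i => x i + t * H.mulVec x i) (fun i => y i + t * H.mulVec y i) (Mem φ' c0 c1) =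
        Polynomial.C (M.det.eval t ^ d) * lp x y (Mem φ c0 c1) := by
      intro x y
      apply Polynomial.funext
      intro s
      rw [lp_eval, Polynomial.eval_mul, lp_eval, Polynomial.eval_C, ← hMem2]
      congr 2
      funext i
      have : H.mulVec (fun i => x i + s * y i) i = H.mulVec x i + s * H.mulVec y i := by
        simp only [Matrix.mulVec, dotProduct, Finset.mul_sum, ← Finset.sum_add_distrib]
        exact Finset.sum_congr rfl fun j _ => by ring
      rw [this]; ring
    have hg : Good φ' c0 c1 (fun i => v i + t * H.mulVec v i) (fun i => w i + t * H.mulVec w i) := by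
      have t1 := left_ne_zero_of_mul (left_ne_zero_of_mul ht)
      have t2 := right_ne_zero_of_mul (left_ne_zero_of_mul ht)
      have t3 := right_ne_zero_of_mul ht
      refine ⟨hc, ?_, ?_, ?_, ?_, ?_⟩
      · simp [hv]; exact right_ne_zero_of_mul t1
      · simp [hw]; exact t2
      · simp [ell, hv, hw]; exact t3
      · rw [hlp]; exact Dvd.dvd.mul_left h0 _
      · rw [hlp]; exact Dvd.dvd.mul_left h1 _
    rw [hB_eq _ _ _ _ hc, hK _ _ _ _ _ hg, mul_zero]
  have hm := hB_map (Polynomial.aeval 0 : Polynomial ℂ →ₐ[ℂ] ℂ) B (fun i => Sum.elim aF aG i) (Polynomial.C c0) (Polynomial.C c1)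
  rw [Polynomial.coe_aeval_eq_eval, hp] at hm
  simp only [Polynomial.eval_C, Polynomial.eval_zero] at hm
  have hN0 : ∀ x, (fun i => ∑ j, (N i j).eval 0 * x j) = x := by
    intro x
    have := hNM 0 x
    have e := hMe 0 x
    simp only [zero_mul, add_zero, hM0, one_mul] at this e
    funext i
    have h2 := congrFun this i
    refine Eq.trans ?_ h2
    refine Finset.sum_congr rfl fun j _ => ?_
    rw [congrFun e j]
  have hφ : (fun i => Polynomial.eval 0 (Sum.elim aF aG i)) = φ := by
    have e1 : (fun e => (aF e).eval 0) = fun e => φ (Sum.inl e) := by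
      apply fev_inj; intro x; rw [haF, hN0]
    have e2 : (fun e => (aG e).eval 0) = fun e => φ (Sum.inr e) := by
      apply fev_inj; intro x; rw [haG, hN0]
    funext i
    rcases i with e | e
    · exact congrFun e1 e
    · exact congrFun e2 e
  rw [hφ] at hm
  exact hm.symm

lemma kill2 (B : Polynomial (A d)) (hK : Kills B) (φ : Sg d → ℂ) (c0 c1 : ℂ) (v w : Fin 3 → ℂ) (hc : c0 ≠ 0 ∨ c1 ≠ 0)
    (hli : LinearIndependent ℂ ![v, w]) (h0 : Polynomial.X ^ 3 ∣ lp v w (Mem φ c0 c1)) 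
    (h1 : Polynomial.X ^ 2 ∣ lp w v (Mem φ c0 c1)) : hB B φ c0 c1 = 0 := by
  by_cases hc0 : c0 = 0
  swap
  · exact kill1 B hK φ c0 c1 v w hc0 hli h0 h1
  subst hc0
  have hc1 : c1 ≠ 0 := hc.resolve_left (by simp)
  let φp : Sg d → Polynomial ℂ := Sum.elim (fun e => Polynomial.C (φ (Sum.inl e)))
    (fun e => Polynomial.C (φ (Sum.inr e)) - Polynomial.X * Polynomial.C (c1⁻¹ * φ (Sum.inl e)))
  have hp : hB B φp Polynomial.X (Polynomial.C c1) = 0 := by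
    apply poly_dense _ Polynomial.X Polynomial.X_ne_zero
    intro t ht
    rw [Polynomial.eval_X] at ht
    have hm := hB_map (Polynomial.aeval t : Polynomial ℂ →ₐ[ℂ] ℂ) B φp Polynomial.X (Polynomial.C c1)
    rw [Polynomial.coe_aeval_eq_eval] at hm
    rw [hm, Polynomial.eval_X, Polynomial.eval_C]
    have e : Mem (fun i => (φp i).eval t) t c1 = Mem φ 0 c1 := by
      rw [Mem, Mem]
      congr 1
      funext e
      simp [φp]
      field_simp
      ring
    exact kill1 B hK _ t c1 v w ht hli (by rw [e]; exact h0) (by rw [e]; exact h1)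
  have hm := hB_map (Polynomial.aeval 0 : Polynomial ℂ →ₐ[ℂ] ℂ) B φp Polynomial.X (Polynomial.C c1)
  rw [Polynomial.coe_aeval_eq_eval, hp, Polynomial.eval_X, Polynomial.eval_C] at hm
  have hφ : (fun i => (φp i).eval 0) = φ := by
    funext i
    rcases i with e | e <;> simp [φp]
  rw [hφ] at hm
  simpa using hm.symm
end FB

end

end part24

section part25
open MvPolynomial

set_option linter.all false
noncomputable section
namespace FB
variable {d : ℕ}

def iot (d : ℕ) : Sg d → (Fin 3 →₀ ℕ) ⊕ (Fin 3 →₀ ℕ) := Sum.map (fun e => e.1) (fun e => e.1)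

def cf (d : ℕ) (F G : MvPolynomial (Fin 3) ℂ) : Sg d → ℂ := fun i => coeffs2 F G (iot d i)

lemma pm_eq (F G : MvPolynomial (Fin 3) ℂ) (hF : F.IsHomogeneous d) (hG : G.IsHomogeneous d) (c0 c1 : ℂ) :
    c0 • F + c1 • G = Mem (cf d F G) c0 c1 := by
  apply MvPolynomial.funext
  intro x
  rw [Mem_eval, map_add, smul_eval, smul_eval, ← fev_coeff F hF x, ← fev_coeff G hG x]
  rfl

lemma Mem_mul (φ : Sg d → ℂ) (s c0 c1 : ℂ) : Mem φ (s * c0) (s * c1) = C s * Mem φ c0 c1 := by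
  apply MvPolynomial.funext
  intro x
  rw [map_mul, eval_C, Mem_eval, Mem_eval]
  ring

lemma li_of_ell (v w : Fin 3 → ℂ) (h : v 2 * w 0 - v 0 * w 2 ≠ 0) : LinearIndependent ℂ ![v, w] := by
  rw [LinearIndependent.pair_iff]
  intro s t hst
  have h0 := congrFun hst 0
  have h2 := congrFun hst 2
  simp only [Pi.add_apply, Pi.smul_apply, smul_eq_mul, Pi.zero_apply] at h0 h2
  constructor
  · have : s * (v 2 * w 0 - v 0 * w 2) = 0 := by linear_combination w 0 * h2 - w 2 * h0
    exact (mul_eq_zero.1 this).resolve_right h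
  · have : t * (v 2 * w 0 - v 0 * w 2) = 0 := by linear_combination v 2 * h0 - v 0 * h2
    exact (mul_eq_zero.1 this).resolve_right h

/-- the data produced for each degree -/
def Data (d N : ℕ) (B : Polynomial (A d)) (a : A d) : Prop := 
   a ≠ 0 ∧ Kills B ∧ B.natDegree = N ∧
    ∀ ψ : A d →+* ℂ, ψ a ≠ 0 → ψ B.leadingCoeff ≠ 0 ∧ (∀ r, B.eval₂ ψ r = 0 → B.derivative.eval₂ ψ r ≠ 0) ∧
      ∀ r, B.eval₂ ψ r = 0 → ∃ z : Gv → ℂ, z (gc 1) = r ∧ (∀ g ∈ cts d, eval₂ ψ z g = 0) ∧ 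
        ∀ g ∈ ({X (gp 0 2) * X (gp 1 0) - X (gp 0 0) * X (gp 1 2)} : Finset (T d)), eval₂ ψ z g ≠ 0

def pt (r : ℂ) : Projectivization ℂ (Fin 2 → ℂ) := Projectivization.mk ℂ ![1, r] (by
  intro h; have := congrFun h 0; simp at this)

lemma pt_inj : Function.Injective pt := by
  intro r s h
  rw [pt, pt, Projectivization.mk_eq_mk_iff'] at h
  obtain ⟨a, ha⟩ := h
  have h0 := congrFun ha 0
  have h1 := congrFun ha 1
  simp at h0 h1
  rw [h0] at h1
  simpa using h1.symm

lemma members_eq (N : ℕ) (B : Polynomial (A d)) (a : A d) (hD : Data d N B a) (F G : MvPolynomial (Fin 3) ℂ)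
    (hF : F.IsHomogeneous d) (hG : G.IsHomogeneous d) (ha : aeval (cf d F G) a ≠ 0) :
    flexBitangentMembers F G = pt '' {r | B.eval₂ (aeval (cf d F G) : A d →ₐ[ℂ] ℂ).toRingHom r = 0} := by
  obtain ⟨_, hK, _, hψ⟩ := hD
  obtain ⟨hl, _, hz⟩ := hψ (aeval (cf d F G) : A d →ₐ[ℂ] ℂ).toRingHom ha
  set φ := cf d F G with hφ
  ext c
  constructor
  · rintro ⟨v, w, hli, h0, h1⟩
    have hm : pencilMember F G c = Mem φ (c.rep 0) (c.rep 1) := pm_eq F G hF hG _ _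
    rw [hm] at h0 h1
    have hc : c.rep 0 ≠ 0 ∨ c.rep 1 ≠ 0 := by
      by_contra hcon
      push Not at hcon
      apply c.rep_nonzero
      funext i; fin_cases i
      · exact hcon.1
      · exact hcon.2
    have hk := kill2 B hK φ _ _ v w hc hli h0 h1
    have hc0 : c.rep 0 ≠ 0 := by
      intro h
      rw [h, hB_zero] at hk
      have := hc.resolve_left (by simpa using h)
      exact (mul_ne_zero hl (pow_ne_zero _ this)) hk
    rw [hB_eq _ _ _ _ hc0] at hk
    refine ⟨c.rep 1 / c.rep 0, (mul_eq_zero.1 hk).resolve_left (pow_ne_zero _ hc0), ?_⟩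
    conv_rhs => rw [← c.mk_rep]
    rw [pt, Projectivization.mk_eq_mk_iff']
    refine ⟨(c.rep 0)⁻¹, ?_⟩
    funext i; fin_cases i
    · simp [hc0]
    · simp; field_simp
  · rintro ⟨r, hr, rfl⟩
    obtain ⟨z, hz1, hcts, hne⟩ := hz r hr
    have hz0 : z (gc 0) = 1 := by
      have := hcts (X (gc 0) - 1) (by simp [cts])
      rw [eval₂_sub, eval₂_X, eval₂_one] at this
      linear_combination this
    have hψX : (fun i => (aeval φ : A d →ₐ[ℂ] ℂ).toRingHom (X i)) = φ := by
      funext i; exact aeval_X _ _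
    have hd0 : Polynomial.X ^ 3 ∣ lp (pp z 0) (pp z 1) (Mem φ 1 r) := by
      rw [Polynomial.X_pow_dvd_iff]
      intro j hj
      have := hcts (ctc 0 1 j) (by
        simp only [cts, Finset.mem_union, Finset.mem_image, Finset.mem_range]
        exact Or.inl (Or.inl ⟨j, hj, rfl⟩))
      rw [eval_ctc, hψX, hz0, hz1] at this
      exact this
    have hd1 : Polynomial.X ^ 2 ∣ lp (pp z 1) (pp z 0) (Mem φ 1 r) := by
      rw [Polynomial.X_pow_dvd_iff]
      intro j hj
      have := hcts (ctc 1 0 j) (by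
        simp only [cts, Finset.mem_union, Finset.mem_image, Finset.mem_range]
        exact Or.inl (Or.inr ⟨j, hj, rfl⟩))
      rw [eval_ctc, hψX, hz0, hz1] at this
      exact this
    have hli : LinearIndependent ℂ ![pp z 0, pp z 1] := by
      apply li_of_ell
      have := hne _ (Finset.mem_singleton_self _)
      rw [eval₂_sub, eval₂_mul, eval₂_mul, eval₂_X, eval₂_X, eval₂_X, eval₂_X] at this
      exact this
    obtain ⟨s, hs⟩ := Projectivization.exists_smul_eq_mk_rep ℂ ![1, r] (by
      intro h; have := congrFun h 0; simp at this)
    have hm : pencilMember F G (pt r) = C (s : ℂ) * Mem φ 1 r := by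
      rw [← Mem_mul]
      refine (pm_eq F G hF hG _ _).trans ?_
      have e0 := congrFun hs 0
      have e1 := congrFun hs 1
      change s.1 * 1 = _ at e0
      change s.1 * r = _ at e1
      rw [e0, e1]; rfl
    refine ⟨pp z 0, pp z 1, hli, ?_, ?_⟩
    · rw [ContactLE, hm]
      change _ ∣ lp _ _ _
      rw [lp_mul]
      exact Dvd.dvd.mul_left hd0 _
    · rw [ContactLE, hm]
      change _ ∣ lp _ _ _
      rw [lp_mul]
      exact Dvd.dvd.mul_left hd1 _

lemma root_count (N : ℕ) (B : Polynomial (A d)) (a : A d) (hD : Data d N B a) (ψ : A d →+* ℂ) (ha : ψ a ≠ 0) :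
    {r | B.eval₂ ψ r = 0}.Finite ∧ {r | B.eval₂ ψ r = 0}.ncard = N := by
  obtain ⟨_, hK, hN, hψ⟩ := hD
  obtain ⟨hl, hs, _⟩ := hψ ψ ha
  set P := B.map ψ with hP
  have hPd : P.natDegree = N := by rw [hP, Polynomial.natDegree_map_of_leadingCoeff_ne_zero _ hl, hN]
  have hP0 : P ≠ 0 := by
    intro h
    apply hl
    rw [← Polynomial.leadingCoeff_map_of_leadingCoeff_ne_zero _ hl, ← hP, h, Polynomial.leadingCoeff_zero]
  have hset : {r | B.eval₂ ψ r = 0} = (P.roots.toFinset : Set ℂ) := by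
    ext r
    simp only [Set.mem_setOf_eq, Finset.mem_coe, Multiset.mem_toFinset]
    rw [Polynomial.mem_roots hP0, Polynomial.IsRoot, hP, Polynomial.eval_map]
  have hnd : P.roots.Nodup := by
    rw [Multiset.nodup_iff_count_le_one]
    intro r
    rw [Polynomial.count_roots]
    by_contra hcon
    push Not at hcon
    rw [Polynomial.one_lt_rootMultiplicity_iff_isRoot hP0] at hcon
    obtain ⟨h1, h2⟩ := hcon
    rw [Polynomial.IsRoot, hP, Polynomial.derivative_map, Polynomial.eval_map] at h2
    rw [Polynomial.IsRoot, hP, Polynomial.eval_map] at h1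
    exact hs r h1 h2
  rw [hset]
  refine ⟨Finset.finite_toSet _, ?_⟩
  rw [Set.ncard_coe_finset, Multiset.toFinset_card_of_nodup hnd, ← hPd]
  exact (IsAlgClosed.splits P).natDegree_eq_card_roots.symm

lemma li_forms (φ : Sg d → ℂ) (e0 e1 : E d) (h : φ (Sum.inl e0) * φ (Sum.inr e1) - φ (Sum.inl e1) * φ (Sum.inr e0) ≠ 0) :
    LinearIndependent ℂ ![(mkF (fun e => φ (Sum.inl e)) : MvPolynomial (Fin 3) ℂ), mkF (fun e => φ (Sum.inr e))] := by
  rw [LinearIndependent.pair_iff]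
  intro s t hst
  have h0 := congrArg (coeff e0.1) hst
  have h1 := congrArg (coeff e1.1) hst
  simp only [coeff_add, coeff_smul, coeff_mkF, smul_eq_mul, coeff_zero] at h0 h1
  constructor
  · have : s * (φ (Sum.inl e0) * φ (Sum.inr e1) - φ (Sum.inl e1) * φ (Sum.inr e0)) = 0 := by
      linear_combination φ (Sum.inr e1) * h0 - φ (Sum.inr e0) * h1
    exact (mul_eq_zero.1 this).resolve_right h
  · have : t * (φ (Sum.inl e0) * φ (Sum.inr e1) - φ (Sum.inl e1) * φ (Sum.inr e0)) = 0 := by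
      linear_combination φ (Sum.inl e0) * h1 - φ (Sum.inl e1) * h0
    exact (mul_eq_zero.1 this).resolve_right h

lemma exists_E (hd : 1 ≤ d) : ∃ e0 e1 : E d, e0 ≠ e1 := by
  have h : ∀ i : Fin 3, Finsupp.single i d ∈ Finset.finsuppAntidiag (Finset.univ : Finset (Fin 3)) d := by
    intro i
    rw [Finset.mem_finsuppAntidiag]
    exact ⟨by simp [Finsupp.single_apply], by simp⟩
  refine ⟨⟨_, h 0⟩, ⟨_, h 1⟩, ?_⟩
  intro he
  have := congrArg (fun e : E d => e.1 0) he
  simp at this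
  omega

theorem final_of (hd : 1 ≤ d) (N : ℕ) (B : Polynomial (A d)) (a : A d) (hD : Data d N B a) :
    ∃ Q : MvPolynomial ((Fin 3 →₀ ℕ) ⊕ (Fin 3 →₀ ℕ)) ℂ,
      (∃ F G : MvPolynomial (Fin 3) ℂ, F.IsHomogeneous d ∧ G.IsHomogeneous d ∧
          LinearIndependent ℂ ![F, G] ∧ MvPolynomial.eval (coeffs2 F G) Q ≠ 0) ∧
      ∀ F G : MvPolynomial (Fin 3) ℂ, F.IsHomogeneous d → G.IsHomogeneous d →
        LinearIndependent ℂ ![F, G] → MvPolynomial.eval (coeffs2 F G) Q ≠ 0 →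
          (flexBitangentMembers F G).Finite ∧
            (flexBitangentMembers F G).ncard = N := by
  have hev : ∀ F G, MvPolynomial.eval (coeffs2 F G) (rename (iot d) a) = aeval (cf d F G) a := by
    intro F G
    rw [eval_rename]; rfl
  refine ⟨rename (iot d) a, ?_, ?_⟩
  · obtain ⟨e0, e1, he⟩ := exists_E hd
    let m : A d := X (Sum.inl e0) * X (Sum.inr e1) - X (Sum.inl e1) * X (Sum.inr e0)
    have hm : m ≠ 0 := by
      classical
      intro h
      have := congrArg (eval (fun i : Sg d => if i = Sum.inl e0 ∨ i = Sum.inr e1 then (1 : ℂ) else 0)) h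
      simp [m, he, he.symm] at this
    have ham : a * m ≠ 0 := mul_ne_zero hD.1 hm
    obtain ⟨φ, hφ⟩ : ∃ φ : Sg d → ℂ, eval φ (a * m) ≠ 0 := by
      by_contra hcon
      push Not at hcon
      apply ham
      apply MvPolynomial.funext
      intro x; rw [hcon, map_zero]
    rw [map_mul] at hφ
    refine ⟨mkF (fun e : E d => φ (Sum.inl e)), mkF (fun e : E d => φ (Sum.inr e)), mkF_hom _, mkF_hom _, ?_, ?_⟩
    · apply li_forms φ e0 e1
      have := right_ne_zero_of_mul hφ
      simpa [m] using this
    · rw [hev]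
      have : cf d (mkF (fun e : E d => φ (Sum.inl e))) (mkF (fun e : E d => φ (Sum.inr e))) = φ := by
        funext i
        rcases i with e | e
        · exact coeff_mkF _ e
        · exact coeff_mkF _ e
      rw [this]
      exact left_ne_zero_of_mul hφ
  · intro F G hF hG _ ha
    rw [hev] at ha
    rw [members_eq N B a hD F G hF hG ha]
    obtain ⟨h1, h2⟩ := root_count N B a hD (aeval (cf d F G) : A d →ₐ[ℂ] ℂ).toRingHom ha
    refine ⟨h1.image _, ?_⟩
    rw [Set.ncard_image_of_injective _ pt_inj, h2]

lemma data_ge5 (n : ℕ) : ∃ B a, Data (n+5) (NNum n) B a := by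
  obtain ⟨B, a, h1, h2, h3, h4⟩ := main_gen n
  exact ⟨B, a, h1, kills_gen n (by omega) B h2, h3, h4⟩

lemma data_le4 (a : A d) (ha : a ≠ 0) (h : Kills (Polynomial.C a)) : ∃ B a, Data d 0 B a := by
  refine ⟨Polynomial.C a, a, ha, h, Polynomial.natDegree_C a, ?_⟩
  intro ψ hψ
  refine ⟨by simpa using hψ, ?_, ?_⟩
  · intro r hr; rw [Polynomial.eval₂_C] at hr; exact absurd hr hψ
  · intro r hr; rw [Polynomial.eval₂_C] at hr; exact absurd hr hψ
end FB

end

end part25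

section part26
open MvPolynomial

set_option linter.all false
noncomputable section
namespace FB
variable {d : ℕ}

abbrev V4 (d : ℕ) : Type := {e : E d // e.1 1 ≠ 0} ⊕ (E d ⊕ Fin 3)
abbrev S4 (d : ℕ) : Type := MvPolynomial (V4 d) ℂ

def f4 (e : E d) : S4 d := by
  classical
  exact if h : e.1 1 ≠ 0 then X (Sum.inl ⟨e, h⟩) else 0

def sub4 (d : ℕ) : Fin 3 → MvPolynomial (Fin 3) (S4 d) :=
  ![X 0, - (C (X (Sum.inr (Sum.inr 1))) * X 0 + C (X (Sum.inr (Sum.inr 2))) * X 2), X 2]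

def P4 (d : ℕ) : MvPolynomial (Fin 3) (S4 d) :=
  fev (fun e : E d => C (f4 e + X (Sum.inr (Sum.inr 0)) * X (Sum.inr (Sum.inl e)))) (sub4 d)

def phi4 : Sg d → S4 d
  | Sum.inl e => if e.1 1 ≠ 0 then f4 e else - coeff e.1 (P4 d)
  | Sum.inr e => X (Sum.inr (Sum.inl e))

lemma card4 (hd : 3 ≤ d) : Fintype.card (V4 d) < Fintype.card (Sg d) := by
  classical
  have h1 : Fintype.card {e : E d // e.1 1 ≠ 0} + Fintype.card {e : E d // ¬ e.1 1 ≠ 0} = Fintype.card (E d) := by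
    rw [← Fintype.card_sum]
    exact Fintype.card_congr (Equiv.sumCompl (fun e : E d => e.1 1 ≠ 0))
  have h2 : 4 ≤ Fintype.card {e : E d // ¬ e.1 1 ≠ 0} := by
    have hm : ∀ i : Fin 4, Finsupp.single 0 i.1 + Finsupp.single 2 (d - i.1) ∈ Finset.finsuppAntidiag (Finset.univ : Finset (Fin 3)) d := by
      intro i
      rw [Finset.mem_finsuppAntidiag]
      refine ⟨?_, by simp⟩
      have := i.2
      simp [Fin.sum_univ_three, Finsupp.single_apply]
      omega
    let f : Fin 4 → {e : E d // ¬ e.1 1 ≠ 0} := fun i => ⟨⟨_, hm i⟩, by simp [Finsupp.single_apply]⟩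
    have hf : Function.Injective f := by
      intro i j h
      have := congrArg (fun e : {e : E d // ¬ e.1 1 ≠ 0} => e.1.1 0) h
      simp [f, Finsupp.single_apply] at this
      exact Fin.ext this
    simpa using Fintype.card_le_of_injective f hf
  simp only [Fintype.card_sum, Fintype.card_fin]
  omega

lemma exists_a4 (hd : 3 ≤ d) : ∃ a : A d, a ≠ 0 ∧ aeval (phi4 : Sg d → S4 d) a = 0 := by
  by_contra hcon
  push Not at hcon
  have hi : AlgebraicIndependent ℂ (phi4 : Sg d → S4 d) := by
    rw [algebraicIndependent_iff]
    intro p hp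
    by_contra h0
    exact hcon p h0 hp
  have := hi.cardinalMk_le_trdeg
  rw [MvPolynomial.trdeg_of_isDomain, Cardinal.lift_id, Cardinal.mk_fintype, Cardinal.mk_fintype] at this
  have h2 := card4 hd
  have h3 : Fintype.card (Sg d) ≤ Fintype.card (V4 d) := by exact_mod_cast this
  omega

def rho4 (φ : Sg d → ℂ) (c a b : ℂ) : S4 d →ₐ[ℂ] ℂ :=
  aeval (Sum.elim (fun e => φ (Sum.inl e.1)) (Sum.elim (fun e => φ (Sum.inr e)) ![c, a, b]))

lemma rho4_f4 (φ : Sg d → ℂ) (c a b : ℂ) (e : E d) : rho4 φ c a b (f4 e) = if e.1 1 ≠ 0 then φ (Sum.inl e) else 0 := by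
  rw [f4]
  split_ifs with h
  · simp [rho4]
  · simp

lemma rho4_P4 (φ : Sg d → ℂ) (c a b : ℂ) (h : ∀ x : Fin 3 → ℂ, x 1 = -(a * x 0 + b * x 2) → fev (fun e => φ (Sum.inl e)) x + c * fev (fun e => φ (Sum.inr e)) x = 0) :
    map (rho4 φ c a b : S4 d →+* ℂ) (P4 d) = mkF (fun e : E d => if e.1 1 ≠ 0 then 0 else - φ (Sum.inl e)) := by
  apply MvPolynomial.funext
  intro x
  rw [mkF_eval, P4, map_fev, map_fev]
  have hs : (fun i => (eval x : MvPolynomial (Fin 3) ℂ →+* ℂ) (map (rho4 φ c a b : S4 d →+* ℂ) (sub4 d i))) = ![x 0, -(a * x 0 + b * x 2), x 2] := by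
    funext i
    fin_cases i
    · simp [sub4]
    · simp [sub4, rho4]
    · simp [sub4]
  rw [hs]
  have hc : (fun e : E d => (eval x : MvPolynomial (Fin 3) ℂ →+* ℂ) (map (rho4 φ c a b : S4 d →+* ℂ) (C (f4 e + X (Sum.inr (Sum.inr 0)) * X (Sum.inr (Sum.inl e))))))
      = fun e => (if e.1 1 ≠ 0 then φ (Sum.inl e) else 0) + c * φ (Sum.inr e) := by
    funext e
    rw [map_C, eval_C]
    have := rho4_f4 φ c a b e
    change rho4 φ c a b _ = _
    rw [map_add, map_mul, this]
    simp [rho4]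
  rw [hc, fev_add]
  set y : Fin 3 → ℂ := ![x 0, -(a * x 0 + b * x 2), x 2] with hy
  have h1 := h y (by simp [hy])
  have h2 : fev (fun e : E d => if e.1 1 ≠ 0 then 0 else - φ (Sum.inl e)) x = fev (fun e : E d => if e.1 1 ≠ 0 then 0 else - φ (Sum.inl e)) y := by
    rw [fev, fev]
    refine Finset.sum_congr rfl fun e _ => ?_
    by_cases he : e.1 1 = 0
    · simp only [Fin.prod_univ_three, he, hy]
      simp
    · simp [he]
  have h3 : (fun e : E d => φ (Sum.inl e)) = fun e => (if e.1 1 ≠ 0 then φ (Sum.inl e) else 0) - (if e.1 1 ≠ 0 then 0 else - φ (Sum.inl e)) := by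
    funext e; split_ifs <;> simp
  rw [h3, fev_sub] at h1
  rw [h2]
  linear_combination h1

lemma rho4_phi4 (φ : Sg d → ℂ) (c a b : ℂ) (h : ∀ x : Fin 3 → ℂ, x 1 = -(a * x 0 + b * x 2) → fev (fun e => φ (Sum.inl e)) x + c * fev (fun e => φ (Sum.inr e)) x = 0)
    (i : Sg d) : rho4 φ c a b (phi4 i) = φ i := by
  rcases i with e | e
  · simp only [phi4]
    split_ifs with he
    · rw [rho4_f4, if_pos he]
    · rw [map_neg]
      have := congrArg (coeff e.1) (rho4_P4 φ c a b h)
      rw [coeff_mkF, coeff_map, if_neg he] at this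
      have h2 : rho4 φ c a b (coeff e.1 (P4 d)) = - φ (Sum.inl e) := this
      rw [h2, neg_neg]
  · simp [phi4, rho4]

lemma kills4 (hd : 3 ≤ d) (hd' : d ≤ 4) (a : A d) (ha : aeval (phi4 : Sg d → S4 d) a = 0) : Kills (Polynomial.C a) := by
  intro φ c0 c1 v w hg
  rw [Polynomial.eval₂_C]
  have hz := good_zero hd hd' hg
  have hu : crs v w 1 ≠ 0 := hg.l
  have hc := hg.hc0
  have h : ∀ x : Fin 3 → ℂ, x 1 = -(crs v w 0 / crs v w 1 * x 0 + crs v w 2 / crs v w 1 * x 2) → fev (fun e => φ (Sum.inl e)) x + (c1 / c0) * fev (fun e => φ (Sum.inr e)) x = 0 := by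
    intro x hx
    have h1 : dt (crs v w) x = 0 := by
      rw [dt, hx]; field_simp; ring
    have h2 := hz x h1
    rw [Mem_eval] at h2
    field_simp
    linear_combination h2
  have h3 := congrArg (rho4 φ (c1 / c0) (crs v w 0 / crs v w 1) (crs v w 2 / crs v w 1)) ha
  rw [map_zero, ← AlgHom.comp_apply, comp_aeval] at h3
  have e : (fun i => rho4 φ (c1 / c0) (crs v w 0 / crs v w 1) (crs v w 2 / crs v w 1) (phi4 i)) = φ := by
    funext i; exact rho4_phi4 φ _ _ _ h i
  rw [e] at h3
  exact h3

theorem all_data (hd : 3 ≤ d) : ∃ N : ℕ, (N : ℤ) = 3 * ((d : ℤ) ^ 2 + 6 * (d : ℤ) - 4) * ((d : ℤ) - 3) * ((d : ℤ) - 4) ∧ ∃ B a, Data d N B a := by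
  by_cases h : d ≤ 4
  · obtain ⟨a, ha, ha'⟩ := exists_a4 hd
    refine ⟨0, ?_, data_le4 a ha (kills4 hd h a ha')⟩
    have : d = 3 ∨ d = 4 := by omega
    rcases this with rfl | rfl <;> norm_num
  · obtain ⟨n, rfl⟩ : ∃ n, d = n + 5 := ⟨d - 5, by omega⟩
    refine ⟨NNum n, ?_, data_ge5 n⟩
    rw [NNum]; push_cast; ring
end FB


end

end part26

/-- For a general pencil of degree-`d` plane curves, the number of members admitting a
flex bitangent line is `3(d² + 6d − 4)(d − 3)(d − 4)`. -/
theorem flex_bitangent_count (d : ℕ) (hd : 3 ≤ d) :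
    ∃ Q : MvPolynomial ((Fin 3 →₀ ℕ) ⊕ (Fin 3 →₀ ℕ)) ℂ,
      (∃ F G : MvPolynomial (Fin 3) ℂ, F.IsHomogeneous d ∧ G.IsHomogeneous d ∧
          LinearIndependent ℂ ![F, G] ∧ MvPolynomial.eval (coeffs2 F G) Q ≠ 0) ∧
      ∀ F G : MvPolynomial (Fin 3) ℂ, F.IsHomogeneous d → G.IsHomogeneous d →
        LinearIndependent ℂ ![F, G] → MvPolynomial.eval (coeffs2 F G) Q ≠ 0 →
          (flexBitangentMembers F G).Finite ∧
            ((flexBitangentMembers F G).ncard : ℤ) =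
              3 * ((d : ℤ) ^ 2 + 6 * (d : ℤ) - 4) * ((d : ℤ) - 3) * ((d : ℤ) - 4) := by
  obtain ⟨N, hN, B, a, hD⟩ := FB.all_data hd
  obtain ⟨Q, h1, h2⟩ := FB.final_of (by omega) N B a hD
  refine ⟨Q, h1, fun F G hF hG hl hQ => ?_⟩
  obtain ⟨h3, h4⟩ := h2 F G hF hG hl hQ
  exact ⟨h3, by rw [h4, hN]⟩
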